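/- arXiv:2602.07552 — 5 statements merged into one kernel-verified Lean document; each statement's English description precedes it below -/
import Mathlib

section
/- Let d ≥ 1 be an integer and let 𝒞 be a family of open subsets of ℝ^d such that the intersection of every nonempty finite subfamily of 𝒞 is either empty or contractible. Then for every finite subfamily ℱ ⊆ 𝒞 with ⋂ℱ = ∅ there exists a subfamily 𝒢 ⊆ ℱ with at most d+1 elements and ⋂𝒢 = ∅. -/
section Scarf

variable {T ι L : Type*} [LinearOrder L]

/-- A pair `(σ, C)` is dominant for the orders `r i` if no point of `T` lies, in every
order `i ∈ C`, strictly above the minimum of `σ` in that order. -/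
def IsDominant (r : ι → T → L) (σ : Finset T) (C : Finset ι) : Prop :=
  ∀ y, ∃ i ∈ C, ∀ x ∈ σ, r i y ≤ r i x

variable {r : ι → T → L} {μ : ι → T} {σ : Finset T} {C : Finset ι}

variable [DecidableEq T]

theorem IsDominant.subset_image (hr : ∀ i, Function.Injective (r i))
    (hμ : ∀ k, μ k ∈ σ ∧ ∀ x ∈ σ, r k (μ k) ≤ r k x) (h : IsDominant r σ C) :
    σ ⊆ C.image μ := by
  intro x hx
  obtain ⟨i, hi, hix⟩ := h x
  exact Finset.mem_image.2 ⟨i, hi, hr i (le_antisymm ((hμ i).2 x hx) (hix _ (hμ i).1))⟩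

variable [DecidableEq ι]

/-- `IsFacePair p q` says that `p` arises from `q` by removing a point from the first component
or by adding an index to the second one. -/
def IsFacePair (p q : Finset T × Finset ι) : Prop :=
  (∃ y ∉ p.1, q = (insert y p.1, p.2)) ∨ ∃ i ∉ q.2, p = (q.1, insert i q.2)

/-- `ExtendsAway r μ σ C a q` says that `q` is a dominant pair obtained from `(σ, C)` by removing
the index `a`, or by adding a point lying above the minima `μ k` for all `k ≠ a`. -/
def ExtendsAway (r : ι → T → L) (μ : ι → T) (σ : Finset T) (C : Finset ι) (a : ι)
    (q : Finset T × Finset ι) : Prop :=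
  IsDominant r q.1 q.2 ∧ (q = (σ, C.erase a) ∨
    ∃ y ∉ σ, (∀ k ∈ C.erase a, r k (μ k) < r k y) ∧ q = (insert y σ, C))

theorem existsUnique_extendsAway [Finite T] (hr : ∀ i, Function.Injective (r i))
    (hμ : ∀ k, μ k ∈ σ ∧ ∀ x ∈ σ, r k (μ k) ≤ r k x) (h : IsDominant r σ C) {a : ι}
    (ha : σ ⊆ (C.erase a).image μ) : ∃! q, ExtendsAway r μ σ C a q := by
  by_cases hM : ∃ y, ∀ k ∈ C.erase a, r k (μ k) < r k y
  · obtain ⟨y, hyM, hymax⟩ := Set.exists_max_image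
      {y | ∀ k ∈ C.erase a, r k (μ k) < r k y} (r a) (Set.toFinite _) hM
    simp only [Set.mem_ofPred_eq] at hyM hymax
    have hyσ : y ∉ σ := by
      intro hy
      obtain ⟨k, hk, rfl⟩ := Finset.mem_image.1 (ha hy)
      exact lt_irrefl _ (hyM k hk)
    refine ⟨(insert y σ, C), ⟨?_, Or.inr ⟨y, hyσ, hyM, rfl⟩⟩, ?_⟩
    · intro z
      by_contra! hz
      have hzM : ∀ k ∈ C.erase a, r k (μ k) < r k z := by
        intro k hk
        obtain ⟨x, hx, hxz⟩ := hz k (Finset.mem_of_mem_erase hk)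
        rcases Finset.mem_insert.1 hx with rfl | hx
        · exact (hyM k hk).trans hxz
        · exact ((hμ k).2 x hx).trans_lt hxz
      obtain ⟨k, hk, hkz⟩ := h z
      have hka : k = a := by
        by_contra hka
        exact absurd (hkz _ (hμ k).1) (not_le.2 (hzM k (Finset.mem_erase.2 ⟨hka, hk⟩)))
      subst hka
      obtain ⟨x, hx, hxz⟩ := hz k hk
      rcases Finset.mem_insert.1 hx with rfl | hx
      · exact absurd (hymax z hzM) (not_le.2 hxz)
      · exact absurd (hkz x hx) (not_le.2 hxz)
    · rintro q ⟨hq, rfl | ⟨z, hzσ, hzM, rfl⟩⟩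
      · obtain ⟨k, hk, hky⟩ := hq y
        exact absurd (hky _ (hμ k).1) (not_le.2 (hyM k hk))
      · obtain ⟨k, hk, hky⟩ := hq y
        have hka : k = a := by
          by_contra hka
          exact absurd (hky _ (Finset.mem_insert_of_mem (hμ k).1))
            (not_le.2 (hyM k (Finset.mem_erase.2 ⟨hka, hk⟩)))
        subst hka
        rw [hr k (le_antisymm (hymax z hzM) (hky z (Finset.mem_insert_self _ _)))]
  · push Not at hM
    refine ⟨(σ, C.erase a), ⟨fun y ↦ ?_, Or.inl rfl⟩, ?_⟩
    · obtain ⟨k, hk, hky⟩ := hM y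
      exact ⟨k, hk, fun x hx ↦ hky.trans ((hμ k).2 x hx)⟩
    · rintro q ⟨-, rfl | ⟨z, -, hzM, -⟩⟩
      · rfl
      · obtain ⟨k, hk, hkz⟩ := hM z
        exact absurd hkz (not_le.2 (hzM k hk))

theorem ExtendsAway.ne (hμ : ∀ k, μ k ∈ σ) (h : IsDominant r σ C) {a b : ι} (ha : a ∈ C)
    (hab : a ≠ b) {p q : Finset T × Finset ι} (hp : ExtendsAway r μ σ C a p)
    (hq : ExtendsAway r μ σ C b q) : p ≠ q := by
  rintro rfl
  obtain ⟨-, hp⟩ := hp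
  obtain ⟨-, hq⟩ := hq
  rcases hp with rfl | ⟨y, hy, hyM, rfl⟩
  · rcases hq with hq | ⟨z, hz, -, hq⟩
    · rw [Prod.mk.injEq] at hq
      exact Finset.notMem_erase a C (hq.2 ▸ Finset.mem_erase.2 ⟨hab, ha⟩)
    · rw [Prod.mk.injEq] at hq
      exact hz (hq.1 ▸ Finset.mem_insert_self z σ)
  · rcases hq with hq | ⟨z, hz, hzM, hq⟩
    · rw [Prod.mk.injEq] at hq
      exact hy (hq.1 ▸ Finset.mem_insert_self y σ)
    · have hzy : z = y := by
        rw [Prod.mk.injEq] at hq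
        have : z ∈ insert y σ := hq.1 ▸ Finset.mem_insert_self z σ
        exact (Finset.mem_insert.1 this).resolve_right hz
      subst hzy
      obtain ⟨k, hk, hkz⟩ := h z
      refine absurd (hkz _ (hμ k)) (not_le.2 ?_)
      by_cases hka : k = a
      · exact hzM k (Finset.mem_erase.2 ⟨hka ▸ hab, hk⟩)
      · exact hyM k (Finset.mem_erase.2 ⟨hka, hk⟩)

theorem IsFacePair.exists_extendsAway (hr : ∀ i, Function.Injective (r i))
    (hμ : ∀ k, μ k ∈ σ ∧ ∀ x ∈ σ, r k (μ k) ≤ r k x) (hcard : C.card = σ.card + 1)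
    {q : Finset T × Finset ι} (hpq : IsFacePair (σ, C) q) (hq : IsDominant r q.1 q.2) :
    ∃ a ∈ C, σ ⊆ (C.erase a).image μ ∧ ExtendsAway r μ σ C a q := by
  rcases hpq with ⟨y, hy, rfl⟩ | ⟨a, ha, hpq⟩
  · simp only at hy hq
    obtain ⟨k, hk, hky⟩ := hq y
    have hkx : ∀ x ∈ σ, ∃ l ∈ C.erase k, μ l = x ∧ r l x ≤ r l y := by
      intro x hx
      obtain ⟨l, hl, hlx⟩ := hq x
      have hlxy := hlx y (Finset.mem_insert_self _ _)
      refine ⟨l, Finset.mem_erase.2 ⟨?_, hl⟩, ?_, hlxy⟩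
      · rintro rfl
        exact hy (hr l (le_antisymm hlxy (hky x (Finset.mem_insert_of_mem hx))) ▸ hx)
      · exact hr l (le_antisymm ((hμ l).2 x hx) (hlx _ (Finset.mem_insert_of_mem (hμ l).1)))
    have hsub : σ ⊆ (C.erase k).image μ := by
      intro x hx
      obtain ⟨l, hl, hlx, -⟩ := hkx x hx
      exact Finset.mem_image.2 ⟨l, hl, hlx⟩
    have hinj : Set.InjOn μ (C.erase k : Finset ι) := by
      refine Finset.injOn_of_card_image_eq (le_antisymm Finset.card_image_le ?_)
      rw [Finset.card_erase_of_mem hk, hcard]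
      exact Finset.card_le_card hsub
    refine ⟨k, hk, hsub, hq, Or.inr ⟨y, hy, fun l hl ↦ ?_, rfl⟩⟩
    obtain ⟨m, hm, hml, hmy⟩ := hkx (μ l) (hμ l).1
    obtain rfl := hinj hm hl hml
    refine lt_of_le_of_ne hmy fun h ↦ hy (hr m h ▸ (hμ m).1)
  · obtain ⟨rfl, rfl⟩ := Prod.ext_iff.1 hpq
    simp only at *
    refine ⟨a, Finset.mem_insert_self _ _, ?_, hq, Or.inl ?_⟩
    · rw [Finset.erase_insert ha]
      exact hq.subset_image hr hμ
    · rw [Finset.erase_insert ha]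

theorem ExtendsAway.isFacePair {a : ι} (ha : a ∈ C) {q : Finset T × Finset ι}
    (h : ExtendsAway r μ σ C a q) : IsFacePair (σ, C) q := by
  rcases h.2 with rfl | ⟨y, hy, -, rfl⟩
  · exact Or.inr ⟨a, Finset.notMem_erase _ _, by rw [Finset.insert_erase ha]⟩
  · exact Or.inl ⟨y, hy, rfl⟩

open Classical in
theorem card_filter_isFacePair_eq_two [Fintype T] [Fintype ι]
    (hr : ∀ i, Function.Injective (r i)) (h : IsDominant r σ C) (hσ : σ.Nonempty)
    (hcard : C.card = σ.card + 1) :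
    (Finset.univ.filter fun q : Finset T × Finset ι ↦
      IsDominant r q.1 q.2 ∧ IsFacePair (σ, C) q).card = 2 := by
  have hex : ∀ k, ∃ m ∈ σ, ∀ x ∈ σ, r k m ≤ r k x := fun k ↦ σ.exists_min_image (r k) hσ
  choose μ hμ using hex
  obtain ⟨a, ha, b, hb, hab, hμab⟩ := Finset.exists_ne_map_eq_of_card_lt_of_maps_to
    (s := C) (t := σ) (f := μ) (by omega) (fun k _ ↦ (hμ k).1)
  have hsub := h.subset_image hr hμ
  have hsub' : ∀ {c e}, c ≠ e → e ∈ C → μ c = μ e → σ ⊆ (C.erase c).image μ := by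
    intro c e hce he hμce x hx
    obtain ⟨k, hk, rfl⟩ := Finset.mem_image.1 (hsub hx)
    by_cases hkc : k = c
    · exact Finset.mem_image.2 ⟨e, Finset.mem_erase.2 ⟨hce.symm, he⟩, hkc ▸ hμce.symm⟩
    · exact Finset.mem_image.2 ⟨k, Finset.mem_erase.2 ⟨hkc, hk⟩, rfl⟩
  obtain ⟨p, hp, hp'⟩ := existsUnique_extendsAway hr hμ h (hsub' hab hb hμab)
  obtain ⟨q, hq, hq'⟩ := existsUnique_extendsAway hr hμ h (hsub' hab.symm ha hμab.symm)
  refine Finset.card_eq_two.2 ⟨p, q, hp.ne (fun k ↦ (hμ k).1) h ha hab hq, ?_⟩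
  ext s
  simp only [Finset.mem_filter, Finset.mem_univ, true_and, Finset.mem_insert,
    Finset.mem_singleton]
  constructor
  · rintro ⟨hs, hsf⟩
    obtain ⟨c, hc, hcσ, hcs⟩ := hsf.exists_extendsAway hr hμ hcard hs
    have hinj : Set.InjOn μ (C.erase c : Finset ι) := by
      refine Finset.injOn_of_card_image_eq (le_antisymm Finset.card_image_le ?_)
      rw [Finset.card_erase_of_mem hc, hcard]
      exact Finset.card_le_card hcσ
    by_cases hca : c = a
    · subst hca; exact Or.inl (hp' s hcs)
    by_cases hcb : c = b
    · subst hcb; exact Or.inr (hq' s hcs)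
    exact absurd (hinj (by simp [ha, Ne.symm hca]) (by simp [hb, Ne.symm hcb]) hμab) hab
  · rintro (rfl | rfl)
    · exact ⟨hp.1, hp.isFacePair ha⟩
    · exact ⟨hq.1, hq.isFacePair hb⟩

open Classical in
theorem card_filter_isFacePair_empty [Fintype T] [Nonempty T] [Fintype ι]
    (hr : ∀ i, Function.Injective (r i)) (i : ι) :
    (Finset.univ.filter fun q : Finset T × Finset ι ↦
      IsDominant r q.1 q.2 ∧ IsFacePair (∅, {i}) q).card = 1 := by
  obtain ⟨m, hm⟩ := Finite.exists_max (r i)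
  refine Finset.card_eq_one.2 ⟨({m}, {i}), ?_⟩
  ext s
  simp only [Finset.mem_filter, Finset.mem_univ, true_and, Finset.mem_singleton]
  constructor
  · rintro ⟨hs, ⟨y, -, rfl⟩ | ⟨j, hj, hs'⟩⟩
    · obtain ⟨k, hk, hkm⟩ := hs m
      simp only [Finset.mem_singleton] at hk
      subst hk
      rw [hr k (le_antisymm (hm y) (hkm y (Finset.mem_insert_self _ _)))]
      simp
    · obtain ⟨k, hk, -⟩ := hs m
      have h2 : s.2.card = 0 := by
        have := congrArg Finset.card (Prod.ext_iff.1 hs').2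
        simpa [Finset.card_insert_of_notMem hj] using this
      rw [Finset.card_eq_zero.1 h2] at hk
      simp at hk
  · rintro rfl
    refine ⟨fun y ↦ ⟨i, by simp, fun x hx ↦ ?_⟩, Or.inl ⟨m, by simp, by simp⟩⟩
    simp only [Finset.mem_singleton] at hx
    exact hx ▸ hm y

/-- The faces of a pair `(σ, C)` with `σ.card = C.card` that are nearly rainbow coloured, missing
only the colour `i₀`, are even in number unless `σ` is itself rainbow coloured. -/
theorem even_card_filter_isFacePair [Fintype T] [Fintype ι] (c : T → ι) (i₀ : ι)
    (hcard : σ.card = C.card) (hne : σ.image c ≠ C)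
    [DecidablePred fun p : Finset T × Finset ι ↦
      insert i₀ (p.1.image c) = p.2 ∧ p.2.card = p.1.card + 1 ∧ IsFacePair p (σ, C)] :
    Even (Finset.univ.filter fun p : Finset T × Finset ι ↦
      insert i₀ (p.1.image c) = p.2 ∧ p.2.card = p.1.card + 1 ∧ IsFacePair p (σ, C)).card := by
  have hface : ∀ p, (insert i₀ (p.1.image c) = p.2 ∧ p.2.card = p.1.card + 1 ∧
      IsFacePair p (σ, C)) ↔ (∃ x ∈ σ, p = (σ.erase x, C) ∧ insert i₀ ((σ.erase x).image c) = C) ∨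
      ∃ i ∉ C, p = (σ, insert i C) ∧ insert i₀ (σ.image c) = insert i C := by
    rintro ⟨τ, D⟩
    simp only [IsFacePair, Prod.mk.injEq]
    constructor
    · rintro ⟨h1, h2, ⟨y, hy, rfl, rfl⟩ | ⟨i, hi, rfl, rfl⟩⟩
      · exact Or.inl ⟨y, Finset.mem_insert_self _ _, by simp [Finset.erase_insert hy, h1]⟩
      · exact Or.inr ⟨i, hi, by simp [h1]⟩
    · rintro (⟨x, hx, ⟨rfl, rfl⟩, h⟩ | ⟨i, hi, ⟨rfl, rfl⟩, h⟩)
      · exact ⟨h, by rw [Finset.card_erase_add_one hx, hcard],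
          Or.inl ⟨x, Finset.notMem_erase _ _, by simp [Finset.insert_erase hx]⟩⟩
      · exact ⟨h, by rw [Finset.card_insert_of_notMem hi, hcard], Or.inr ⟨i, hi, by simp⟩⟩
  simp only [hface]
  by_cases hA : ∃ i ∉ C, insert i₀ (σ.image c) = insert i C
  · obtain ⟨i, hi, hiC⟩ := hA
    have h1 : (insert i₀ (σ.image c)).card = σ.card + 1 := by
      rw [hiC, Finset.card_insert_of_notMem hi, hcard]
    have h2 := Finset.card_insert_le i₀ (σ.image c)
    have h3 := Finset.card_image_le (s := σ) (f := c)
    have hinj : Set.InjOn c σ := Finset.injOn_of_card_image_eq (by omega)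
    have hi₀ : i₀ ∉ σ.image c := by
      intro h
      rw [Finset.insert_eq_of_mem h] at h1
      omega
    have hii₀ : i ≠ i₀ := by
      rintro rfl
      refine hne ?_
      rw [← Finset.erase_insert hi₀, hiC, Finset.erase_insert hi]
    obtain ⟨x, hx, rfl⟩ : ∃ x ∈ σ, c x = i := by
      have : i ∈ insert i₀ (σ.image c) := hiC ▸ Finset.mem_insert_self _ _
      simpa [hii₀] using this
    have hmem : ∀ k, (k = i₀ ∨ ∃ y ∈ σ, c y = k) ↔ k = c x ∨ k ∈ C := by
      intro k
      have := Finset.ext_iff.1 hiC k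
      simpa using this
    refine (Finset.card_eq_two.2 ⟨(σ.erase x, C), (σ, insert (c x) C), ?_, ?_⟩) ▸ even_two
    · simp [hx]
    · ext p
      simp only [Finset.mem_filter, Finset.mem_univ, true_and, Finset.mem_insert,
        Finset.mem_singleton]
      constructor
      · rintro (⟨y, hy, rfl, h⟩ | ⟨j, hj, rfl, h⟩)
        · left
          have hmem' : ∀ k, (k = i₀ ∨ ∃ z, (z ≠ y ∧ z ∈ σ) ∧ c z = k) ↔ k ∈ C := by
            intro k
            have := Finset.ext_iff.1 h k
            simpa using this
          grind
        · right
          rw [hiC] at h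
          have : c x ∈ insert j C := h ▸ Finset.mem_insert_self _ _
          grind
      · rintro (rfl | rfl)
        · refine Or.inl ⟨x, hx, rfl, ?_⟩
          ext k
          have := hmem k
          simp only [Finset.mem_insert, Finset.mem_image, Finset.mem_erase]
          constructor
          · rintro (rfl | ⟨y, ⟨hyx, hy⟩, rfl⟩)
            · grind
            · have := hinj.ne hy hx hyx
              grind
          · grind
        · exact Or.inr ⟨c x, hi, rfl, hiC⟩
  · by_cases hB : ∃ x ∈ σ, insert i₀ ((σ.erase x).image c) = C
    · obtain ⟨x, hx, hxC⟩ := hB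
      have hinj : Set.InjOn c (σ.erase x : Finset T) ∧ i₀ ∉ (σ.erase x).image c := by
        have h1 := congrArg Finset.card hxC
        have h2 := Finset.card_insert_le i₀ ((σ.erase x).image c)
        have h3 := Finset.card_image_le (s := σ.erase x) (f := c)
        have h4 := Finset.card_erase_add_one hx
        refine ⟨Finset.injOn_of_card_image_eq (by omega), fun h ↦ ?_⟩
        rw [Finset.insert_eq_of_mem h] at h1
        omega
      obtain ⟨hinj, hi₀⟩ := hinj
      have himg : σ.image c = insert (c x) ((σ.erase x).image c) := by
        rw [← Finset.image_insert, Finset.insert_erase hx]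
      have hxi₀ : c x ≠ i₀ := by
        intro h
        exact hne (by rw [himg, h, hxC])
      have hcxC : c x ∈ C := by
        by_contra h
        refine hA ⟨c x, h, ?_⟩
        rw [himg, ← hxC, Finset.insert_comm]
      obtain ⟨y, hy, hyx⟩ : ∃ y ∈ σ.erase x, c y = c x := by
        rw [← hxC] at hcxC
        simpa [hxi₀] using hcxC
      obtain ⟨hne', hyσ⟩ := Finset.mem_erase.1 hy
      refine (Finset.card_eq_two.2 ⟨(σ.erase x, C), (σ.erase y, C), ?_, ?_⟩) ▸ even_two
      · intro h
        rw [Prod.mk.injEq] at h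
        exact Finset.notMem_erase y σ (h.1 ▸ hy)
      · ext p
        simp only [Finset.mem_filter, Finset.mem_univ, true_and, Finset.mem_insert,
          Finset.mem_singleton]
        constructor
        · rintro (⟨z, hz, rfl, h⟩ | ⟨j, hj, rfl, h⟩)
          · by_cases hzx : z = x
            · exact Or.inl (by rw [hzx])
            by_cases hzy : z = y
            · exact Or.inr (by rw [hzy])
            have hz' : c z ∈ C := hxC ▸ Finset.mem_insert_of_mem
              (Finset.mem_image_of_mem c (Finset.mem_erase.2 ⟨hzx, hz⟩))
            rw [← h] at hz'
            have hzi₀ : c z ≠ i₀ := fun h ↦ hi₀ (h ▸ Finset.mem_image_of_mem c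
              (Finset.mem_erase.2 ⟨hzx, hz⟩))
            obtain ⟨w, hw, hwz⟩ := Finset.mem_image.1 ((Finset.mem_insert.1 hz').resolve_left hzi₀)
            obtain ⟨hwz', hwσ⟩ := Finset.mem_erase.1 hw
            by_cases hwx : w = x
            · subst hwx
              exact absurd (hinj (Finset.mem_erase.2 ⟨hzx, hz⟩) hy (hwz.symm.trans hyx.symm)) hzy
            · exact absurd (hinj (Finset.mem_erase.2 ⟨hwx, hwσ⟩)
                (Finset.mem_erase.2 ⟨hzx, hz⟩) hwz) hwz'
          · exact absurd ⟨j, hj, h⟩ hA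
        · rintro (rfl | rfl)
          · exact Or.inl ⟨x, hx, rfl, hxC⟩
          · refine Or.inl ⟨y, hyσ, rfl, ?_⟩
            rw [← hxC]
            congr 1
            ext k
            simp only [Finset.mem_image, Finset.mem_erase]
            grind
    · rw [Finset.filter_false_of_mem, Finset.card_empty]
      · exact Even.zero
      · rintro p - (⟨x, hx, -, h⟩ | ⟨i, hi, -, h⟩)
        · exact hB ⟨x, hx, h⟩
        · exact hA ⟨i, hi, h⟩

theorem IsFacePair.isDominant {p q : Finset T × Finset ι} (hpq : IsFacePair p q)
    (hq : IsDominant r q.1 q.2) : IsDominant r p.1 p.2 := by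
  intro y
  obtain ⟨k, hk, hky⟩ := hq y
  rcases hpq with ⟨z, hz, rfl⟩ | ⟨i, hi, rfl⟩
  · exact ⟨k, hk, fun x hx ↦ hky x (Finset.mem_insert_of_mem hx)⟩
  · exact ⟨k, Finset.mem_insert_of_mem hk, hky⟩

/-- **Scarf's lemma**: if the points of a finite set carry finitely many linear orders and are
coloured by the same index set, some dominant pair is rainbow coloured. -/
theorem exists_isDominant_image_eq [Finite T] [Nonempty T] [Finite ι] [Nonempty ι]
    (hr : ∀ i, Function.Injective (r i)) (c : T → ι) :
    ∃ (σ : Finset T), IsDominant r σ (σ.image c) := by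
  classical
  have := Fintype.ofFinite T
  have := Fintype.ofFinite ι
  by_contra! hno
  let i₀ : ι := Classical.arbitrary ι
  let D := Finset.univ.filter fun p : Finset T × Finset ι ↦
    IsDominant r p.1 p.2 ∧ insert i₀ (p.1.image c) = p.2 ∧ p.2.card = p.1.card + 1
  let R := Finset.univ.filter fun q : Finset T × Finset ι ↦
    IsDominant r q.1 q.2 ∧ q.1.card = q.2.card
  have hsum := Finset.sum_card_bipartiteAbove_eq_sum_card_bipartiteBelow (s := D) (t := R)
    IsFacePair
  have hR : Even (∑ q ∈ R, (D.bipartiteBelow IsFacePair q).card) := by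
    refine Finset.even_sum _ fun q hq ↦ ?_
    obtain ⟨hq, hcard⟩ := (Finset.mem_filter.1 hq).2
    have hne : q.1.image c ≠ q.2 := fun h ↦ hno q.1 (h ▸ hq)
    have hfilter : D.bipartiteBelow IsFacePair q = Finset.univ.filter fun p ↦
        insert i₀ (p.1.image c) = p.2 ∧ p.2.card = p.1.card + 1 ∧ IsFacePair p (q.1, q.2) := by
      ext p
      simp only [Finset.bipartiteBelow, D, Finset.mem_filter, Finset.mem_univ, true_and]
      exact ⟨fun h ↦ ⟨h.1.2.1, h.1.2.2, h.2⟩,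
        fun h ↦ ⟨⟨h.2.2.isDominant hq, h.1, h.2.1⟩, h.2.2⟩⟩
    rw [hfilter]
    exact even_card_filter_isFacePair c i₀ hcard hne
  have habove : ∀ p ∈ D, R.bipartiteAbove IsFacePair p = Finset.univ.filter fun q ↦
      IsDominant r q.1 q.2 ∧ IsFacePair (p.1, p.2) q := by
    intro p hp
    obtain ⟨-, -, hcard⟩ := (Finset.mem_filter.1 hp).2
    ext q
    simp only [Finset.bipartiteAbove, R, Finset.mem_filter, Finset.mem_univ, true_and]
    refine ⟨fun h ↦ ⟨h.1.1, h.2⟩, fun h ↦ ⟨⟨h.1, ?_⟩, h.2⟩⟩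
    rcases h.2 with ⟨y, hy, rfl⟩ | ⟨i, hi, hp'⟩
    · simp only at hy ⊢
      rw [Finset.card_insert_of_notMem hy, hcard]
    · rw [Prod.mk.injEq] at hp'
      rw [hp'.1, hp'.2, Finset.card_insert_of_notMem hi] at hcard
      omega
  have h0 : ((∅, {i₀}) : Finset T × Finset ι) ∈ D := by
    exact Finset.mem_filter.2 ⟨Finset.mem_univ _, fun y ↦ ⟨i₀, by simp⟩, by simp, by simp⟩
  rw [← Finset.add_sum_erase D _ h0, habove _ h0, card_filter_isFacePair_empty hr i₀] at hsum
  have hE : Even (∑ p ∈ D.erase (∅, {i₀}), (R.bipartiteAbove IsFacePair p).card) := by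
    refine Finset.even_sum _ fun p hp ↦ ?_
    obtain ⟨hp0, hp⟩ := Finset.mem_erase.1 hp
    obtain ⟨hdom, himg, hcard⟩ := (Finset.mem_filter.1 hp).2
    rw [habove p hp, card_filter_isFacePair_eq_two hr hdom ?_ hcard]
    · exact even_two
    · rw [Finset.nonempty_iff_ne_empty]
      intro h
      refine hp0 (Prod.ext h ?_)
      simp [← himg, h]
  rw [← hsum] at hR
  exact absurd hR (by rw [Nat.not_even_iff_odd]; exact hE.one_add)

end Scarf

section KKM

variable {ι : Type*} [Fintype ι] [Nonempty ι]

/-- Colour the lattice points of the dilated simplex `{a : ι → ℕ | ∑ i, a i = N}` by `ι`. Some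
cluster of lattice points carries every colour `i` for which the `i`-th coordinate is not small. -/
theorem exists_rainbow_cluster (N : ℕ) (c : (ι → ℕ) → ι) :
    ∃ σ : Finset (ι → ℕ), σ.Nonempty ∧ (∀ a ∈ σ, ∑ i, a i = N) ∧
      (∀ a ∈ σ, ∀ b ∈ σ, ∀ i, a i ≤ b i + Fintype.card ι) ∧
      ∀ a ∈ σ, ∀ i, a i ≤ Fintype.card ι ∨ ∃ b ∈ σ, c b = i := by
  classical
  let T := {a // a ∈ Finset.piAntidiag (Finset.univ : Finset ι) N}
  have hT : ∀ a : T, ∑ i, a.1 i = N := fun a ↦ (Finset.mem_piAntidiag.1 a.2).1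
  have mkT : ∀ a : ι → ℕ, ∑ i, a i = N → a ∈ Finset.piAntidiag (Finset.univ : Finset ι) N :=
    fun a ha ↦ Finset.mem_piAntidiag.2 ⟨ha, fun i _ ↦ Finset.mem_univ i⟩
  have hne : Nonempty T := by
    obtain ⟨j⟩ := ‹Nonempty ι›
    exact ⟨⟨Pi.single j N, mkT _ (by simp)⟩⟩
  let e := Fintype.equivFin T
  let r : ι → T → ℕ ×ₗ Fin (Fintype.card T) := fun i a ↦ toLex (a.1 i, e a)
  have hr : ∀ i, Function.Injective (r i) := by
    intro i a b hab
    have := (Prod.mk.injEq _ _ _ _ ▸ toLex.injective hab : a.1 i = b.1 i ∧ e a = e b)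
    exact e.injective this.2
  have hle : ∀ {i a b}, r i a ≤ r i b → a.1 i ≤ b.1 i := by
    intro i a b hab
    rcases Prod.Lex.toLex_le_toLex.1 hab with h | h
    · exact h.le
    · exact h.1.le
  obtain ⟨σ, hσ⟩ := exists_isDominant_image_eq hr (fun a ↦ c a.1)
  set C := σ.image fun a ↦ c a.1
  obtain ⟨j, hjC, -⟩ := hσ (Classical.arbitrary T)
  have hσne : σ.Nonempty := Finset.image_nonempty.1 ⟨j, hjC⟩
  let m : ι → ℕ := fun i ↦ σ.inf' hσne fun a ↦ a.1 i
  have hm : ∀ i, ∀ a ∈ σ, m i ≤ a.1 i := fun i a ha ↦ Finset.inf'_le _ ha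
  have hsum : N < ∑ i ∈ C, (m i + 1) := by
    by_contra! hN
    let y : ι → ℕ := fun i ↦ (if i ∈ C then m i + 1 else 0) +
      if i = j then N - ∑ i ∈ C, (m i + 1) else 0
    have hy : ∑ i, y i = N := by
      simp only [y, Finset.sum_add_distrib, Finset.sum_ite_mem, Finset.univ_inter,
        Finset.sum_ite_eq', Finset.mem_univ, if_true] at hN ⊢
      omega
    obtain ⟨i, hi, hiy⟩ := hσ ⟨y, mkT y hy⟩
    have : y i ≤ m i := Finset.le_inf' _ _ fun a ha ↦ hle (hiy a ha)
    simp only [y, hi, if_true] at this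
    omega
  have hsum' : N < ∑ i ∈ C, m i + Fintype.card ι := by
    rw [Finset.sum_add_distrib] at hsum
    have := Finset.card_le_univ C
    simp only [Finset.sum_const, smul_eq_mul, mul_one] at hsum
    omega
  have hbound : ∀ a ∈ σ, ∀ i ∈ C, a.1 i ≤ m i + Fintype.card ι := by
    intro a ha i hi
    have h1 : ∑ k ∈ C, a.1 k ≤ N := (Finset.sum_le_univ_sum_of_nonneg (by simp)).trans_eq (hT a)
    rw [← Finset.add_sum_erase C _ hi] at h1 hsum'
    have h2 : ∑ k ∈ C.erase i, m k ≤ ∑ k ∈ C.erase i, a.1 k :=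
      Finset.sum_le_sum fun k _ ↦ hm k a ha
    omega
  have hbound' : ∀ a ∈ σ, ∀ i ∉ C, a.1 i ≤ Fintype.card ι := by
    intro a ha i hi
    have h1 : ∑ k ∈ insert i C, a.1 k ≤ N := (Finset.sum_le_univ_sum_of_nonneg (by simp)).trans_eq (hT a)
    rw [Finset.sum_insert hi] at h1
    have h2 : ∑ k ∈ C, m k ≤ ∑ k ∈ C, a.1 k := Finset.sum_le_sum fun k _ ↦ hm k a ha
    omega
  refine ⟨σ.image Subtype.val, hσne.image _, ?_, ?_, ?_⟩
  · simp only [Finset.forall_mem_image]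
    exact fun a _ ↦ hT a
  · simp only [Finset.forall_mem_image]
    intro a ha b hb i
    by_cases hi : i ∈ C
    · have := hbound a ha i hi
      have := hm i b hb
      omega
    · have := hbound' a ha i hi
      omega
  · simp only [Finset.forall_mem_image]
    intro a ha i
    by_cases hi : i ∈ C
    · obtain ⟨b, hb, hbi⟩ := Finset.mem_image.1 hi
      exact Or.inr ⟨b.1, Finset.mem_image_of_mem _ hb, hbi⟩
    · exact Or.inl (hbound' a ha i hi)

/-- A dual form of the Knaster–Kuratowski–Mazurkiewicz theorem: if closed sets `A i` cover the
standard simplex, some point of the simplex lies in `A i` for each `i` in its support. -/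
theorem exists_mem_stdSimplex_forall_eq_zero_or_mem {A : ι → Set (ι → ℝ)}
    (hA : ∀ i, IsClosed (A i)) (hcover : ∀ x ∈ stdSimplex ℝ ι, ∃ i, x ∈ A i) :
    ∃ x ∈ stdSimplex ℝ ι, ∀ i, x i = 0 ∨ x ∈ A i := by
  classical
  by_contra! hno
  obtain ⟨δ, hδ, hball⟩ := lebesgue_number_lemma_of_metric (isCompact_stdSimplex ℝ ι)
    (c := fun i ↦ {x : ι → ℝ | x i ≠ 0} ∩ (A i)ᶜ)
    (fun i ↦ (isOpen_ne_fun (continuous_apply i) continuous_const).inter (hA i).isOpen_compl)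
    (fun x hx ↦ by
      obtain ⟨i, hi, hxi⟩ := hno x hx
      exact Set.mem_iUnion.2 ⟨i, hi, hxi⟩)
  obtain ⟨N, hN⟩ := exists_nat_gt (Fintype.card ι / δ)
  have hN0 : (0 : ℝ) < N := lt_of_le_of_lt (by positivity) hN
  have hnN : (Fintype.card ι : ℝ) / N < δ := by
    rw [div_lt_iff₀ hδ] at hN
    rw [div_lt_iff₀ hN0]
    linarith
  let p : (ι → ℕ) → ι → ℝ := fun a i ↦ a i / N
  have hp : ∀ a, ∑ i, a i = N → p a ∈ stdSimplex ℝ ι := by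
    intro a ha
    refine ⟨fun i ↦ by positivity, ?_⟩
    rw [← Finset.sum_div, ← Nat.cast_sum, ha, div_self hN0.ne']
  have hcol : ∀ a : ι → ℕ, ∃ i, ∑ i, a i = N → p a ∈ A i := by
    intro a
    by_cases ha : ∑ i, a i = N
    · obtain ⟨i, hi⟩ := hcover _ (hp a ha)
      exact ⟨i, fun _ ↦ hi⟩
    · exact ⟨Classical.arbitrary ι, fun h ↦ absurd h ha⟩
  choose c hc using hcol
  obtain ⟨σ, ⟨a, ha⟩, hσN, hclose, hcolour⟩ := exists_rainbow_cluster N c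
  obtain ⟨i, hi⟩ := hball (p a) (hp a (hσN a ha))
  rcases hcolour a ha i with hai | ⟨b, hb, rfl⟩
  · have : Function.update (p a) i 0 ∈ Metric.ball (p a) δ := by
      rw [Metric.mem_ball, dist_pi_lt_iff hδ]
      intro k
      by_cases hk : k = i
      · subst hk
        rw [Function.update_self, Real.dist_eq, zero_sub, abs_neg, abs_of_nonneg (by positivity)]
        refine lt_of_le_of_lt ?_ hnN
        simp only [p]
        gcongr
      · rw [Function.update_of_ne hk, dist_self]
        exact hδ
    exact (hi this).1 (Function.update_self _ _ _)
  · have : p b ∈ Metric.ball (p a) δ := by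
      rw [Metric.mem_ball, dist_pi_lt_iff hδ]
      intro k
      refine lt_of_le_of_lt ?_ hnN
      have h1 : (b k : ℝ) ≤ a k + Fintype.card ι := by exact_mod_cast hclose b hb a ha k
      have h2 : (a k : ℝ) ≤ b k + Fintype.card ι := by exact_mod_cast hclose a ha b hb k
      rw [Real.dist_eq, ← sub_div, abs_div, abs_of_pos hN0]
      gcongr
      exact abs_sub_le_iff.2 ⟨by linarith, by linarith⟩
    exact (hi this).2 (hc b (hσN b hb))

end KKM

/-- A continuous map sending `A ∩ B` to a contractible open set `W` can be modified off `A`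
so as to send all of `B` to `W`. -/
theorem ContinuousMap.exists_eqOn_mapsTo_of_contractibleSpace.{u, v} {X : Type u} {E : Type v}
    [TopologicalSpace X] [NormalSpace X] [TopologicalSpace E] [TietzeExtension.{u, v} E] {A B : Set X} (hA : IsClosed A)
    (hB : IsClosed B) {W : Set E} (hW : IsOpen W) [ContractibleSpace W] (f : C(X, E))
    (hf : Set.MapsTo f (A ∩ B) W) :
    ∃ g : C(X, E), Set.EqOn g f A ∧ Set.MapsTo g B W := by
  classical
  obtain ⟨p, ⟨H⟩⟩ := id_nullhomotopic W
  obtain ⟨u, hu0, hu1, hu⟩ := exists_continuous_zero_one_of_isClosed (hA.inter hB)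
    (hB.inter (hW.isClosed_compl.preimage f.continuous))
    (Set.disjoint_left.2 fun x hx hx' ↦ hx'.2 (hf hx))
  let v : C(X, unitInterval) := ⟨fun x ↦ Set.projIcc 0 1 zero_le_one (2 * u x), by fun_prop⟩
  let k : X → E := fun x ↦ if h : f x ∈ W then H (v x, ⟨f x, h⟩) else p
  have hkW : ∀ x, k x ∈ W := by
    intro x
    simp only [k]
    split_ifs
    · exact Subtype.coe_prop _
    · exact p.2
  have hkA : Set.EqOn k f (A ∩ B) := by
    intro x hx
    have hv : v x = 0 := by
      have : u x = 0 := hu0 hx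
      simp [v, this]
    simp [k, hf hx, hv]
  have hkB : ContinuousOn k B := by
    intro x hx
    refine ContinuousAt.continuousWithinAt ?_
    by_cases hxW : f x ∈ W
    · have hopen : IsOpen (f ⁻¹' W) := hW.preimage f.continuous
      refine ContinuousOn.continuousAt (s := f ⁻¹' W) ?_ (hopen.mem_nhds hxW)
      rw [continuousOn_iff_continuous_domRestrict]
      have : (f ⁻¹' W).domRestrict k = fun x : f ⁻¹' W ↦ (H (v x, ⟨f x, x.2⟩) : E) := by
        ext y
        have : f y ∈ W := y.2
        exact dif_pos this
      rw [this]
      fun_prop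
    · have hux : u x = 1 := hu1 ⟨hx, hxW⟩
      have hev : ∀ᶠ y in nhds x, 1 / 2 < u y :=
        u.continuous.continuousAt.eventually (lt_mem_nhds (by rw [hux]; norm_num))
      refine (continuousAt_const (y := (p : E))).congr (hev.mono fun y hy ↦ ?_)
      have hv : v y = 1 := Set.projIcc_of_right_le zero_le_one (by linarith)
      simp [k, hv]
  let q : X → E := fun x ↦ if x ∈ A then f x else k x
  have hqA : Set.EqOn q f A := fun x hx ↦ if_pos hx
  have hqB : Set.EqOn q k B := by
    intro x hx
    by_cases hxA : x ∈ A
    · rw [hqA hxA, hkA ⟨hxA, hx⟩]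
    · exact if_neg hxA
  have hq : ContinuousOn q (A ∪ B) :=
    (f.continuous.continuousOn.congr hqA).union_of_isClosed (hkB.congr hqB) hA hB
  obtain ⟨g, hg⟩ := ContinuousMap.exists_restrict_eq (hA.union hB)
    ⟨(A ∪ B).domRestrict q, continuousOn_iff_continuous_domRestrict.1 hq⟩
  have hgq : Set.EqOn g q (A ∪ B) := fun x hx ↦ DFunLike.congr_fun hg ⟨x, hx⟩
  refine ⟨g, fun x hx ↦ ?_, fun x hx ↦ ?_⟩
  · rw [hgq (Or.inl hx), hqA hx]
  · rw [hgq (Or.inr hx), hqB hx]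
    exact hkW x

/-- If the intersections of the open sets `U i` are contractible whenever the corresponding
intersections of closed sets `B i` are nonempty, some continuous map sends each `B i` to `U i`. -/
theorem ContinuousMap.exists_forall_mapsTo_of_contractibleSpace.{u, v, w} {X : Type u}
    {E : Type v} {ι : Type w}
    [TopologicalSpace X] [NormalSpace X] [TopologicalSpace E] [TietzeExtension.{u, v} E] [Nonempty E]
    [Finite ι] {B : ι → Set X} (hB : ∀ i, IsClosed (B i)) {U : ι → Set E}
    (hU : ∀ i, IsOpen (U i))
    (h : ∀ J : Finset ι, J.Nonempty → (⋂ i ∈ J, B i).Nonempty →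
      ContractibleSpace ↥(⋂ i ∈ J, U i)) :
    ∃ g : C(X, E), ∀ i, Set.MapsTo g (B i) (U i) := by
  classical
  have := Fintype.ofFinite ι
  suffices H : ∀ 𝒥 : Finset (Finset ι), IsUpperSet (𝒥 : Set (Finset ι)) →
      (∀ J ∈ 𝒥, J.Nonempty) →
      ∃ g : C(X, E), ∀ J ∈ 𝒥, Set.MapsTo g (⋂ i ∈ J, B i) (⋂ i ∈ J, U i) by
    obtain ⟨g, hg⟩ := H (Finset.univ.filter Finset.Nonempty)
      (fun J K hJK hJ ↦ by simpa using (Finset.mem_filter.1 hJ).2.mono hJK) (by simp)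
    exact ⟨g, fun i ↦ by simpa using hg {i} (by simp)⟩
  intro 𝒥
  induction 𝒥 using Finset.strongInduction with
  | H 𝒥 ih =>
    intro hup hne
    rcases 𝒥.eq_empty_or_nonempty with rfl | h𝒥
    · exact ⟨ContinuousMap.const X (Classical.arbitrary E), by simp⟩
    obtain ⟨J, hJ⟩ := 𝒥.exists_minimal h𝒥
    obtain ⟨f, hf⟩ := ih (𝒥.erase J) (Finset.erase_ssubset hJ.1) (by
      intro K L hKL hK
      obtain ⟨hKJ, hK𝒥⟩ := Finset.mem_erase.1 (Finset.mem_coe.1 hK)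
      refine Finset.mem_coe.2 (Finset.mem_erase.2 ⟨?_, hup hKL hK𝒥⟩)
      rintro rfl
      exact hKJ (le_antisymm hKL (hJ.2 hK𝒥 hKL)))
      (fun K hK ↦ hne K (Finset.mem_of_mem_erase hK))
    by_cases hBJ : (⋂ i ∈ J, B i).Nonempty
    · have hA : IsClosed (⋃ K ∈ 𝒥.erase J, ⋂ i ∈ K, B i) :=
        isClosed_biUnion_finset fun K _ ↦ isClosed_biInter fun i _ ↦ hB i
      have := h J (hne J hJ.1) hBJ
      obtain ⟨g, hgA, hgB⟩ := f.exists_eqOn_mapsTo_of_contractibleSpace hA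
        (isClosed_biInter fun i (_ : i ∈ J) ↦ hB i)
        (isOpen_biInter_finset fun i (_ : i ∈ J) ↦ hU i) (by
          rintro x ⟨hxA, hxB⟩
          obtain ⟨K, hK, hxK⟩ := Set.mem_iUnion₂.1 hxA
          obtain ⟨hKJ, hK⟩ := Finset.mem_erase.1 hK
          have hKJ' : K ∪ J ∈ 𝒥.erase J := by
            refine Finset.mem_erase.2 ⟨fun h ↦ hKJ ?_, hup Finset.subset_union_left hK⟩
            have hsub : K ⊆ J := h ▸ Finset.subset_union_left
            exact le_antisymm hsub (hJ.2 hK hsub)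
          have := hf _ hKJ' (x := x) (by
            simp only [Set.mem_iInter, Finset.mem_union] at hxK hxB ⊢
            exact fun i hi ↦ hi.elim (hxK i) (hxB i))
          simp only [Set.mem_iInter, Finset.mem_union] at this ⊢
          exact fun i hi ↦ this i (Or.inr hi))
      refine ⟨g, fun K hK ↦ ?_⟩
      by_cases hKJ : K = J
      · exact hKJ ▸ hgB
      · have hK' := Finset.mem_erase.2 ⟨hKJ, hK⟩
        intro x hx
        rw [hgA (Set.mem_biUnion (Finset.mem_coe.2 hK') hx)]
        exact hf K hK' hx
    · refine ⟨f, fun K hK ↦ ?_⟩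
      by_cases hKJ : K = J
      · subst hKJ
        exact fun x hx ↦ absurd ⟨x, hx⟩ hBJ
      · exact hf K (Finset.mem_erase.2 ⟨hKJ, hK⟩)

/-- **Helly's topological theorem**, for an indexed family: if more than `d + 1` open subsets of
`ℝ^d` are such that all intersections of proper subfamilies are contractible, they have a common
point. -/
theorem nonempty_iInter_of_contractibleSpace {ι : Type*} [Fintype ι] {d : ℕ}
    (hd : d + 1 < Fintype.card ι) {U : ι → Set (Fin d → ℝ)} (hU : ∀ i, IsOpen (U i))
    (h : ∀ J : Finset ι, J.Nonempty → J ≠ Finset.univ → ContractibleSpace ↥(⋂ i ∈ J, U i)) :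
    (⋂ i, U i).Nonempty := by
  classical
  have hι : Nonempty ι := Fintype.card_pos_iff.1 (by omega)
  have hc : ∀ i, Continuous fun x : stdSimplex ℝ ι ↦ (x : ι → ℝ) i := fun i ↦
    (continuous_apply i).comp continuous_subtype_val
  have hcompact : CompactSpace (stdSimplex ℝ ι) :=
    isCompact_iff_compactSpace.1 (isCompact_stdSimplex ℝ ι)
  by_contra hempty
  obtain ⟨g, hg⟩ := ContinuousMap.exists_forall_mapsTo_of_contractibleSpace
    (B := fun i ↦ {x : stdSimplex ℝ ι | (x : ι → ℝ) i = 0})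
    (fun i ↦ isClosed_eq (hc i) continuous_const) hU (fun J hJ hBJ ↦ h J hJ (by
      rintro rfl
      obtain ⟨x, hx⟩ := hBJ
      have hsum : ∑ i, (x : ι → ℝ) i = 0 :=
        Finset.sum_eq_zero fun i hi ↦ Set.mem_iInter₂.1 hx i hi
      exact zero_ne_one (hsum.symm.trans x.2.2)))
  choose φ hφU hφ hφI using fun i ↦ (hU i).exists_contDiff_support_eq (n := 1)
  have hφg : ∀ i, Continuous fun x ↦ φ i (g x) := fun i ↦ (hφ i).continuous.comp g.continuous
  have hφpos : ∀ i y, y ∈ U i → 0 < φ i y := by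
    intro i y hy
    rw [← hφU i] at hy
    exact lt_of_le_of_ne (hφI i ⟨y, rfl⟩).1 (Ne.symm hy)
  have hlow : ∀ i, ∃ δ > 0, ∀ x : stdSimplex ℝ ι, (x : ι → ℝ) i = 0 → δ ≤ φ i (g x) := fun i ↦
    (isClosed_eq (hc i) continuous_const).isCompact.exists_forall_le'
      (hφg i).continuousOn fun x hx ↦ hφpos i _ (hg i hx)
  choose δ hδ hφδ using hlow
  obtain ⟨i₀, hi₀⟩ := Finite.exists_min δ
  have hdense : Dense (Set.range fun p : (Fin d → ℝ) × ℝ ↦ fun i ↦ p.2 - φ i p.1)ᶜ := by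
    refine ContDiff.dense_compl_range_of_finrank_lt_finrank ?_ (by simpa using hd)
    exact contDiff_pi.2 fun i ↦ contDiff_snd.sub ((hφ i).comp contDiff_fst)
  obtain ⟨v, hv, hvδ⟩ := hdense.exists_dist_lt 0 (half_pos (hδ i₀))
  rw [dist_pi_lt_iff (half_pos (hδ i₀))] at hvδ
  let F : ι → stdSimplex ℝ ι → ℝ := fun i x ↦ φ i (g x) + v i
  let m : stdSimplex ℝ ι → ℝ := fun x ↦ Finset.univ.inf' Finset.univ_nonempty fun i ↦ F i x
  have hF : ∀ i, Continuous (F i) := fun i ↦ (hφg i).add continuous_const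
  have hm : Continuous m := Continuous.finset_inf'_apply _ fun i _ ↦ hF i
  have hmF : ∀ i x, m x ≤ F i x := fun i x ↦ Finset.inf'_le _ (Finset.mem_univ i)
  have hpos : ∀ x, 0 < ∑ i, (F i x - m x) := by
    intro x
    refine lt_of_le_of_ne (Finset.sum_nonneg fun i _ ↦ sub_nonneg.2 (hmF i x)) fun h0 ↦ hv ?_
    rw [eq_comm, Finset.sum_eq_zero_iff_of_nonneg fun i _ ↦ sub_nonneg.2 (hmF i x)] at h0
    refine ⟨(g x, m x), funext fun i ↦ ?_⟩
    have := h0 i (Finset.mem_univ i)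
    simp only [F] at this ⊢
    linarith
  obtain ⟨t, ht, htF⟩ := isCompact_univ.exists_forall_le'
    (continuous_finsetSum _ fun i _ ↦ (hF i).sub hm).continuousOn fun x _ ↦ hpos x
  have hclosed : ∀ i, IsClosed
      ((↑) '' {x : stdSimplex ℝ ι | t * (x : ι → ℝ) i ≤ F i x - m x} : Set (ι → ℝ)) := fun i ↦
    ((isClosed_le (continuous_const.mul (hc i)) ((hF i).sub hm)).isCompact.image
      continuous_subtype_val).isClosed
  obtain ⟨x, hx, hxF⟩ := exists_mem_stdSimplex_forall_eq_zero_or_mem hclosed (by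
    intro x hx
    by_contra! hno
    have hlt : ∀ i, F i ⟨x, hx⟩ - m ⟨x, hx⟩ < t * x i := fun i ↦
      not_le.1 fun hle ↦ hno i ⟨⟨x, hx⟩, hle, rfl⟩
    have hsum := Finset.sum_lt_sum_of_nonempty Finset.univ_nonempty fun i _ ↦ hlt i
    rw [← Finset.mul_sum, hx.2, mul_one] at hsum
    exact absurd (htF ⟨x, hx⟩ (Set.mem_univ _)) (not_le.2 hsum))
  obtain ⟨i, -, hi⟩ := Finset.exists_mem_eq_inf' Finset.univ_nonempty fun i ↦ F i ⟨x, hx⟩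
  have hmi : m ⟨x, hx⟩ = F i ⟨x, hx⟩ := hi
  have hxi : x i = 0 := by
    rcases hxF i with hxi | ⟨y, hy, rfl⟩
    · exact hxi
    · have hy' : t * (y : ι → ℝ) i ≤ F i y - m y := hy
      have hmy : m y = F i y := hmi
      rw [hmy, sub_self] at hy'
      exact le_antisymm (nonpos_of_mul_nonpos_right hy' ht) (y.2.1 i)
  obtain ⟨j, hj⟩ : ∃ j, g ⟨x, hx⟩ ∉ U j := by
    by_contra! hall
    exact hempty ⟨_, Set.mem_iInter.2 hall⟩
  have hφj : φ j (g ⟨x, hx⟩) = 0 := by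
    rw [← hφU j] at hj
    exact Function.notMem_support.1 hj
  have hle := hmF j ⟨x, hx⟩
  have hφi := hφδ i ⟨x, hx⟩ hxi
  have hvi := hvδ i
  have hvj := hvδ j
  simp only [Pi.zero_apply, dist_zero_left, Real.norm_eq_abs, abs_lt] at hvi hvj
  rw [hmi] at hle
  simp only [F, hφj] at hle
  linarith [hi₀ i, hvi.1, hvj.2]


/-- **Helly's topological theorem.**
Let `d ≥ 1` and let `𝒞` be a family of open subsets of `ℝ^d` such that the intersection of
every nonempty finite subfamily of `𝒞` is either empty or contractible. Then for every finite
subfamily `ℱ ⊆ 𝒞` with empty intersection there is a subfamily `𝒢 ⊆ ℱ` with at most `d + 1`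
elements and empty intersection. -/
theorem helly_topological
    (d : ℕ) (hd : 1 ≤ d) (𝒞 : Set (Set (Fin d → ℝ)))
    (hopen : ∀ C ∈ 𝒞, IsOpen C)
    (hgood : ∀ 𝒟 : Finset (Set (Fin d → ℝ)), ↑𝒟 ⊆ 𝒞 → 𝒟.Nonempty →
      ⋂₀ (𝒟 : Set (Set (Fin d → ℝ))) = ∅ ∨
        ContractibleSpace ↥(⋂₀ (𝒟 : Set (Set (Fin d → ℝ)))))
    (ℱ : Finset (Set (Fin d → ℝ))) (hℱ : ↑ℱ ⊆ 𝒞)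
    (hempty : ⋂₀ (ℱ : Set (Set (Fin d → ℝ))) = ∅) :
    ∃ 𝒢 ⊆ ℱ, 𝒢.card ≤ d + 1 ∧ ⋂₀ (𝒢 : Set (Set (Fin d → ℝ))) = ∅ := by
    classical
  obtain ⟨𝒢, h𝒢, hmin⟩ := Finset.exists_minimal
    (s := ℱ.powerset.filter fun 𝒢 : Finset (Set (Fin d → ℝ)) ↦
      ⋂₀ (𝒢 : Set (Set (Fin d → ℝ))) = ∅)
    ⟨ℱ, Finset.mem_filter.2 ⟨Finset.mem_powerset_self ℱ, hempty⟩⟩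
  obtain ⟨h𝒢ℱ, h𝒢empty⟩ := Finset.mem_filter.1 h𝒢
  rw [Finset.mem_powerset] at h𝒢ℱ
  refine ⟨𝒢, h𝒢ℱ, ?_, h𝒢empty⟩
  by_contra! hcard
  have hne : (⋂ C : 𝒢, (C : Set (Fin d → ℝ))).Nonempty := by
    refine nonempty_iInter_of_contractibleSpace (by simpa using hcard)
      (fun C ↦ hopen _ (hℱ (h𝒢ℱ C.2))) fun J hJ hJuniv ↦ ?_
    let 𝒟 : Finset (Set (Fin d → ℝ)) := J.image Subtype.val
    have h𝒟𝒢 : 𝒟 ⊆ 𝒢 := Finset.image_subset_iff.2 fun C _ ↦ C.2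
    have h𝒟 : ⋂₀ (𝒟 : Set (Set (Fin d → ℝ))) = ⋂ C ∈ J, (C : Set (Fin d → ℝ)) := by
      simp only [𝒟, Finset.coe_image, Set.sInter_image, Finset.mem_coe]
    rw [← h𝒟]
    refine (hgood 𝒟 (fun C hC ↦ hℱ (h𝒢ℱ (h𝒟𝒢 hC))) (hJ.image _)).resolve_left fun h ↦ hJuniv ?_
    have hle := hmin (Finset.mem_filter.2 ⟨Finset.mem_powerset.2 (h𝒟𝒢.trans h𝒢ℱ), h⟩) h𝒟𝒢
    refine Finset.eq_univ_of_forall fun C ↦ ?_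
    obtain ⟨C', hC', heq⟩ := Finset.mem_image.1 (hle C.2)
    exact Subtype.ext heq ▸ hC'
  obtain ⟨x, hx⟩ := hne
  exact Set.eq_empty_iff_forall_notMem.1 h𝒢empty x fun C hC ↦ Set.mem_iInter.1 hx ⟨C, hC⟩
end

section
/- Let d ≥ 1 be an integer and let X be a paracompact Hausdorff topological space such that the singular homology H_t(U; ℤ) vanishes for every open subset U ⊆ X and every t ≥ d. Let ℱ be a finite nonempty family of open subsets of X such that: (i) for every 1 ≤ j ≤ d−1 and all (not necessarily distinct) F₁,…,F_j ∈ ℱ, H_{d−j}(F₁ ∩ ⋯ ∩ F_j; ℤ) = 0; (ii) the intersection of any d (not necessarily distinct) members of ℱ is either empty or path-connected; (iii) the intersection of any d+1 (not necessarily distinct) members of ℱ is nonempty. Then ⋂ℱ ≠ ∅. -/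
open CategoryTheory AlgebraicTopology

/-- Singular homology of a topological space with coefficients in a commutative ring `R`. -/
noncomputable def SingularHomology (R : Type) [CommRing R]
    (X : Type) [TopologicalSpace X] (n : ℕ) : ModuleCat R :=
  (((alternatingFaceMapComplex (ModuleCat R)).obj
      (((SimplicialObject.whiskering _ _).obj (ModuleCat.free R)).obj
        (TopCat.toSSet.obj (TopCat.of X)))).homology n)

/-- Ordered affine chains: formal integral combinations of `m`-tuples of points. The chains on
`0`-tuples play the role of the augmentation. -/
abbrev TupleChain (E : Type) (m : ℕ) : Type := (Fin m → E) →₀ ℤ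

namespace TupleChain

variable {E F : Type}

/-- The (augmented) boundary of tuple chains. -/
noncomputable def bd (m : ℕ) : TupleChain E (m + 1) →ₗ[ℤ] TupleChain E m :=
  Finsupp.linearCombination ℤ fun w =>
    ∑ i : Fin (m + 1), (-1 : ℤ) ^ (i : ℕ) • Finsupp.single (w ∘ i.succAbove) (1 : ℤ)

/-- The cone over a tuple chain with apex `b`. -/
noncomputable def cone (b : E) (m : ℕ) : TupleChain E m →ₗ[ℤ] TupleChain E (m + 1) :=
  Finsupp.lmapDomain ℤ ℤ fun w => (Fin.cons b w : Fin (m + 1) → E)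

/-- Pushing tuple chains forward along a map. -/
noncomputable def map (f : E → F) (m : ℕ) : TupleChain E m →ₗ[ℤ] TupleChain F m :=
  Finsupp.lmapDomain ℤ ℤ fun w => f ∘ w

lemma bd_single {m : ℕ} (w : Fin (m + 1) → E) :
    bd m (Finsupp.single w 1) =
      ∑ i : Fin (m + 1), (-1 : ℤ) ^ (i : ℕ) • Finsupp.single (w ∘ i.succAbove) (1 : ℤ) := by
  simp only [bd, Finsupp.linearCombination_single, one_smul]

lemma cone_single (b : E) {m : ℕ} (w : Fin m → E) :
    cone b m (Finsupp.single w 1) = Finsupp.single (Fin.cons b w : Fin (m + 1) → E) 1 := by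
  simp only [cone, Finsupp.lmapDomain_apply, Finsupp.mapDomain_single]

lemma map_single (f : E → F) {m : ℕ} (w : Fin m → E) :
    map f m (Finsupp.single w 1) = Finsupp.single (f ∘ w) 1 := by
  simp only [map, Finsupp.lmapDomain_apply, Finsupp.mapDomain_single]

lemma bd_cone_zero (b : E) (c : TupleChain E 0) : bd 0 (cone b 0 c) = c := by
  suffices bd 0 ∘ₗ cone b 0 = LinearMap.id from LinearMap.congr_fun this c
  refine Finsupp.lhom_ext' fun w => LinearMap.ext_ring ?_
  simp only [LinearMap.comp_apply, Finsupp.lsingle_apply, cone_single, bd_single,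
    LinearMap.id_apply]
  simp [Subsingleton.elim _ w]

lemma bd_cone (b : E) (m : ℕ) (c : TupleChain E (m + 1)) :
    bd (m + 1) (cone b (m + 1) c) = c - cone b m (bd m c) := by
  suffices bd (m + 1) ∘ₗ cone b (m + 1) = LinearMap.id - cone b m ∘ₗ bd m from
    LinearMap.congr_fun this c
  refine Finsupp.lhom_ext' fun w => LinearMap.ext_ring ?_
  have h (i : Fin (m + 1)) : (Fin.cons b w : Fin (m + 2) → E) ∘ i.succ.succAbove =
      (Fin.cons b (w ∘ i.succAbove) : Fin (m + 1) → E) := by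
    ext j
    refine Fin.cases ?_ (fun j => ?_) j
    · simp
    · simp
  simp only [LinearMap.comp_apply, LinearMap.sub_apply, Finsupp.lsingle_apply, cone_single,
    bd_single, LinearMap.id_apply, map_sum, map_smul]
  rw [Fin.sum_univ_succ]
  simp [h, pow_succ, sub_eq_add_neg]

lemma bd_map (f : E → F) (m : ℕ) (c : TupleChain E (m + 1)) :
    bd m (map f (m + 1) c) = map f m (bd m c) := by
  suffices bd m ∘ₗ map f (m + 1) = map f m ∘ₗ bd m from LinearMap.congr_fun this c
  refine Finsupp.lhom_ext' fun w => LinearMap.ext_ring ?_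
  simp only [LinearMap.comp_apply, Finsupp.lsingle_apply, map_single, bd_single, map_sum,
    map_smul, Function.comp_assoc]

lemma map_cone (f : E → F) (b : E) (m : ℕ) (c : TupleChain E m) :
    map f (m + 1) (cone b m c) = cone (f b) m (map f m c) := by
  suffices map f (m + 1) ∘ₗ cone b m = cone (f b) m ∘ₗ map f m from LinearMap.congr_fun this c
  refine Finsupp.lhom_ext' fun w => LinearMap.ext_ring ?_
  simp only [LinearMap.comp_apply, Finsupp.lsingle_apply, map_single, cone_single]
  congr 1
  ext j
  refine Fin.cases ?_ (fun j => ?_) j <;> simp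

lemma bd_bd (m : ℕ) (c : TupleChain E (m + 2)) : bd m (bd (m + 1) c) = 0 := by
  induction m with
  | zero =>
    suffices bd 0 ∘ₗ bd 1 = (0 : TupleChain E 2 →ₗ[ℤ] _) from LinearMap.congr_fun this c
    refine Finsupp.lhom_ext' fun w => LinearMap.ext_ring ?_
    simp only [LinearMap.comp_apply, Finsupp.lsingle_apply, LinearMap.zero_apply]
    rw [← Fin.cons_self_tail w, ← cone_single, bd_cone, map_sub, bd_cone_zero, sub_self]
  | succ m ih =>
    suffices bd (m + 1) ∘ₗ bd (m + 2) = (0 : TupleChain E (m + 3) →ₗ[ℤ] _) from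
      LinearMap.congr_fun this c
    refine Finsupp.lhom_ext' fun w => LinearMap.ext_ring ?_
    simp only [LinearMap.comp_apply, Finsupp.lsingle_apply, LinearMap.zero_apply]
    rw [← Fin.cons_self_tail w, ← cone_single, bd_cone, map_sub, bd_cone, ih, map_zero, sub_zero,
      sub_self]

/-- Barycentric subdivision of tuple chains with respect to a choice `β` of barycenters. -/
noncomputable def sd (β : ∀ m : ℕ, (Fin (m + 1) → E) → E) :
    ∀ m : ℕ, TupleChain E m →ₗ[ℤ] TupleChain E m
  | 0 => LinearMap.id
  | m + 1 => Finsupp.linearCombination ℤ fun w =>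
      cone (β m w) m (sd β m (bd m (Finsupp.single w 1)))

/-- The chain homotopy between the identity and barycentric subdivision. -/
noncomputable def sdHomotopy (β : ∀ m : ℕ, (Fin (m + 1) → E) → E) :
    ∀ m : ℕ, TupleChain E m →ₗ[ℤ] TupleChain E (m + 1)
  | 0 => 0
  | m + 1 => Finsupp.linearCombination ℤ fun w =>
      cone (β m w) (m + 1) (Finsupp.single w 1 - sdHomotopy β m (bd m (Finsupp.single w 1)))

variable (β : ∀ m : ℕ, (Fin (m + 1) → E) → E)

lemma sd_single {m : ℕ} (w : Fin (m + 1) → E) : sd β (m + 1) (Finsupp.single w 1) =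
    cone (β m w) m (sd β m (bd m (Finsupp.single w 1))) := by
  simp only [sd, Finsupp.linearCombination_single, one_smul]

lemma sdHomotopy_single {m : ℕ} (w : Fin (m + 1) → E) :
    sdHomotopy β (m + 1) (Finsupp.single w 1) = cone (β m w) (m + 1)
      (Finsupp.single w 1 - sdHomotopy β m (bd m (Finsupp.single w 1))) := by
  simp only [sdHomotopy, Finsupp.linearCombination_single, one_smul]

lemma bd_sd (m : ℕ) (c : TupleChain E (m + 1)) :
    bd m (sd β (m + 1) c) = sd β m (bd m c) := by
  induction m with
  | zero =>
    suffices bd 0 ∘ₗ sd β 1 = sd β 0 ∘ₗ bd 0 from LinearMap.congr_fun this c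
    refine Finsupp.lhom_ext' fun w => LinearMap.ext_ring ?_
    simp only [LinearMap.comp_apply, Finsupp.lsingle_apply, sd_single, bd_cone_zero]
  | succ m ih =>
    suffices bd (m + 1) ∘ₗ sd β (m + 2) = sd β (m + 1) ∘ₗ bd (m + 1) from
      LinearMap.congr_fun this c
    refine Finsupp.lhom_ext' fun w => LinearMap.ext_ring ?_
    simp only [LinearMap.comp_apply, Finsupp.lsingle_apply, sd_single, bd_cone, ih, bd_bd,
      map_zero, sub_zero]

lemma bd_sdHomotopy_zero (c : TupleChain E 0) : bd 0 (sdHomotopy β 0 c) = c - sd β 0 c := by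
  simp [sdHomotopy, sd]

lemma bd_sdHomotopy (m : ℕ) (c : TupleChain E (m + 1)) :
    bd (m + 1) (sdHomotopy β (m + 1) c) = c - sd β (m + 1) c - sdHomotopy β m (bd m c) := by
  induction m with
  | zero =>
    suffices bd 1 ∘ₗ sdHomotopy β 1 = LinearMap.id - sd β 1 - sdHomotopy β 0 ∘ₗ bd 0 from
      LinearMap.congr_fun this c
    refine Finsupp.lhom_ext' fun w => LinearMap.ext_ring ?_
    simp only [LinearMap.comp_apply, Finsupp.lsingle_apply, sdHomotopy_single, sd_single,
      LinearMap.sub_apply, LinearMap.id_apply, bd_cone, map_sub, bd_sdHomotopy_zero]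
    abel
  | succ m ih =>
    suffices bd (m + 2) ∘ₗ sdHomotopy β (m + 2) =
        LinearMap.id - sd β (m + 2) - sdHomotopy β (m + 1) ∘ₗ bd (m + 1) from
      LinearMap.congr_fun this c
    refine Finsupp.lhom_ext' fun w => LinearMap.ext_ring ?_
    simp only [LinearMap.comp_apply, Finsupp.lsingle_apply, sdHomotopy_single, sd_single,
      LinearMap.sub_apply, LinearMap.id_apply, bd_cone, map_sub, ih, bd_bd, map_zero]
    abel

variable {β} {β' : ∀ m : ℕ, (Fin (m + 1) → F) → F} {f : E → F}

lemma map_sd (hf : ∀ m w, f (β m w) = β' m (f ∘ w)) (m : ℕ) (c : TupleChain E m) :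
    map f m (sd β m c) = sd β' m (map f m c) := by
  induction m with
  | zero => rfl
  | succ m ih =>
    suffices map f (m + 1) ∘ₗ sd β (m + 1) = sd β' (m + 1) ∘ₗ map f (m + 1) from
      LinearMap.congr_fun this c
    refine Finsupp.lhom_ext' fun w => LinearMap.ext_ring ?_
    simp only [LinearMap.comp_apply, Finsupp.lsingle_apply, map_single, sd_single, map_cone, ih,
      hf, ← bd_map]

lemma map_sdHomotopy (hf : ∀ m w, f (β m w) = β' m (f ∘ w)) (m : ℕ) (c : TupleChain E m) :
    map f (m + 1) (sdHomotopy β m c) = sdHomotopy β' m (map f m c) := by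
  induction m with
  | zero => simp [sdHomotopy]
  | succ m ih =>
    suffices map f (m + 2) ∘ₗ sdHomotopy β (m + 1) = sdHomotopy β' (m + 1) ∘ₗ map f (m + 1) from
      LinearMap.congr_fun this c
    refine Finsupp.lhom_ext' fun w => LinearMap.ext_ring ?_
    simp only [LinearMap.comp_apply, Finsupp.lsingle_apply, map_single, sdHomotopy_single,
      map_cone, ih, hf, ← bd_map, map_sub]

end TupleChain

/-- The standard topological simplex with `m` vertices. -/
abbrev VertexSimplex (m : ℕ) : Type := stdSimplex ℝ (Fin m)

namespace VertexSimplex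

/-- The affine map between standard simplices with prescribed images of the vertices. -/
noncomputable def affine {m n : ℕ} (w : Fin m → VertexSimplex n) :
    C(VertexSimplex m, VertexSimplex n) where
  toFun t := ⟨∑ i, t.1 i • (w i).1, (convex_stdSimplex ℝ (Fin n)).sum_mem (fun i _ => t.2.1 i)
    t.2.2 fun i _ => (w i).2⟩
  continuous_toFun := by
    refine Continuous.subtype_mk (continuous_finsetSum _ fun i _ => ?_) _
    exact ((continuous_apply i).comp continuous_subtype_val).smul continuous_const

variable {m n k : ℕ}

lemma affine_val (w : Fin m → VertexSimplex n) (t : VertexSimplex m) :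
    (affine w t).1 = ∑ i, t.1 i • (w i).1 := rfl

lemma affine_vertex (w : Fin m → VertexSimplex n) (i : Fin m) :
    affine w (stdSimplex.vertex i) = w i := by
  apply Subtype.ext
  rw [affine_val, Finset.sum_eq_single i]
  · simp
  · intro j _ hj
    simp [Pi.single_eq_of_ne hj]
  · simp

lemma affine_comp_vertex (w : Fin m → VertexSimplex n) : affine w ∘ stdSimplex.vertex = w :=
  funext fun i => affine_vertex w i

lemma affine_affine (w : Fin m → VertexSimplex n) (v : Fin k → VertexSimplex m)
    (t : VertexSimplex k) : affine w (affine v t) = affine (affine w ∘ v) t := by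
  apply Subtype.ext
  simp only [affine_val, Function.comp_apply, Finset.sum_apply, Pi.smul_apply, Finset.sum_smul,
    Finset.smul_sum, smul_smul, smul_eq_mul]
  exact Finset.sum_comm

lemma affine_comp (w : Fin m → VertexSimplex n) (v : Fin k → VertexSimplex m) :
    (affine w).comp (affine v) = affine (affine w ∘ v) :=
  ContinuousMap.ext fun t => affine_affine w v t

lemma affine_stdSimplex_vertex :
    affine (stdSimplex.vertex : Fin m → VertexSimplex m) = ContinuousMap.id _ := by
  ext t i
  change (affine (stdSimplex.vertex : Fin m → VertexSimplex m) t).1 i = t.1 i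
  rw [affine_val, Finset.sum_apply, Finset.sum_eq_single i]
  · simp
  · intro j _ hj
    simp [Pi.single_eq_of_ne hj.symm]
  · simp

/-- The barycenter of a nonempty tuple of points of a standard simplex. -/
noncomputable def centroid (m : ℕ) (w : Fin (m + 1) → VertexSimplex n) : VertexSimplex n :=
  affine w stdSimplex.barycenter

lemma affine_centroid (w : Fin m → VertexSimplex n) (k : ℕ) (v : Fin (k + 1) → VertexSimplex m) :
    affine w (centroid k v) = centroid k (affine w ∘ v) :=
  affine_affine _ _ _

lemma affine_mem_convexHull (w : Fin m → VertexSimplex n) (t : VertexSimplex m) :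
    (affine w t).1 ∈ convexHull ℝ (Set.range fun i => (w i).1) :=
  (convex_convexHull ℝ _).sum_mem (fun i _ => t.2.1 i) t.2.2
    fun i _ => subset_convexHull ℝ _ ⟨i, rfl⟩

lemma dist_le_of_mem_convexHull {w : Fin m → VertexSimplex n} {b x : VertexSimplex n} {δ : ℝ}
    (h : ∀ i, dist (w i) b ≤ δ) (hx : x.1 ∈ convexHull ℝ (Set.range fun i => (w i).1)) :
    dist x b ≤ δ := by
  have : convexHull ℝ (Set.range fun i => (w i).1) ⊆ Metric.closedBall b.1 δ := by
    refine convexHull_min ?_ (convex_closedBall b.1 δ)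
    rintro _ ⟨i, rfl⟩
    exact h i
  exact this hx

lemma dist_centroid_le (w : Fin (m + 1) → VertexSimplex n) {δ : ℝ}
    (h : ∀ i j, dist (w i) (w j) ≤ δ) (i : Fin (m + 1)) :
    dist (w i) (centroid m w) ≤ m / (m + 1) * δ := by
  have hm : (0 : ℝ) < m + 1 := by positivity
  have key : (centroid m w).1 - (w i).1 = ∑ j, ((m : ℝ) + 1)⁻¹ • ((w j).1 - (w i).1) := by
    simp only [smul_sub, Finset.sum_sub_distrib]
    congr 1
    · simp [centroid, affine_val, stdSimplex.barycenter]
    · rw [Finset.sum_const, Finset.card_univ, Fintype.card_fin, ← Nat.cast_smul_eq_nsmul ℝ,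
        smul_smul]
      push_cast
      rw [mul_inv_cancel₀ hm.ne', one_smul]
  rw [dist_comm, Subtype.dist_eq, dist_eq_norm, key, Fin.sum_univ_succAbove _ i]
  simp only [sub_self, smul_zero, zero_add]
  calc _ ≤ ∑ j : Fin m, ‖((m : ℝ) + 1)⁻¹ • ((w (i.succAbove j)).1 - (w i).1)‖ :=
        norm_sum_le _ _
    _ ≤ ∑ j : Fin m, ((m : ℝ) + 1)⁻¹ * δ := by
        refine Finset.sum_le_sum fun j _ => ?_
        rw [norm_smul, Real.norm_of_nonneg (by positivity), ← dist_eq_norm]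
        exact mul_le_mul_of_nonneg_left (h _ _) (by positivity)
    _ = _ := by
        rw [Finset.sum_const, Finset.card_univ, Fintype.card_fin, nsmul_eq_mul]
        ring

lemma map_mem_supported {α β : Type} {f : α → β} {s : Set α} {t : Set β} (h : Set.MapsTo f s t)
    {c : α →₀ ℤ} (hc : c ∈ Finsupp.supported ℤ ℤ s) :
    Finsupp.lmapDomain ℤ ℤ f c ∈ Finsupp.supported ℤ ℤ t := by
  have := Submodule.mem_map_of_mem (f := Finsupp.lmapDomain ℤ ℤ f) hc
  rw [Finsupp.lmapDomain_supported] at this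
  exact Finsupp.supported_mono h.image_subset this

lemma linear_mem_of_supported {α M : Type} [AddCommGroup M] {s : Set α} {f : (α →₀ ℤ) →ₗ[ℤ] M}
    {P : Submodule ℤ M} (h : ∀ a ∈ s, f (Finsupp.single a 1) ∈ P)
    {c : α →₀ ℤ} (hc : c ∈ Finsupp.supported ℤ ℤ s) : f c ∈ P := by
  rw [Finsupp.supported_eq_span_single] at hc
  have : Submodule.span ℤ ((fun i => Finsupp.single i (1 : ℤ)) '' s) ≤ P.comap f := by
    rw [Submodule.span_le]
    rintro _ ⟨a, ha, rfl⟩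
    exact h a ha
  exact this hc

lemma sd_single_mem_supported {M : ℕ} (w : Fin m → VertexSimplex n) (hm : m ≤ M) {δ : ℝ}
    (h : ∀ i j, dist (w i) (w j) ≤ δ) :
    TupleChain.sd centroid m (Finsupp.single w 1) ∈ Finsupp.supported ℤ ℤ
      {v : Fin m → VertexSimplex n |
        (∀ i, (v i).1 ∈ convexHull ℝ (Set.range fun i => (w i).1)) ∧
        ∀ i j, dist (v i) (v j) ≤ M / (M + 1) * δ} := by
  induction m with
  | zero =>
    exact Finsupp.single_mem_supported ℤ 1 ⟨fun i => i.elim0, fun i => i.elim0⟩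
  | succ m ih =>
    have hδ : 0 ≤ δ := dist_nonneg.trans (h 0 0)
    rw [TupleChain.sd_single]
    refine map_mem_supported (s := {v : Fin m → VertexSimplex n |
        (∀ i, (v i).1 ∈ convexHull ℝ (Set.range fun i => (w i).1)) ∧
        ∀ i j, dist (v i) (v j) ≤ M / (M + 1) * δ}) ?_ ?_
    · rintro v ⟨hv, hv'⟩
      have hb (i : Fin m) : dist (v i) (centroid m w) ≤ M / (M + 1) * δ := by
        refine (dist_le_of_mem_convexHull (dist_centroid_le w h) (hv i)).trans ?_
        refine mul_le_mul_of_nonneg_right ?_ hδ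
        have : (m : ℝ) ≤ M := by exact_mod_cast (Nat.le_succ m).trans hm
        rw [div_le_div_iff₀ (by positivity) (by positivity)]
        linarith
      refine ⟨fun i => ?_, fun i j => ?_⟩
      · refine Fin.cases ?_ (fun i => ?_) i
        · exact affine_mem_convexHull w _
        · exact hv i
      · refine Fin.cases ?_ (fun i => ?_) i <;> refine Fin.cases ?_ (fun j => ?_) j
        · simp only [dist_self]
          positivity
        · rw [dist_comm]
          exact hb j
        · exact hb i
        · exact hv' i j
    · rw [TupleChain.bd_single, map_sum]
      refine Submodule.sum_mem _ fun i _ => ?_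
      rw [map_smul]
      refine Submodule.smul_mem _ _ ?_
      refine Finsupp.supported_mono ?_
        (ih (w ∘ i.succAbove) ((Nat.le_succ m).trans hm) fun _ _ => h _ _)
      rintro v ⟨hv, hv'⟩
      refine ⟨fun j => convexHull_mono ?_ (hv j), hv'⟩
      rintro _ ⟨j, rfl⟩
      exact ⟨i.succAbove j, rfl⟩

lemma sd_iterate_mem_supported (w : Fin m → VertexSimplex n) {δ : ℝ}
    (h : ∀ i j, dist (w i) (w j) ≤ δ) (N : ℕ) :
    (TupleChain.sd centroid m)^[N] (Finsupp.single w 1) ∈ Finsupp.supported ℤ ℤ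
      {v : Fin m → VertexSimplex n | ∀ i j, dist (v i) (v j) ≤ ((m : ℝ) / (m + 1)) ^ N * δ} := by
  induction N with
  | zero => exact Finsupp.single_mem_supported ℤ 1 (by simpa using h)
  | succ N ih =>
    rw [Function.iterate_succ_apply']
    refine linear_mem_of_supported (fun v hv => ?_) ih
    refine Finsupp.supported_mono ?_ (sd_single_mem_supported v le_rfl hv)
    rintro u ⟨-, hu⟩ i j
    rw [pow_succ', mul_assoc]
    exact hu i j

/-- Iterated barycentric subdivision of a simplex is eventually subordinate to any open cover. -/
lemma exists_sd_iterate_mem_supported (m : ℕ) {ι : Type} [Nonempty ι]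
    {c : ι → Set (VertexSimplex m)}
    (hc : ∀ i, IsOpen (c i)) (hcover : ∀ x, ∃ i, x ∈ c i) :
    ∃ N₀, ∀ N, N₀ ≤ N → (TupleChain.sd centroid m)^[N]
      (Finsupp.single (stdSimplex.vertex : Fin m → VertexSimplex m) 1) ∈ Finsupp.supported ℤ ℤ
        {v : Fin m → VertexSimplex m | ∃ i, ∀ t, affine v t ∈ c i} := by
  obtain ⟨δ, hδ, H⟩ := lebesgue_number_lemma_of_metric (s := Set.univ) isCompact_univ hc
    fun x _ => Set.mem_iUnion.2 (hcover x)
  set D := Metric.diam (Set.univ : Set (VertexSimplex m))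
  have hr : (m : ℝ) / (m + 1) < 1 := by
    rw [div_lt_one (by positivity)]
    linarith
  have hlim : Filter.Tendsto (fun N : ℕ => ((m : ℝ) / (m + 1)) ^ N * D) Filter.atTop (nhds 0) := by
    simpa using (tendsto_pow_atTop_nhds_zero_of_lt_one (by positivity) hr).mul_const D
  obtain ⟨N₀, hN₀⟩ := Filter.eventually_atTop.1 (hlim.eventually_lt_const hδ)
  refine ⟨N₀, fun N hN => ?_⟩
  refine Finsupp.supported_mono ?_ (sd_iterate_mem_supported (δ := D) _ (fun i j =>
    Metric.dist_le_diam_of_mem isCompact_univ.isBounded (Set.mem_univ _) (Set.mem_univ _)) N)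
  intro v hv
  match m, v, hv with
  | 0, v, hv =>
    refine ⟨Classical.arbitrary ι, fun t => ?_⟩
    exact absurd t.2.2 (by simp)
  | m + 1, v, hv =>
    obtain ⟨i, hi⟩ := H (v 0) (Set.mem_univ _)
    refine ⟨i, fun t => hi ?_⟩
    exact (dist_le_of_mem_convexHull (fun j => hv j 0) (affine_mem_convexHull v t)).trans_lt
      (hN₀ N hN)

end VertexSimplex

/-- Augmented singular chains: formal integral combinations of singular simplices with `m`
vertices. For `m = 0` there is exactly one such simplex, the empty one. -/
abbrev SingularChain (X : Type) [TopologicalSpace X] (m : ℕ) : Type := C(VertexSimplex m, X) →₀ ℤ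

namespace SingularChain

open VertexSimplex

variable {X : Type} [TopologicalSpace X] {m n : ℕ}

/-- The augmented singular boundary. -/
noncomputable def bd (m : ℕ) : SingularChain X (m + 1) →ₗ[ℤ] SingularChain X m :=
  Finsupp.linearCombination ℤ fun σ => ∑ i : Fin (m + 1), (-1 : ℤ) ^ (i : ℕ) •
    Finsupp.single (σ.comp (affine (stdSimplex.vertex ∘ i.succAbove))) (1 : ℤ)

/-- The singular chain in `X` obtained from a tuple chain in the domain of a singular simplex. -/
noncomputable def push (σ : C(VertexSimplex n, X)) (m : ℕ) :
    TupleChain (VertexSimplex n) m →ₗ[ℤ] SingularChain X m :=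
  Finsupp.lmapDomain ℤ ℤ fun v => σ.comp (affine v)

/-- Barycentric subdivision of singular chains. -/
noncomputable def sd (m : ℕ) : SingularChain X m →ₗ[ℤ] SingularChain X m :=
  Finsupp.linearCombination ℤ fun σ =>
    push σ m (TupleChain.sd centroid m (Finsupp.single stdSimplex.vertex 1))

/-- The chain homotopy between the identity and barycentric subdivision. -/
noncomputable def sdHomotopy (m : ℕ) : SingularChain X m →ₗ[ℤ] SingularChain X (m + 1) :=
  Finsupp.linearCombination ℤ fun σ =>
    push σ (m + 1) (TupleChain.sdHomotopy centroid m (Finsupp.single stdSimplex.vertex 1))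

lemma bd_single (σ : C(VertexSimplex (m + 1), X)) :
    bd m (Finsupp.single σ 1) = ∑ i : Fin (m + 1), (-1 : ℤ) ^ (i : ℕ) •
      Finsupp.single (σ.comp (affine (stdSimplex.vertex ∘ i.succAbove))) (1 : ℤ) := by
  simp only [bd, Finsupp.linearCombination_single, one_smul]

lemma push_single (σ : C(VertexSimplex n, X)) (v : Fin m → VertexSimplex n) :
    push σ m (Finsupp.single v 1) = Finsupp.single (σ.comp (affine v)) 1 := by
  simp only [push, Finsupp.lmapDomain_apply, Finsupp.mapDomain_single]

lemma push_vertex (σ : C(VertexSimplex m, X)) :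
    push σ m (Finsupp.single stdSimplex.vertex 1) = Finsupp.single σ 1 := by
  rw [push_single, affine_stdSimplex_vertex, ContinuousMap.comp_id]

lemma sd_single (σ : C(VertexSimplex m, X)) : sd m (Finsupp.single σ 1) =
    push σ m (TupleChain.sd centroid m (Finsupp.single stdSimplex.vertex 1)) := by
  simp only [sd, Finsupp.linearCombination_single, one_smul]

lemma sdHomotopy_single (σ : C(VertexSimplex m, X)) : sdHomotopy m (Finsupp.single σ 1) =
    push σ (m + 1) (TupleChain.sdHomotopy centroid m (Finsupp.single stdSimplex.vertex 1)) := by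
  simp only [sdHomotopy, Finsupp.linearCombination_single, one_smul]

lemma push_comp_affine (σ : C(VertexSimplex n, X)) {k : ℕ} (v : Fin k → VertexSimplex n)
    (c : TupleChain (VertexSimplex k) m) :
    push (σ.comp (affine v)) m c = push σ m (TupleChain.map (affine v) m c) := by
  suffices push (σ.comp (affine v)) m = push σ m ∘ₗ TupleChain.map (affine v) m from
    LinearMap.congr_fun this c
  refine Finsupp.lhom_ext' fun w => LinearMap.ext_ring ?_
  simp only [LinearMap.comp_apply, Finsupp.lsingle_apply, push_single, TupleChain.map_single,
    ContinuousMap.comp_assoc, affine_comp]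

lemma bd_push (σ : C(VertexSimplex n, X)) (c : TupleChain (VertexSimplex n) (m + 1)) :
    bd m (push σ (m + 1) c) = push σ m (TupleChain.bd m c) := by
  suffices bd m ∘ₗ push σ (m + 1) = push σ m ∘ₗ TupleChain.bd m from LinearMap.congr_fun this c
  refine Finsupp.lhom_ext' fun w => LinearMap.ext_ring ?_
  simp only [LinearMap.comp_apply, Finsupp.lsingle_apply, push_single, TupleChain.bd_single,
    bd_single, map_sum, map_smul, ContinuousMap.comp_assoc, affine_comp, ← Function.comp_assoc,
    affine_comp_vertex]

lemma sd_push (σ : C(VertexSimplex n, X)) (c : TupleChain (VertexSimplex n) m) :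
    sd m (push σ m c) = push σ m (TupleChain.sd centroid m c) := by
  suffices sd m ∘ₗ push σ m = push σ m ∘ₗ TupleChain.sd centroid m from LinearMap.congr_fun this c
  refine Finsupp.lhom_ext' fun w => LinearMap.ext_ring ?_
  simp only [LinearMap.comp_apply, Finsupp.lsingle_apply, push_single, sd_single,
    push_comp_affine, TupleChain.map_sd (affine_centroid w), TupleChain.map_single,
    affine_comp_vertex]

lemma sdHomotopy_push (σ : C(VertexSimplex n, X)) (c : TupleChain (VertexSimplex n) m) :
    sdHomotopy m (push σ m c) = push σ (m + 1) (TupleChain.sdHomotopy centroid m c) := by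
  suffices sdHomotopy m ∘ₗ push σ m = push σ (m + 1) ∘ₗ TupleChain.sdHomotopy centroid m from
    LinearMap.congr_fun this c
  refine Finsupp.lhom_ext' fun w => LinearMap.ext_ring ?_
  simp only [LinearMap.comp_apply, Finsupp.lsingle_apply, push_single, sdHomotopy_single,
    push_comp_affine, TupleChain.map_sdHomotopy (affine_centroid w), TupleChain.map_single,
    affine_comp_vertex]

lemma bd_bd (c : SingularChain X (m + 2)) : bd m (bd (m + 1) c) = 0 := by
  suffices bd m ∘ₗ bd (m + 1) = (0 : SingularChain X (m + 2) →ₗ[ℤ] _) from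
    LinearMap.congr_fun this c
  refine Finsupp.lhom_ext' fun σ => LinearMap.ext_ring ?_
  simp only [LinearMap.comp_apply, Finsupp.lsingle_apply, LinearMap.zero_apply]
  rw [← push_vertex, bd_push, bd_push, TupleChain.bd_bd, map_zero]

lemma bd_sd (c : SingularChain X (m + 1)) : bd m (sd (m + 1) c) = sd m (bd m c) := by
  suffices bd m ∘ₗ sd (m + 1) = sd m ∘ₗ (bd m : SingularChain X (m + 1) →ₗ[ℤ] _) from
    LinearMap.congr_fun this c
  refine Finsupp.lhom_ext' fun σ => LinearMap.ext_ring ?_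
  simp only [LinearMap.comp_apply, Finsupp.lsingle_apply]
  rw [← push_vertex, sd_push, bd_push, bd_push, sd_push, TupleChain.bd_sd]

lemma bd_sdHomotopy_zero (c : SingularChain X 0) : bd 0 (sdHomotopy 0 c) = c - sd 0 c := by
  suffices bd 0 ∘ₗ sdHomotopy 0 = LinearMap.id - (sd 0 : SingularChain X 0 →ₗ[ℤ] _) from
    LinearMap.congr_fun this c
  refine Finsupp.lhom_ext' fun σ => LinearMap.ext_ring ?_
  simp only [LinearMap.comp_apply, Finsupp.lsingle_apply, LinearMap.sub_apply, LinearMap.id_apply]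
  rw [← push_vertex, sd_push, sdHomotopy_push, bd_push, TupleChain.bd_sdHomotopy_zero, map_sub]

lemma bd_sdHomotopy (c : SingularChain X (m + 1)) :
    bd (m + 1) (sdHomotopy (m + 1) c) = c - sd (m + 1) c - sdHomotopy m (bd m c) := by
  suffices bd (m + 1) ∘ₗ sdHomotopy (m + 1) = LinearMap.id - sd (m + 1) -
      sdHomotopy m ∘ₗ (bd m : SingularChain X (m + 1) →ₗ[ℤ] _) from LinearMap.congr_fun this c
  refine Finsupp.lhom_ext' fun σ => LinearMap.ext_ring ?_
  simp only [LinearMap.comp_apply, Finsupp.lsingle_apply, LinearMap.sub_apply, LinearMap.id_apply]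
  rw [← push_vertex, sd_push, sdHomotopy_push, bd_push, bd_push, sdHomotopy_push,
    TupleChain.bd_sdHomotopy, map_sub, map_sub]

lemma sd_pow_single (σ : C(VertexSimplex m, X)) (N : ℕ) : (sd m ^ N) (Finsupp.single σ 1) =
    push σ m ((TupleChain.sd centroid m)^[N] (Finsupp.single stdSimplex.vertex 1)) := by
  induction N with
  | zero => exact (push_vertex σ).symm
  | succ N ih => rw [pow_succ', Module.End.mul_apply, ih, sd_push, Function.iterate_succ_apply']

/-- The chains carried by a subset `U` of `X`. -/
noncomputable def chainsIn (U : Set X) (m : ℕ) : Submodule ℤ (SingularChain X m) :=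
  Finsupp.supported ℤ ℤ {σ | ∀ t, σ t ∈ U}

lemma chainsIn_mono {U V : Set X} (h : U ⊆ V) : chainsIn U m ≤ chainsIn V m :=
  Finsupp.supported_mono fun _ hσ t => h (hσ t)

lemma chainsIn_inf (U V : Set X) : chainsIn U m ⊓ chainsIn V m = chainsIn (U ∩ V) m := by
  rw [chainsIn, chainsIn, ← Finsupp.supported_inter, chainsIn]
  congr 1
  ext σ
  simp [forall_and]

lemma push_mem_chainsIn {U : Set X} {σ : C(VertexSimplex n, X)} (h : ∀ t, σ t ∈ U)
    (c : TupleChain (VertexSimplex n) m) : push σ m c ∈ chainsIn U m :=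
  map_mem_supported (s := Set.univ) (t := {τ : C(VertexSimplex m, X) | ∀ t, τ t ∈ U})
    (fun v _ t => h (affine v t)) (by simp [Finsupp.supported_univ])

lemma bd_mem_chainsIn {U : Set X} {c : SingularChain X (m + 1)} (hc : c ∈ chainsIn U (m + 1)) :
    bd m c ∈ chainsIn U m := by
  refine linear_mem_of_supported (fun σ hσ => ?_) hc
  rw [← push_vertex, bd_push]
  exact push_mem_chainsIn hσ _

lemma sd_mem_chainsIn {U : Set X} {c : SingularChain X m} (hc : c ∈ chainsIn U m) :
    sd m c ∈ chainsIn U m := by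
  refine linear_mem_of_supported (fun σ hσ => ?_) hc
  rw [sd_single]
  exact push_mem_chainsIn hσ _

lemma sdHomotopy_mem_chainsIn {U : Set X} {c : SingularChain X m} (hc : c ∈ chainsIn U m) :
    sdHomotopy m c ∈ chainsIn U (m + 1) := by
  refine linear_mem_of_supported (fun σ hσ => ?_) hc
  rw [sdHomotopy_single]
  exact push_mem_chainsIn hσ _

lemma sd_pow_mem_chainsIn {U : Set X} {c : SingularChain X m} (hc : c ∈ chainsIn U m) (N : ℕ) :
    (sd m ^ N) c ∈ chainsIn U m := by
  induction N with
  | zero => exact hc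
  | succ N ih =>
    rw [pow_succ', Module.End.mul_apply]
    exact sd_mem_chainsIn ih

/-- The cycles of the augmented singular chain complex. -/
def IsCycle : ∀ m : ℕ, SingularChain X m → Prop
  | 0, _ => True
  | m + 1, z => bd m z = 0

lemma IsCycle.sd_pow {z : SingularChain X m} (hz : IsCycle m z) (N : ℕ) :
    IsCycle m ((sd m ^ N) z) := by
  match m, z, hz with
  | 0, _, _ => trivial
  | m + 1, z, hz =>
    induction N with
    | zero => exact hz
    | succ N ih =>
      change bd m _ = 0
      rw [pow_succ', Module.End.mul_apply, bd_sd, show bd m _ = 0 from ih, map_zero]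

lemma isCycle_bd (c : SingularChain X (m + 1)) : IsCycle m (bd m c) := by
  match m, c with
  | 0, _ => trivial
  | m + 1, c => exact bd_bd c

lemma IsCycle.bd_sdHomotopy {z : SingularChain X m} (hz : IsCycle m z) :
    bd m (sdHomotopy m z) = z - sd m z := by
  match m, z, hz with
  | 0, z, _ => exact bd_sdHomotopy_zero z
  | m + 1, z, hz =>
    rw [SingularChain.bd_sdHomotopy, show bd m z = 0 from hz, map_zero, sub_zero]

/-- The chain homotopy between the identity and the `N`-fold barycentric subdivision. -/
noncomputable def sdPowHomotopy (N m : ℕ) : SingularChain X m →ₗ[ℤ] SingularChain X (m + 1) :=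
  ∑ k ∈ Finset.range N, sdHomotopy m ∘ₗ (sd m ^ k)

lemma sdPowHomotopy_mem_chainsIn {U : Set X} {c : SingularChain X m} (hc : c ∈ chainsIn U m)
    (N : ℕ) : sdPowHomotopy N m c ∈ chainsIn U (m + 1) := by
  rw [sdPowHomotopy, LinearMap.sum_apply]
  exact Submodule.sum_mem _ fun k _ => sdHomotopy_mem_chainsIn (sd_pow_mem_chainsIn hc k)

lemma IsCycle.bd_sdPowHomotopy {z : SingularChain X m} (hz : IsCycle m z) (N : ℕ) :
    bd m (sdPowHomotopy N m z) = z - (sd m ^ N) z := by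
  induction N with
  | zero => simp [sdPowHomotopy]
  | succ N ih =>
    have h : sdPowHomotopy (X := X) (N + 1) m = sdPowHomotopy N m + sdHomotopy m ∘ₗ (sd m ^ N) :=
      Finset.sum_range_succ _ _
    rw [h, LinearMap.add_apply, map_add, ih, LinearMap.comp_apply, (hz.sd_pow N).bd_sdHomotopy,
      pow_succ', Module.End.mul_apply]
    abel

lemma exists_sd_pow_mem {A B : Set X} (hA : IsOpen A) (hB : IsOpen B) {c : SingularChain X m}
    (hc : c ∈ chainsIn (A ∪ B) m) : ∃ N, (sd m ^ N) c ∈ chainsIn A m ⊔ chainsIn B m := by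
  suffices ∃ N₀, ∀ N, N₀ ≤ N → (sd m ^ N) c ∈ chainsIn A m ⊔ chainsIn B m by
    obtain ⟨N, hN⟩ := this
    exact ⟨N, hN N le_rfl⟩
  rw [chainsIn, Finsupp.supported_eq_span_single] at hc
  induction hc using Submodule.span_induction with
  | zero => exact ⟨0, fun N _ => by rw [map_zero]; exact Submodule.zero_mem _⟩
  | add x y _ _ hx hy =>
    obtain ⟨N₁, h₁⟩ := hx
    obtain ⟨N₂, h₂⟩ := hy
    refine ⟨max N₁ N₂, fun N hN => ?_⟩
    rw [map_add]
    exact Submodule.add_mem _ (h₁ N ((le_max_left _ _).trans hN))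
      (h₂ N ((le_max_right _ _).trans hN))
  | smul a x _ hx =>
    obtain ⟨N₁, h₁⟩ := hx
    refine ⟨N₁, fun N hN => ?_⟩
    rw [map_smul]
    exact Submodule.smul_mem _ _ (h₁ N hN)
  | mem x hx =>
    obtain ⟨σ, hσ, rfl⟩ := hx
    obtain ⟨N₀, hN₀⟩ := exists_sd_iterate_mem_supported m
      (c := fun b : Bool => σ ⁻¹' (if b then A else B))
      (fun b => IsOpen.preimage σ.continuous (by cases b <;> simpa))
      (fun t => (hσ t).elim (fun h => ⟨true, h⟩) fun h => ⟨false, h⟩)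
    refine ⟨N₀, fun N hN => ?_⟩
    rw [sd_pow_single]
    refine linear_mem_of_supported ?_ (hN₀ N hN)
    rintro v ⟨b, hb⟩
    rw [push_single]
    cases b
    · exact Submodule.mem_sup_right (Finsupp.single_mem_supported ℤ 1 hb)
    · exact Submodule.mem_sup_left (Finsupp.single_mem_supported ℤ 1 hb)

/-- `U` has vanishing reduced singular homology in degree `m - 1`. -/
def ReducedAcyclic (m : ℕ) (U : Set X) : Prop :=
  ∀ z ∈ chainsIn U m, IsCycle m z → ∃ c ∈ chainsIn U (m + 1), bd m c = z

lemma ReducedAcyclic.union {A B : Set X} (hA : IsOpen A) (hB : IsOpen B)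
    (hA' : ReducedAcyclic (m + 1) A) (hB' : ReducedAcyclic (m + 1) B)
    (hAB : ReducedAcyclic m (A ∩ B)) : ReducedAcyclic (m + 1) (A ∪ B) := by
  intro z hz hcyc
  obtain ⟨N, hN⟩ := exists_sd_pow_mem hA hB hz
  obtain ⟨a, ha, b, hb, hab⟩ := Submodule.mem_sup.1 hN
  have hab' : bd m a = - bd m b := by
    rw [eq_neg_iff_add_eq_zero, ← map_add, hab]
    exact hcyc.sd_pow N
  have hmem : bd m a ∈ chainsIn (A ∩ B) m := by
    rw [← chainsIn_inf]
    refine ⟨bd_mem_chainsIn ha, ?_⟩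
    rw [hab']
    exact Submodule.neg_mem _ (bd_mem_chainsIn hb)
  obtain ⟨e, he, hea⟩ := hAB _ hmem (isCycle_bd a)
  obtain ⟨p, hp, hpa⟩ := hA' (a - e)
    (Submodule.sub_mem _ ha (chainsIn_mono Set.inter_subset_left he))
    (show bd m _ = 0 by rw [map_sub, hea, sub_self])
  obtain ⟨q, hq, hqb⟩ := hB' (b + e)
    (Submodule.add_mem _ hb (chainsIn_mono Set.inter_subset_right he))
    (show bd m _ = 0 by rw [map_add, hea, hab', add_neg_cancel])
  refine ⟨sdPowHomotopy N (m + 1) z + (p + q), Submodule.add_mem _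
    (sdPowHomotopy_mem_chainsIn hz N) (Submodule.add_mem _ (chainsIn_mono Set.subset_union_left hp)
      (chainsIn_mono Set.subset_union_right hq)), ?_⟩
  rw [map_add, map_add, hcyc.bd_sdPowHomotopy, hpa, hqb, ← hab]
  abel

lemma ReducedAcyclic.inter {A B : Set X} (hA : IsOpen A) (hB : IsOpen B)
    (hA' : ReducedAcyclic m A) (hB' : ReducedAcyclic m B)
    (hAB : ReducedAcyclic (m + 1) (A ∪ B)) : ReducedAcyclic m (A ∩ B) := by
  intro z hz hcyc
  obtain ⟨a, ha, haz⟩ := hA' z (chainsIn_mono Set.inter_subset_left hz) hcyc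
  obtain ⟨b, hb, hbz⟩ := hB' z (chainsIn_mono Set.inter_subset_right hz) hcyc
  have hcyc' : IsCycle (m + 1) (a - b) := by
    change bd m _ = 0
    rw [map_sub, haz, hbz, sub_self]
  obtain ⟨c, hc, hcab⟩ := hAB (a - b) (Submodule.sub_mem _
    (chainsIn_mono Set.subset_union_left ha) (chainsIn_mono Set.subset_union_right hb)) hcyc'
  obtain ⟨N, hN⟩ := exists_sd_pow_mem hA hB hc
  obtain ⟨p, hp, q, hq, hpq⟩ := Submodule.mem_sup.1 hN
  have hsd : bd (m + 1) ((sd (m + 2) ^ N) c) = (sd (m + 1) ^ N) (a - b) := by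
    rw [← hcab]
    clear * -
    induction N with
    | zero => rfl
    | succ N ih =>
      rw [pow_succ', pow_succ', Module.End.mul_apply, Module.End.mul_apply, bd_sd, ih]
  have key := hcyc'.bd_sdPowHomotopy N
  rw [← hsd, ← hpq, map_sub, map_sub, map_add] at key
  set a' := sdPowHomotopy N (m + 1) a with ha'
  set b' := sdPowHomotopy N (m + 1) b with hb'
  have haA : a' ∈ chainsIn A (m + 2) := sdPowHomotopy_mem_chainsIn ha N
  have hbB : b' ∈ chainsIn B (m + 2) := sdPowHomotopy_mem_chainsIn hb N
  have heq : a - bd (m + 1) (a' + p) = b - bd (m + 1) (b' - q) := by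
    rw [map_add, map_sub]
    rw [sub_eq_sub_iff_add_eq_add, ← sub_eq_zero]
    rw [← sub_eq_zero] at key
    rw [← neg_eq_zero, ← key]
    abel
  refine ⟨a - bd (m + 1) (a' + p), ?_, ?_⟩
  · rw [← chainsIn_inf]
    refine ⟨Submodule.sub_mem _ ha (bd_mem_chainsIn (Submodule.add_mem _ haA hp)), ?_⟩
    rw [heq]
    exact Submodule.sub_mem _ hb (bd_mem_chainsIn (Submodule.sub_mem _ hbB hq))
  · rw [map_sub, bd_bd, haz, sub_zero]

lemma reducedAcyclic_zero_iff {U : Set X} : ReducedAcyclic 0 U ↔ U.Nonempty := by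
  have hempty : IsEmpty (VertexSimplex 0) := ⟨fun t => absurd t.2.2 (by simp)⟩
  have hsub : Subsingleton C(VertexSimplex 0, X) :=
    ⟨fun f g => ContinuousMap.ext fun t => hempty.elim t⟩
  let σ₀ : C(VertexSimplex 0, X) :=
    ⟨fun t => hempty.elim t, continuous_of_const fun t => hempty.elim t⟩
  constructor
  · intro h
    obtain ⟨c, hc, hcz⟩ := h (Finsupp.single σ₀ 1)
      (Finsupp.single_mem_supported ℤ 1 fun t => hempty.elim t) trivial
    by_contra hU
    rw [Set.not_nonempty_iff_eq_empty] at hU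
    have : c = 0 := by
      rw [← Finsupp.support_eq_empty, Finset.eq_empty_iff_forall_notMem]
      intro σ hσ
      have := hc hσ (stdSimplex.vertex 0)
      simp [hU] at this
    rw [this, map_zero] at hcz
    simpa using DFunLike.congr_fun hcz σ₀
  · rintro ⟨x, hx⟩ z - -
    refine ⟨z σ₀ • Finsupp.single (ContinuousMap.const _ x) 1, Submodule.smul_mem _ _
      (Finsupp.single_mem_supported ℤ 1 fun t => hx), ?_⟩
    rw [map_smul, bd_single]
    ext σ
    simp [Subsingleton.elim _ σ₀]

lemma reducedAcyclic_one_of_isPathConnected {U : Set X} (hU : IsPathConnected U) :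
    ReducedAcyclic 1 U := by
  obtain ⟨x₀, hx₀, hjoin⟩ := hU
  have hγ (σ : C(VertexSimplex 1, X)) : ∃ c : SingularChain X 2, (∀ t, σ t ∈ U) →
      (c ∈ chainsIn U 2 ∧ bd 1 c = Finsupp.single σ 1 -
        Finsupp.single (ContinuousMap.const _ x₀) 1) := by
    by_cases hσ : ∀ t, σ t ∈ U
    swap
    · exact ⟨0, fun h => absurd h hσ⟩
    obtain ⟨γ, hγ⟩ := hjoin (hσ (stdSimplex.vertex 0))
    let τ : C(VertexSimplex 2, X) := ⟨fun t => γ.extend (t.1 1),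
      γ.continuous_extend.comp ((continuous_apply 1).comp continuous_subtype_val)⟩
    refine ⟨Finsupp.single τ 1, fun _ => ⟨Finsupp.single_mem_supported ℤ 1 fun t => ?_, ?_⟩⟩
    · change γ.extend (t.1 1) ∈ U
      have : γ.extend (t.1 1) ∈ Set.range γ := by
        rw [← γ.extend_range]
        exact ⟨_, rfl⟩
      obtain ⟨s, hs⟩ := this
      rw [← hs]
      exact hγ s
    · rw [bd_single, Fin.sum_univ_two]
      have h0 : τ.comp (affine (stdSimplex.vertex ∘ (0 : Fin 2).succAbove)) = σ := by
        ext t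
        rw [Subsingleton.elim t (stdSimplex.vertex 0), ContinuousMap.comp_apply, affine_vertex]
        change γ.extend _ = _
        simp
      have h1 : τ.comp (affine (stdSimplex.vertex ∘ (1 : Fin 2).succAbove)) =
          ContinuousMap.const _ x₀ := by
        ext t
        rw [Subsingleton.elim t (stdSimplex.vertex 0), ContinuousMap.comp_apply, affine_vertex]
        change γ.extend _ = _
        simp
      rw [h0, h1]
      simp [sub_eq_add_neg]
  choose g hg using hγ
  intro z hz hcyc
  have hL : ∀ z ∈ chainsIn U 1, Finsupp.linearCombination ℤ g z ∈ chainsIn U 2 := by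
    intro z hz
    refine linear_mem_of_supported (fun σ hσ => ?_) hz
    simpa only [Finsupp.linearCombination_single, one_smul] using (hg σ hσ).1
  have hb : ∀ z ∈ chainsIn U 1, bd 1 (Finsupp.linearCombination ℤ g z) =
      z - Finsupp.lmapDomain ℤ ℤ (fun _ => ContinuousMap.const _ x₀) z := by
    intro z hz
    have := linear_mem_of_supported (P := ⊥) (f := bd 1 ∘ₗ Finsupp.linearCombination ℤ g -
      (LinearMap.id - Finsupp.lmapDomain ℤ ℤ fun _ => ContinuousMap.const (VertexSimplex 1) x₀))
      (fun σ hσ => ?_) hz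
    · exact sub_eq_zero.1 this
    · simp [(hg σ hσ).2]
  refine ⟨_, hL z hz, ?_⟩
  rw [hb z hz, sub_eq_self]
  have h0 : (z.sum fun _ a => a) = 0 := by
    have := DFunLike.congr_fun (show bd 0 z = 0 from hcyc)
      ((ContinuousMap.const _ x₀).comp (affine (stdSimplex.vertex ∘ (0 : Fin 1).succAbove)))
    have hempty : IsEmpty (VertexSimplex 0) := ⟨fun t => absurd t.2.2 (by simp)⟩
    have hsub : Subsingleton C(VertexSimplex 0, X) :=
      ⟨fun f g => ContinuousMap.ext fun t => hempty.elim t⟩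
    rw [bd, Finsupp.linearCombination_apply, Finsupp.sum, Finsupp.finsetSum_apply] at this
    rw [Finsupp.sum]
    simpa [Finsupp.single_apply, Subsingleton.elim _ ((ContinuousMap.const _ x₀).comp
      (affine (stdSimplex.vertex ∘ (0 : Fin 1).succAbove)))] using this
  rw [Finsupp.lmapDomain_apply, Finsupp.mapDomain, ← Finsupp.single_sum, h0, Finsupp.single_zero]

lemma affine_succAbove {n : ℕ} (i : Fin (n + 2)) (t : VertexSimplex (n + 1)) :
    VertexSimplex.affine (stdSimplex.vertex ∘ i.succAbove) t =
      stdSimplex.map (SimplexCategory.δ i) t := by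
  apply Subtype.ext
  funext j
  change _ = FunOnFinite.linearMap ℝ ℝ (SimplexCategory.δ i) (⇑t) j
  rw [VertexSimplex.affine_val, FunOnFinite.linearMap_apply_apply, Finset.sum_filter,
    Finset.sum_apply]
  refine Finset.sum_congr rfl fun k _ => ?_
  change t.1 k * (Pi.single (i.succAbove k) (1 : ℝ) : Fin (n + 2) → ℝ) j = _
  rw [Pi.single_apply, mul_ite, mul_one, mul_zero]
  exact if_congr eq_comm rfl rfl

lemma reducedAcyclic_univ_of_subsingleton {n : ℕ}
    (h : Subsingleton (SingularHomology ℤ X (n + 1))) :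
    ReducedAcyclic (n + 2) (Set.univ : Set X) := by
  intro z _ hz
  let S := ((SimplicialObject.whiskering _ _).obj (ModuleCat.free ℤ)).obj
    (TopCat.toSSet.obj (TopCat.of X))
  let K := (alternatingFaceMapComplex (ModuleCat ℤ)).obj S
  let e (k : ℕ) := (TopCat.of X).toSSetObjEquiv (.op (SimplexCategory.mk k))
  let φ (k : ℕ) : SingularChain X (k + 1) ≃ₗ[ℤ] K.X k := Finsupp.domLCongr (e k).symm
  have hφ (k : ℕ) (c : SingularChain X (k + 2)) : (K.d (k + 1) k).hom (φ (k + 1) c) =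
      φ k (bd (k + 1) c) := by
    suffices (K.d (k + 1) k).hom ∘ₗ (φ (k + 1)).toLinearMap = (φ k).toLinearMap ∘ₗ bd (k + 1) from
      LinearMap.congr_fun this c
    refine Finsupp.lhom_ext' fun σ => LinearMap.ext_ring ?_
    have hφs (k : ℕ) (τ : C(VertexSimplex (k + 1), X)) :
        φ k (Finsupp.single τ 1) = Finsupp.single ((e k).symm τ) 1 :=
      Finsupp.domLCongr_single _ _ _
    have hδ (i : Fin (k + 2)) : (S.δ i).hom (φ (k + 1) (Finsupp.single σ 1)) =
        φ k (Finsupp.single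
          (σ.comp (VertexSimplex.affine (stdSimplex.vertex ∘ i.succAbove))) 1) := by
      rw [hφs, hφs]
      refine (Finsupp.mapDomain_single (f := (TopCat.toSSet.obj (TopCat.of X)).δ i)).trans ?_
      congr 1
      rw [Equiv.eq_symm_apply]
      refine ContinuousMap.ext fun t => ?_
      exact congrArg σ (affine_succAbove i t).symm
    have hd : (K.d (k + 1) k).hom = ∑ i : Fin (k + 2), (-1 : ℤ) ^ (i : ℕ) • (S.δ i).hom := by
      have : K.d (k + 1) k = ∑ i : Fin (k + 2), (-1 : ℤ) ^ (i : ℕ) • S.δ i :=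
        AlternatingFaceMapComplex.obj_d_eq S k
      rw [this, ModuleCat.hom_sum]
      rfl
    simp only [LinearMap.comp_apply, Finsupp.lsingle_apply, LinearEquiv.coe_coe, bd_single,
      map_sum]
    rw [hd, LinearMap.sum_apply]
    exact Finset.sum_congr rfl fun i _ =>
      (congrArg (fun y => (-1 : ℤ) ^ (i : ℕ) • y) (hδ i)).trans ((φ k).map_smul _ _).symm
  have hK : K.ExactAt (n + 1) := by
    rw [HomologicalComplex.exactAt_iff_isZero_homology]
    have : Subsingleton (K.homology (n + 1)) := h
    exact ModuleCat.isZero_of_subsingleton _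
  rw [HomologicalComplex.exactAt_iff' _ (n + 2) (n + 1) n (by simp) (by simp),
    ShortComplex.moduleCat_exact_iff] at hK
  obtain ⟨y, hy⟩ := hK (φ (n + 1) z) (by
    change (K.d (n + 1) n).hom _ = 0
    rw [hφ, show bd (n + 1) z = 0 from hz, map_zero])
  refine ⟨(φ (n + 2)).symm y, by simp [chainsIn], ?_⟩
  apply (φ (n + 1)).injective
  exact (hφ (n + 1) _).symm.trans
    ((congrArg _ (LinearEquiv.apply_symm_apply (φ (n + 2)) y)).trans hy)

lemma reducedAcyclic_of_subsingleton {n : ℕ} {U : Set X}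
    (h : Subsingleton (SingularHomology ℤ U (n + 1))) : ReducedAcyclic (n + 2) U := by
  let ι : C(U, X) := ⟨Subtype.val, continuous_subtype_val⟩
  let incl (m : ℕ) : SingularChain U m →ₗ[ℤ] SingularChain X m :=
    Finsupp.lmapDomain ℤ ℤ fun σ => ι.comp σ
  have hincl (m : ℕ) (c : SingularChain U (m + 1)) : bd m (incl (m + 1) c) = incl m (bd m c) := by
    suffices bd m ∘ₗ incl (m + 1) = incl m ∘ₗ bd m from LinearMap.congr_fun this c
    refine Finsupp.lhom_ext' fun σ => LinearMap.ext_ring ?_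
    simp only [incl, LinearMap.comp_apply, Finsupp.lsingle_apply, bd_single, map_sum, map_smul,
      Finsupp.lmapDomain_apply, Finsupp.mapDomain_single, ContinuousMap.comp_assoc]
  have hinj (m : ℕ) : Function.Injective (incl m) := Finsupp.mapDomain_injective fun σ τ hστ =>
    ContinuousMap.ext fun t => Subtype.ext (DFunLike.congr_fun hστ t)
  have hrange (m : ℕ) (c : SingularChain U m) : incl m c ∈ chainsIn U m :=
    VertexSimplex.map_mem_supported (s := Set.univ) (fun σ _ t => (σ t).2)
      (by simp [Finsupp.supported_univ])
  intro z hz hcyc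
  have hlift : ∃ z', incl (n + 2) z' = z := by
    refine VertexSimplex.linear_mem_of_supported (f := LinearMap.id)
      (P := LinearMap.range (incl (n + 2))) (fun σ hσ => ?_) hz
    exact ⟨Finsupp.single ⟨fun t => ⟨σ t, hσ t⟩, σ.continuous.subtype_mk _⟩ 1,
      Finsupp.mapDomain_single⟩
  obtain ⟨z', rfl⟩ := hlift
  obtain ⟨c, -, hc⟩ := reducedAcyclic_univ_of_subsingleton h z' (by simp [chainsIn]) (by
    apply hinj
    rw [← hincl, map_zero]
    exact hcyc)
  exact ⟨incl _ c, hrange _ c, by rw [hincl, hc]⟩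

end SingularChain

section Helly

open SingularChain

variable {X : Type} [TopologicalSpace X] {ℱ : Set (Set X)}

lemma isOpen_setOf_forall_mem {l : List (Set X)} (h : ∀ F ∈ l, IsOpen F) :
    IsOpen {x | ∀ F ∈ l, x ∈ F} := by
  have : {x | ∀ F ∈ l, x ∈ F} = ⋂ i : Fin l.length, l.get i := by
    ext x
    simp [List.forall_mem_iff_get]
  rw [this]
  exact isOpen_iInter_of_finite fun i => h _ (l.get_mem i)

lemma isOpen_setOf_exists_mem {J : List (Set X)} (h : ∀ F ∈ J, IsOpen F) :
    IsOpen {x | ∃ F ∈ J, x ∈ F} := by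
  have : {x | ∃ F ∈ J, x ∈ F} = ⋃ F ∈ {F | F ∈ J}, F := by
    ext x
    simp
  rw [this]
  exact isOpen_biUnion h

/-- `HellyAcyclic ℱ D` says that the intersection of any `1 ≤ j ≤ D + 1` members of `ℱ` has
vanishing reduced homology in degree `D - j`. -/
def HellyAcyclic (ℱ : Set (Set X)) (D : ℕ) : Prop :=
  ∀ (l : List (Set X)) (m : ℕ), l ≠ [] → (∀ F ∈ l, F ∈ ℱ) → l.length + m = D + 1 →
    ReducedAcyclic m {x | ∀ F ∈ l, x ∈ F}

lemma HellyAcyclic.inter_union {D : ℕ} (hD : HellyAcyclic ℱ D) (hopen : ∀ F ∈ ℱ, IsOpen F)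
    (J : List (Set X)) (hJ : J ≠ []) (hJℱ : ∀ F ∈ J, F ∈ ℱ) (l : List (Set X)) (m : ℕ)
    (hl : ∀ F ∈ l, F ∈ ℱ) (hlm : l.length + m = D) :
    ReducedAcyclic m ({x | ∀ F ∈ l, x ∈ F} ∩ {x | ∃ F ∈ J, x ∈ F}) := by
  induction J generalizing l m with
  | nil => exact absurd rfl hJ
  | cons k J ih =>
    have hk : k ∈ ℱ := hJℱ k (by simp)
    have hkl : ∀ F ∈ k :: l, F ∈ ℱ := by
      simpa using ⟨hk, hl⟩
    have hA : ReducedAcyclic m {x | ∀ F ∈ k :: l, x ∈ F} :=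
      hD (k :: l) m (by simp) hkl (by simp; omega)
    rcases eq_or_ne J [] with rfl | hJ'
    · convert hA using 1
      ext x
      simp [and_comm]
    have hJℱ' : ∀ F ∈ J, F ∈ ℱ := fun F hF => hJℱ F (by simp [hF])
    have hB := ih hJ' hJℱ' l m hl hlm
    have hunion : ({x | ∀ F ∈ l, x ∈ F} ∩ {x | ∃ F ∈ k :: J, x ∈ F}) =
        {x | ∀ F ∈ k :: l, x ∈ F} ∪ ({x | ∀ F ∈ l, x ∈ F} ∩ {x | ∃ F ∈ J, x ∈ F}) := by
      ext x
      simp only [List.mem_cons, forall_eq_or_imp, exists_eq_or_imp, Set.mem_inter_iff,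
        Set.mem_union, Set.mem_ofPred_eq]
      tauto
    rw [hunion]
    cases m with
    | zero =>
      rw [reducedAcyclic_zero_iff] at hA ⊢
      exact hA.mono Set.subset_union_left
    | succ m =>
      refine ReducedAcyclic.union (isOpen_setOf_forall_mem fun F hF => hopen F (hkl F hF))
        ((isOpen_setOf_forall_mem fun F hF => hopen F (hl F hF)).inter
          (isOpen_setOf_exists_mem fun F hF => hopen F (hJℱ' F hF))) hA hB ?_
      convert ih hJ' hJℱ' (k :: l) m hkl (by simp; omega) using 1
      ext x
      simp only [List.mem_cons, forall_eq_or_imp, Set.mem_inter_iff, Set.mem_ofPred_eq]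
      tauto

lemma HellyAcyclic.inter_union_succ {D : ℕ} (hD : HellyAcyclic ℱ D)
    (hopen : ∀ F ∈ ℱ, IsOpen F) (hX : ∀ U : Set X, IsOpen U → ReducedAcyclic (D + 1) U)
    (l : List (Set X)) (J : List (Set X)) (hJ : J ≠ []) (hJℱ : ∀ F ∈ J, F ∈ ℱ) (m : ℕ)
    (hl : ∀ F ∈ l, F ∈ ℱ) (hlm : l.length + m = D + 1) :
    ReducedAcyclic m ({x | ∀ F ∈ l, x ∈ F} ∩ {x | ∃ F ∈ J, x ∈ F}) := by
  have hO (l J : List (Set X)) (hl : ∀ F ∈ l, F ∈ ℱ) (hJ : ∀ F ∈ J, F ∈ ℱ) :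
      IsOpen ({x | ∀ F ∈ l, x ∈ F} ∩ {x | ∃ F ∈ J, x ∈ F}) :=
    (isOpen_setOf_forall_mem fun F hF => hopen F (hl F hF)).inter
      (isOpen_setOf_exists_mem fun F hF => hopen F (hJ F hF))
  induction l generalizing J m with
  | nil =>
    obtain rfl : m = D + 1 := by simpa using hlm
    exact hX _ (hO [] J (by simp) hJℱ)
  | cons k l ih =>
    have hk : k ∈ ℱ := hl k (by simp)
    have hl' : ∀ F ∈ l, F ∈ ℱ := fun F hF => hl F (by simp [hF])
    have hlen : l.length + m = D := by simp at hlm; omega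
    have hk' : ∀ F ∈ [k], F ∈ ℱ := by simpa using hk
    have hU := ih (k :: J) (by simp) (by simpa using ⟨hk, hJℱ⟩) (m + 1) hl' (by omega)
    have key := ReducedAcyclic.inter (hO l [k] hl' hk') (hO l J hl' hJℱ)
      (hD.inter_union hopen [k] (by simp) hk' l m hl' hlen)
      (hD.inter_union hopen J hJ hJℱ l m hl' hlen) (by
        convert hU using 1
        ext x
        simp only [List.mem_cons, exists_eq_or_imp, List.not_mem_nil, or_false,
          exists_eq_left, Set.mem_inter_iff, Set.mem_union, Set.mem_ofPred_eq]
        tauto)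
    convert key using 1
    ext x
    simp only [List.mem_cons, forall_eq_or_imp, List.not_mem_nil, or_false,
      exists_eq_left, Set.mem_inter_iff, Set.mem_ofPred_eq]
    tauto

lemma HellyAcyclic.succ {D : ℕ} (hD : HellyAcyclic ℱ D)
    (hopen : ∀ F ∈ ℱ, IsOpen F) (hX : ∀ U : Set X, IsOpen U → ReducedAcyclic (D + 1) U) :
    HellyAcyclic ℱ (D + 1) := by
  intro l m hl hlℱ hlm
  obtain ⟨k, l, rfl⟩ := List.exists_cons_of_ne_nil hl
  convert hD.inter_union_succ hopen hX l [k] (by simp) (by simpa using hlℱ k (by simp)) m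
    (fun F hF => hlℱ F (by simp [hF])) (by simp at hlm; omega) using 1
  ext x
  simp [and_comm]

end Helly

/-- **Montejano's topological Helly theorem.**
Let `d ≥ 1` and let `X` be a paracompact Hausdorff space with `H_t(U; ℤ) = 0` for every open
`U ⊆ X` and every `t ≥ d`. Let `ℱ` be a finite nonempty family of open subsets of `X` such
that (i) for `1 ≤ j ≤ d − 1` and all `F₁, …, F_j ∈ ℱ`, `H_{d−j}(F₁ ∩ ⋯ ∩ F_j; ℤ) = 0`;
(ii) the intersection of any `d` members is empty or path-connected; (iii) the intersection of
any `d + 1` members is nonempty. Then `⋂ℱ ≠ ∅`. -/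
theorem montejano_helly
    (d : ℕ) (hd : 1 ≤ d)
    (X : Type) [TopologicalSpace X] [ParacompactSpace X] [T2Space X]
    (hX : ∀ U : Set X, IsOpen U → ∀ t : ℕ, d ≤ t →
      Subsingleton (SingularHomology ℤ ↥U t))
    (ℱ : Finset (Set X)) (hne : ℱ.Nonempty)
    (hopen : ∀ F ∈ ℱ, IsOpen F)
    (h1 : ∀ j : ℕ, 1 ≤ j → j ≤ d - 1 → ∀ F : Fin j → Set X, (∀ i, F i ∈ ℱ) →
      Subsingleton (SingularHomology ℤ ↥(⋂ i, F i) (d - j)))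
    (h2 : ∀ F : Fin d → Set X, (∀ i, F i ∈ ℱ) →
      (⋂ i, F i) = ∅ ∨ IsPathConnected (⋂ i, F i))
    (h3 : ∀ F : Fin (d + 1) → Set X, (∀ i, F i ∈ ℱ) → (⋂ i, F i).Nonempty) :
    (⋂₀ (ℱ : Set (Set X))).Nonempty := by
  have hX' (t : ℕ) (ht : d ≤ t) (U : Set X) (hU : IsOpen U) :
      SingularChain.ReducedAcyclic (t + 1) U := by
    obtain ⟨n, rfl⟩ : ∃ n, t = n + 1 := ⟨t - 1, by omega⟩
    exact SingularChain.reducedAcyclic_of_subsingleton (hX U hU (n + 1) ht)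
  have hbase : HellyAcyclic (ℱ : Set (Set X)) d := by
    intro l m hl hlℱ hlm
    have hinter : {x | ∀ F ∈ l, x ∈ F} = ⋂ i : Fin l.length, l.get i := by
      ext x
      simp [List.forall_mem_iff_get]
    have hget (i : Fin l.length) : l.get i ∈ ℱ := hlℱ _ (l.get_mem i)
    have hpos : 1 ≤ l.length := List.length_pos_iff.2 hl
    rw [hinter]
    generalize l.get = f at hget ⊢
    generalize l.length = j at f hget hlm hpos ⊢
    match m, hlm with
    | 0, hlm =>
      obtain rfl : j = d + 1 := by omega
      exact SingularChain.reducedAcyclic_zero_iff.2 (h3 f hget)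
    | 1, hlm =>
      obtain rfl : j = d := by omega
      refine SingularChain.reducedAcyclic_one_of_isPathConnected
        ((h2 f hget).resolve_left fun hempty => ?_)
      obtain ⟨x, hx⟩ := h3 (Fin.snoc f (f ⟨0, hpos⟩)) fun i => by
        refine Fin.lastCases ?_ (fun i => ?_) i
        · simpa using hget _
        · simpa using hget _
      have hmem : x ∈ ⋂ i, f i := Set.mem_iInter.2 fun i => by
        simpa using Set.mem_iInter.1 hx i.castSucc
      rw [hempty] at hmem
      exact hmem
    | n + 2, hlm =>
      have hn : d - j = n + 1 := by omega
      have := h1 j hpos (by omega) f hget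
      rw [hn] at this
      exact SingularChain.reducedAcyclic_of_subsingleton this
  have hall (k : ℕ) : HellyAcyclic (ℱ : Set (Set X)) (d + k) := by
    induction k with
    | zero => exact hbase
    | succ k ih => exact ih.succ hopen (hX' (d + k) (by omega))
  obtain ⟨F₀, hF₀⟩ := hne
  have := hall ℱ.card (ℱ.toList ++ List.replicate (d + 1) F₀) 0 (by simp) (fun F hF => by
    rcases List.mem_append.1 hF with h | h
    · simpa using h
    · rw [List.eq_of_mem_replicate h]
      exact hF₀) (by simp; omega)
  obtain ⟨x, hx⟩ := SingularChain.reducedAcyclic_zero_iff.1 this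
  exact ⟨x, fun F hF => hx F (List.mem_append_left _ (by simpa using hF))⟩
end

section
/- Let d ≥ 1 be an integer and let 𝒞₁, …, 𝒞_{d+1} be nonempty finite families of convex sets in ℝ^d. If for every choice C₁ ∈ 𝒞₁, C₂ ∈ 𝒞₂, …, C_{d+1} ∈ 𝒞_{d+1} the intersection C₁ ∩ C₂ ∩ ⋯ ∩ C_{d+1} is nonempty, then there exists an index i ∈ {1,…,d+1} such that ⋂𝒞_i ≠ ∅. -/
/-- If `d + 1` convex sets in dimension `d` have a common point, but none in the convex set `L`,
then all but one of them already have no common point in `L`. -/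
theorem exists_disjoint_iInter_ne {E κ : Type*} [AddCommGroup E] [Module ℝ E]
    [FiniteDimensional ℝ E] [Fintype κ] (hκ : Fintype.card κ = Module.finrank ℝ E + 1)
    {K : κ → Set E} (hK : ∀ i, Convex ℝ (K i)) {L : Set E} (hL : Convex ℝ L)
    (hne : (⋂ i, K i).Nonempty) (hdisj : Disjoint (⋂ i, K i) L) :
    ∃ j, Disjoint (⋂ i, ⋂ _ : i ≠ j, K i) L := by
  classical
  by_contra! h
  let F : Option κ → Set E := fun o => o.elim L K
  have hF : (⋂ o ∈ (Finset.univ : Finset (Option κ)), F o).Nonempty := by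
    refine Convex.helly_theorem (𝕜 := ℝ) ?_ ?_ ?_
    · simp [hκ]
    · rintro (_ | i) -
      exacts [hL, hK i]
    · intro I _ hI
      obtain ⟨o, ho⟩ : ∃ o, o ∉ I := by
        by_contra! hall
        rw [Finset.eq_univ_of_forall hall, Finset.card_univ, Fintype.card_option] at hI
        omega
      cases o with
      | none =>
        obtain ⟨x, hx⟩ := hne
        refine ⟨x, Set.mem_iInter₂.2 ?_⟩
        rintro (_ | i) hi
        exacts [absurd hi ho, Set.mem_iInter.1 hx i]
      | some j =>
        obtain ⟨x, hx, hxL⟩ := Set.not_disjoint_iff.1 (h j)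
        refine ⟨x, Set.mem_iInter₂.2 ?_⟩
        rintro (_ | i) hi
        · exact hxL
        · exact Set.mem_iInter₂.1 hx i fun hij => ho (hij ▸ hi)
  obtain ⟨x, hx⟩ := hF
  simp only [Finset.mem_univ, Set.iInter_true, Set.mem_iInter] at hx
  exact Set.disjoint_left.1 hdisj (Set.mem_iInter.2 fun i => hx (some i)) (hx none)

/-- In a strictly convex space, a convex set has at most one point of minimal norm. -/
theorem Convex.eq_of_forall_norm_le {E : Type*} [NormedAddCommGroup E] [NormedSpace ℝ E]
    [StrictConvexSpace ℝ E] {s : Set E} (hs : Convex ℝ s) {x y : E} (hx : x ∈ s) (hy : y ∈ s)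
    (hmin : ∀ z ∈ s, ‖x‖ ≤ ‖z‖) (hyx : ‖y‖ ≤ ‖x‖) : x = y := by
  by_contra hne
  have h2 : (0 : ℝ) < 1 / 2 := by norm_num
  have h1 : (1 / 2 : ℝ) + 1 / 2 = 1 := by norm_num
  exact (hmin _ (hs hx hy h2.le h2.le h1)).not_gt
    (norm_combo_lt_of_ne le_rfl hyx hne h2 h2 h1)

/-- A nonempty closed set in a proper space has a point of minimal norm. -/
theorem IsClosed.exists_forall_norm_le {E : Type*} [NormedAddCommGroup E] [ProperSpace E]
    {s : Set E} (hs : IsClosed s) (hne : s.Nonempty) : ∃ x ∈ s, ∀ z ∈ s, ‖x‖ ≤ ‖z‖ := by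
  obtain ⟨x, hx, h⟩ := hs.exists_infDist_eq_dist hne 0
  refine ⟨x, hx, fun z hz => ?_⟩
  simpa [h] using Metric.infDist_le_dist_of_mem (x := (0 : E)) hz

/-- The colorful Helly theorem for finite indexed families of closed convex sets. -/
theorem colorful_helly_of_isClosed {E κ : Type*} [NormedAddCommGroup E] [NormedSpace ℝ E]
    [StrictConvexSpace ℝ E] [FiniteDimensional ℝ E] [Fintype κ]
    (hκ : Fintype.card κ = Module.finrank ℝ E + 1) {ι : κ → Type*} [∀ i, Finite (ι i)]
    [∀ i, Nonempty (ι i)] {K : ∀ i, ι i → Set E} (hconv : ∀ i a, Convex ℝ (K i a))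
    (hclosed : ∀ i a, IsClosed (K i a)) (hcol : ∀ s : ∀ i, ι i, (⋂ i, K i (s i)).Nonempty) :
    ∃ i, (⋂ a, K i a).Nonempty := by
  classical
  have : ProperSpace E := FiniteDimensional.proper ℝ E
  have : Nonempty κ := Fintype.card_pos_iff.1 (by omega)
  let A : κ × (∀ i, ι i) → Set E := fun t => ⋂ i, ⋂ _ : i ≠ t.1, K i (t.2 i)
  have hsub (s : ∀ i, ι i) (j : κ) : (⋂ i, K i (s i)) ⊆ A (j, s) :=
    fun x hx => Set.mem_iInter₂.2 fun i _ => Set.mem_iInter.1 hx i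
  have hAconv (t) : Convex ℝ (A t) := convex_iInter₂ fun i _ => hconv i _
  have hmin (t) : ∃ x ∈ A t, ∀ z ∈ A t, ‖x‖ ≤ ‖z‖ :=
    (isClosed_iInter fun i => isClosed_iInter fun _ => hclosed i _).exists_forall_norm_le
      ((hcol t.2).mono (hsub t.2 t.1))
  choose p hpA hpmin using hmin
  obtain ⟨⟨j, s⟩, hmax⟩ := Finite.exists_max fun t => ‖p t‖
  refine ⟨j, p (j, s), Set.mem_iInter.2 fun a => ?_⟩
  let s' := Function.update s j a
  have hA : A (j, s') = A (j, s) :=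
    Set.iInter₂_congr fun i hi => by simp only [s', Function.update_of_ne hi]
  obtain ⟨q, hq, hqmin⟩ :=
    (isClosed_iInter fun i => hclosed i (s' i)).exists_forall_norm_le (hcol s')
  obtain ⟨k, hk⟩ := exists_disjoint_iInter_ne hκ (fun i => hconv i (s' i))
    (convex_ball (0 : E) ‖q‖) (hcol s') <| Set.disjoint_left.2 fun x hx hxb =>
      (hqmin x hx).not_gt (mem_ball_zero_iff.1 hxb)
  have hqp : ‖q‖ ≤ ‖p (j, s)‖ := by
    refine le_trans ?_ (hmax (k, s'))
    by_contra! hlt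
    exact Set.disjoint_left.1 hk (hpA (k, s')) (mem_ball_zero_iff.2 hlt)
  have hpq : p (j, s) = q :=
    (hAconv _).eq_of_forall_norm_le (hpA _) (hA ▸ hsub s' j hq) (hpmin _) hqp
  have hqj := Set.mem_iInter.1 hq j
  simp only [s', Function.update_self] at hqj
  exact hpq ▸ hqj

/-- **Lovász's colorful Helly theorem.**
Let `d ≥ 1` and let `𝒞₁, …, 𝒞_{d+1}` be nonempty finite families of convex sets in `ℝ^d`.
If every colorful selection `C₁ ∈ 𝒞₁, …, C_{d+1} ∈ 𝒞_{d+1}` has nonempty intersection,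
then some color class `𝒞ᵢ` has nonempty intersection. -/
theorem colorful_helly
    (d : ℕ) (hd : 1 ≤ d)
    (𝒞 : Fin (d + 1) → Finset (Set (Fin d → ℝ)))
    (hne : ∀ i, (𝒞 i).Nonempty)
    (hconv : ∀ i, ∀ C ∈ 𝒞 i, Convex ℝ C)
    (hcolorful : ∀ C : Fin (d + 1) → Set (Fin d → ℝ), (∀ i, C i ∈ 𝒞 i) →
      (⋂ i, C i).Nonempty) :
    ∃ i, (⋂₀ ((𝒞 i : Set (Set (Fin d → ℝ))))).Nonempty := by
  have (i : Fin (d + 1)) : Nonempty (𝒞 i) := (hne i).coe_sort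
  have hcol (s : ∀ i, 𝒞 i) : ∃ x, ∀ i, x ∈ (s i : Set (Fin d → ℝ)) := by
    simpa [Set.Nonempty] using hcolorful (fun i => s i) fun i => (s i).2
  choose x hx using hcol
  let e := (EuclideanSpace.equiv (Fin d) ℝ).symm
  let P : ∀ i, 𝒞 i → Set (Fin d → ℝ) := fun i C => x '' {s | s i = C}
  have hP (i C) : convexHull ℝ (P i C) ⊆ C := by
    refine convexHull_min ?_ (hconv i C C.2)
    rintro _ ⟨s, rfl, rfl⟩
    exact hx s i
  obtain ⟨i, y, hy⟩ := colorful_helly_of_isClosed (E := EuclideanSpace ℝ (Fin d)) (by simp)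
    (K := fun i C => convexHull ℝ (e '' P i C)) (fun _ _ => convex_convexHull ℝ _)
    (fun i C => (((Set.toFinite _).image x).image e).isClosed_convexHull ℝ)
    fun s => ⟨e (x s), Set.mem_iInter.2 fun i =>
      subset_convexHull ℝ _ ⟨x s, ⟨s, rfl, rfl⟩, rfl⟩⟩
  refine ⟨i, e.symm y, fun C hC => hP i ⟨C, hC⟩ ?_⟩
  have hyC := Set.mem_iInter.1 hy ⟨C, hC⟩
  have himg := e.toLinearEquiv.toLinearMap.image_convexHull (P i ⟨C, hC⟩)
  obtain ⟨z, hz, rfl⟩ := himg.symm.subset hyC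
  simpa using hz
end

section
/- Let d ≥ 1 and n ≥ d+1 be integers, let α ∈ (0,1], and let F₁, …, F_n be convex subsets of ℝ^d. If at least α·C(n, d+1) of the (d+1)-element subsets I ⊆ {1,…,n} satisfy ⋂_{i∈I} F_i ≠ ∅, then there exists a subset I ⊆ {1,…,n} with |I| ≥ (1 − (1−α)^{1/(d+1)})·n such that ⋂_{i∈I} F_i ≠ ∅. -/
open Finset in
/-- A function on `k`-subsets of `ι` that is a combination of products
`∏ s ∈ S, (p T).eval (v s)` with `deg p T < N`, and that vanishes at `insert i σ` for at least `N`
indices `i` outside `σ`, vanishes at `insert i σ` for all `i` outside `σ`. -/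
lemma sum_prod_eval_insert_eq_zero {ι κ : Type*} [DecidableEq ι] {v : ι → ℝ}
    (hv : Function.Injective v) (P : Finset κ) (p : κ → Polynomial ℝ) (c : κ → ℝ) {N : ℕ}
    (hdeg : ∀ T ∈ P, (p T).degree < N) {σ W : Finset ι} (hW : N ≤ #W) (hσW : Disjoint σ W)
    (h0 : ∀ i ∈ W, ∑ T ∈ P, c T * ∏ s ∈ insert i σ, (p T).eval (v s) = 0)
    {i : ι} (hi : i ∉ σ) :
    ∑ T ∈ P, c T * ∏ s ∈ insert i σ, (p T).eval (v s) = 0 := by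
  let q : Polynomial ℝ := ∑ T ∈ P, (c T * ∏ s ∈ σ, (p T).eval (v s)) • p T
  have hq : ∀ j ∉ σ, q.eval (v j) = ∑ T ∈ P, c T * ∏ s ∈ insert j σ, (p T).eval (v s) := by
    intro j hj
    simp only [q, Polynomial.eval_finsetSum, Polynomial.eval_smul, smul_eq_mul]
    refine sum_congr rfl fun T _ => ?_
    rw [prod_insert hj]
    ring
  have hqdeg : q ∈ Polynomial.degreeLT ℝ N :=
    Submodule.sum_mem _ fun T hT =>
      Submodule.smul_mem _ _ (Polynomial.mem_degreeLT.2 (hdeg T hT))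
  have hq0 : q = 0 := by
    refine Polynomial.eq_zero_of_degree_lt_of_eval_index_eq_zero W hv.injOn
      ((Polynomial.mem_degreeLT.1 hqdeg).trans_le (by exact_mod_cast hW)) fun j hj => ?_
    rw [hq j (disjoint_right.1 hσW hj), h0 j hj]
  rw [← hq i hi, hq0, Polynomial.eval_zero]

open Finset in
/-- Combinatorial upper bound theorem: if the `(d + 1)`-sets outside `B` can be eliminated in
decreasing order of `ρ`, each through a `d`-subset `σ` all of whose not yet eliminated extensions
lie in a set `τ` of size at most `m`, then `B` contains at least `(n - m + d).choose (d + 1)` sets. -/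
theorem choose_le_card_of_collapsible {ι : Type*} [Fintype ι] [DecidableEq ι] {d m : ℕ}
    (hdm : d ≤ m) (hm : m ≤ Fintype.card ι) (B : Finset (Finset ι)) (ρ : Finset ι → ℝ)
    (h : ∀ S : Finset ι, #S = d + 1 → S ∉ B → ∃ σ τ : Finset ι, σ ⊆ S ∧ #σ = d ∧ S ⊆ τ ∧ #τ ≤ m ∧
      ∀ i ∉ τ, insert i σ ∈ B ∨ ρ S < ρ (insert i σ)) :
    (Fintype.card ι - m + d).choose (d + 1) ≤ #B := by
  obtain ⟨v, hv⟩ : ∃ v : ι → ℝ, Function.Injective v :=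
    ⟨fun i => ((Fintype.equivFin ι i : ℕ) : ℝ), fun i j hij => by
      simpa [Fin.val_inj] using hij⟩
  obtain ⟨G, -, hG⟩ := exists_subset_card_eq (s := (univ : Finset ι))
    (n := Fintype.card ι - m + d) (by rw [card_univ]; omega)
  let P := powersetCard (d + 1) G
  let p : Finset ι → Polynomial ℝ := fun T =>
    ∏ a ∈ G \ T, (Polynomial.X - Polynomial.C (v a))
  have hp : ∀ T i, (p T).eval (v i) = ∏ a ∈ G \ T, (v i - v a) := by
    intro T i
    simp [p, Polynomial.eval_prod]
  have hdeg : ∀ T ∈ P, (p T).degree < (Fintype.card ι - m : ℕ) := by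
    intro T hT
    obtain ⟨hTG, hTc⟩ := mem_powersetCard.1 hT
    have h1 := card_le_card hTG
    have h2 := card_sdiff_of_subset hTG
    rw [Polynomial.degree_prod]
    simp only [Polynomial.degree_X_sub_C, sum_const, nsmul_eq_mul, mul_one]
    have h3 : #(G \ T) < Fintype.card ι - m := by omega
    exact_mod_cast h3
  let L : (P → ℝ) →ₗ[ℝ] (B → ℝ) :=
    { toFun := fun c S => ∑ T : P, c T * ∏ s ∈ S.1, (p T.1).eval (v s)
      map_add' := fun c c' => by
        ext S
        simp [add_mul, sum_add_distrib]
      map_smul' := fun r c => by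
        ext S
        simp [mul_assoc, mul_sum] }
  have hL : Function.Injective L := by
    rw [← LinearMap.ker_eq_bot, LinearMap.ker_eq_bot']
    intro c hc
    have hB : ∀ S ∈ B, ∑ T : P, c T * ∏ s ∈ S, (p T.1).eval (v s) = 0 :=
      fun S hS => congrFun hc ⟨S, hS⟩
    have hall : ∀ S : Finset ι, #S = d + 1 →
        ∑ T : P, c T * ∏ s ∈ S, (p T.1).eval (v s) = 0 := by
      by_contra! hne
      obtain ⟨S₀, hS₀, hS₀'⟩ := hne
      obtain ⟨S, hS, hmax⟩ := exists_max_image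
        ((powersetCard (d + 1) (univ : Finset ι)).filter
          fun S => ∑ T : P, c T * ∏ s ∈ S, (p T.1).eval (v s) ≠ 0) ρ
        ⟨S₀, by simp only [mem_filter, mem_powersetCard_univ]; exact ⟨hS₀, hS₀'⟩⟩
      simp only [mem_filter, mem_powersetCard_univ] at hS hmax
      obtain ⟨hSc, hS0⟩ := hS
      obtain ⟨σ, τ, hσS, hσ, hSτ, hτ, hext⟩ := h S hSc fun hSB => hS0 (hB S hSB)
      obtain ⟨i, hi, rfl⟩ : ∃ i, i ∉ σ ∧ insert i σ = S :=
        exists_eq_insert_iff.2 ⟨hσS, by omega⟩ |>.imp fun _ hx => by simpa using hx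
      refine hS0 (sum_prod_eval_insert_eq_zero hv univ (fun T : P => p T.1) c
        (fun T _ => hdeg T.1 T.2) (W := τᶜ) (by rw [card_compl]; omega)
        (disjoint_compl_right.mono_left (hσS.trans hSτ)) (fun j hj => ?_) hi)
      rw [mem_compl] at hj
      by_contra hj0
      rcases hext j hj with hjB | hjρ
      · exact hj0 (hB _ hjB)
      · refine (hmax _ ⟨?_, hj0⟩).not_gt hjρ
        rw [card_insert_of_notMem fun hjσ => hj (hSτ (hσS hjσ)), hσ]
    ext T
    obtain ⟨hTG, hTc⟩ := mem_powersetCard.1 T.2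
    have hT := hall T.1 hTc
    rw [sum_eq_single T] at hT
    · refine (mul_eq_zero.1 hT).resolve_right (prod_ne_zero_iff.2 fun s hs => ?_)
      rw [hp]
      refine prod_ne_zero_iff.2 fun a ha => sub_ne_zero.2 fun hsa => ?_
      exact (mem_sdiff.1 ha).2 (hv hsa ▸ hs)
    · intro T' _ hne
      obtain ⟨hTG', hTc'⟩ := mem_powersetCard.1 T'.2
      have hnot : ¬ T.1 ⊆ T'.1 := fun hsub =>
        hne (Subtype.ext (eq_of_subset_of_card_le hsub (by omega)).symm)
      obtain ⟨s, hs, hs'⟩ := not_subset.1 hnot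
      rw [prod_eq_zero hs, mul_zero]
      rw [hp]
      exact prod_eq_zero (mem_sdiff.2 ⟨hTG hs, hs'⟩) (sub_self _)
    · simp
  have hfin := LinearMap.finrank_le_finrank_of_injective hL
  rw [Module.finrank_fintype_fun_eq_card, Module.finrank_fintype_fun_eq_card, Fintype.card_coe,
    Fintype.card_coe] at hfin
  rwa [card_powersetCard, hG] at hfin

open Finset in
/-- The minimum of a convex function over an intersection of at least `dim E` convex sets is already
the minimum over the intersection of some `dim E` of them. -/
lemma exists_subset_card_eq_finrank_isMinOn {ι E : Type*} [AddCommGroup E] [Module ℝ E]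
    [FiniteDimensional ℝ E] {F : ι → Set E} (hF : ∀ i, Convex ℝ (F i)) {f : E → ℝ}
    (hf : ConvexOn ℝ Set.univ f) {S : Finset ι} (hS : Module.finrank ℝ E ≤ #S) {x : E}
    (hx : x ∈ ⋂ i ∈ S, F i) (hmin : IsMinOn f (⋂ i ∈ S, F i) x) :
    ∃ σ ⊆ S, #σ = Module.finrank ℝ E ∧ IsMinOn f (⋂ i ∈ σ, F i) x := by
  classical
  by_contra! hcon
  let F' : Option ι → Set E := fun o => o.elim {y | f y < f x} F
  obtain ⟨y, hy⟩ : (⋂ o ∈ insertNone S, F' o).Nonempty := by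
    refine Convex.helly_theorem (𝕜 := ℝ) (by simpa using hS) ?_ ?_
    · rintro (_ | i) -
      · simpa [F'] using hf.convex_lt (f x)
      · exact hF i
    · intro I hI hIc
      have hsub : eraseNone I ⊆ S := fun i hi => by
        simpa using hI (mem_eraseNone.1 hi)
      by_cases hnone : none ∈ I
      · have hc : #(eraseNone I) = Module.finrank ℝ E := by
          rw [card_eraseNone_eq_card_erase, card_erase_of_mem hnone, hIc, Nat.add_sub_cancel]
        have := hcon _ hsub hc
        simp only [isMinOn_iff, not_forall, not_le] at this
        obtain ⟨y, hy, hyx⟩ := this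
        refine ⟨y, Set.mem_iInter₂.2 ?_⟩
        rintro (_ | i) ho
        · exact hyx
        · exact Set.mem_iInter₂.1 hy i (mem_eraseNone.2 ho)
      · refine ⟨x, Set.mem_iInter₂.2 ?_⟩
        rintro (_ | i) ho
        · exact absurd ho hnone
        · exact Set.mem_iInter₂.1 hx i (hsub (mem_eraseNone.2 ho))
  rw [Set.mem_iInter₂] at hy
  have h1 : f y < f x := hy none (by simp)
  exact h1.not_ge (hmin (Set.mem_iInter₂.2 fun i hi => hy (some i) (by simpa using hi)))

lemma strictConvexOn_sum_sq (ι : Type*) [Fintype ι] :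
    StrictConvexOn ℝ Set.univ (fun y : ι → ℝ => ∑ i, y i ^ 2) := by
  refine ⟨convex_univ, fun x _ y _ hxy a b ha hb hab => ?_⟩
  obtain ⟨j, hj⟩ := Function.ne_iff.1 hxy
  have key : ∀ i, a * x i ^ 2 + b * y i ^ 2 - (a * x i + b * y i) ^ 2
      = a * b * (x i - y i) ^ 2 := by
    intro i
    obtain rfl : b = 1 - a := by linarith
    ring
  simp only [smul_eq_mul, Pi.add_apply, Pi.smul_apply, Finset.mul_sum, ← Finset.sum_add_distrib]
  refine Finset.sum_lt_sum (fun i _ => ?_) ⟨j, Finset.mem_univ _, ?_⟩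
  · have := key i
    have : 0 ≤ a * b * (x i - y i) ^ 2 := by positivity
    linarith [key i]
  · have : 0 < a * b * (x j - y j) ^ 2 := by
      have := sub_ne_zero.2 hj
      positivity
    linarith [key j]

open Finset in
/-- Upper bound theorem for families of compact convex sets. -/
lemma choose_le_card_not_nonempty_of_isCompact {ι : Type*} [Fintype ι] [DecidableEq ι] {d m : ℕ}
    (hd : 1 ≤ d) (hdm : d ≤ m) (hm : m ≤ Fintype.card ι) {F : ι → Set (Fin d → ℝ)}
    (hconv : ∀ i, Convex ℝ (F i)) (hcomp : ∀ i, IsCompact (F i))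
    (hmax : ∀ I : Finset ι, (⋂ i ∈ I, F i).Nonempty → #I ≤ m)
    (B : Finset (Finset ι)) (hB : ∀ I : Finset ι, #I = d + 1 → ¬ (⋂ i ∈ I, F i).Nonempty → I ∈ B) :
    (Fintype.card ι - m + d).choose (d + 1) ≤ #B := by
  classical
  let f : (Fin d → ℝ) → ℝ := fun y => ∑ i, y i ^ 2
  have hf : StrictConvexOn ℝ Set.univ f := strictConvexOn_sum_sq _
  have hfc : Continuous f := by fun_prop
  have hconvI : ∀ I : Finset ι, Convex ℝ (⋂ i ∈ I, F i) := fun I =>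
    convex_iInter₂ fun i _ => hconv i
  have hexists : ∀ I : Finset ι, ∃ x, I.Nonempty → (⋂ i ∈ I, F i).Nonempty →
      x ∈ (⋂ i ∈ I, F i) ∧ IsMinOn f (⋂ i ∈ I, F i) x := by
    intro I
    by_cases hI : I.Nonempty ∧ (⋂ i ∈ I, F i).Nonempty
    · obtain ⟨⟨i, hi⟩, hne⟩ := hI
      have hcompI : IsCompact (⋂ i ∈ I, F i) :=
        (hcomp i).of_isClosed_subset (isClosed_biInter fun j _ => (hcomp j).isClosed)
          (Set.biInter_subset_of_mem hi)
      obtain ⟨x, hx⟩ := hcompI.exists_isMinOn hne hfc.continuousOn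
      exact ⟨x, fun _ _ => hx⟩
    · exact ⟨0, fun h1 h2 => absurd ⟨h1, h2⟩ hI⟩
  choose x hx using hexists
  refine choose_le_card_of_collapsible hdm hm B (fun I => f (x I)) fun S hS hSB => ?_
  have hSne : (⋂ i ∈ S, F i).Nonempty := by
    by_contra hcon
    exact hSB (hB S hS hcon)
  obtain ⟨hxS, hminS⟩ := hx S (card_pos.1 (by omega)) hSne
  obtain ⟨σ, hσS, hσ, hσmin⟩ :=
    exists_subset_card_eq_finrank_isMinOn hconv hf.convexOn (by simp [hS]) hxS hminS
  rw [Module.finrank_fin_fun] at hσ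
  refine ⟨σ, univ.filter fun i => x S ∈ F i, hσS, hσ, fun i hi => ?_, ?_, fun i hi => ?_⟩
  · simpa using Set.mem_iInter₂.1 hxS i hi
  · exact hmax _ ⟨x S, by simp⟩
  · rw [mem_filter_univ] at hi
    have hxσ : x S ∈ ⋂ i ∈ σ, F i := Set.biInter_subset_biInter_left hσS hxS
    have hiσ : i ∉ σ := fun h => hi (Set.mem_iInter₂.1 hxσ i h)
    refine or_iff_not_imp_left.2 fun hiB => ?_
    have hne : (⋂ j ∈ insert i σ, F j).Nonempty := by
      by_contra hcon
      exact hiB (hB _ (by rw [card_insert_of_notMem hiσ, hσ]) hcon)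
    obtain ⟨hy, -⟩ := hx (insert i σ) (insert_nonempty _ _) hne
    have hyσ : x (insert i σ) ∈ ⋂ j ∈ σ, F j :=
      Set.biInter_subset_biInter_left (subset_insert i σ) hy
    refine lt_of_le_of_ne (hσmin hyσ) fun heq => hi ?_
    have hymin : IsMinOn f (⋂ j ∈ σ, F j) (x (insert i σ)) := fun z hz => by
      simpa [heq] using hσmin hz
    rw [(hf.subset (Set.subset_univ _) (hconvI σ)).eq_of_isMinOn hσmin hymin hxσ hyσ]
    exact Set.mem_iInter₂.1 hy i (mem_insert_self i σ)

/-- A finite family of convex sets contains a family of compact convex sets with the same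
intersection pattern. -/
lemma exists_isCompact_convex_subset {ι E : Type*} [Finite ι] [AddCommGroup E] [Module ℝ E]
    [TopologicalSpace E] [IsTopologicalAddGroup E] [ContinuousSMul ℝ E]
    {F : ι → Set E} (hconv : ∀ i, Convex ℝ (F i)) :
    ∃ K : ι → Set E, (∀ i, Convex ℝ (K i)) ∧ (∀ i, IsCompact (K i)) ∧ (∀ i, K i ⊆ F i) ∧
      ∀ I : Finset ι, (⋂ i ∈ I, F i).Nonempty → (⋂ i ∈ I, K i).Nonempty := by
  have hexists : ∀ I : Finset ι, ∃ x, (⋂ i ∈ I, F i).Nonempty → x ∈ ⋂ i ∈ I, F i := fun I => by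
    by_cases h : (⋂ i ∈ I, F i).Nonempty
    · exact ⟨h.some, fun _ => h.some_mem⟩
    · exact ⟨0, fun h' => absurd h' h⟩
  choose x hx using hexists
  refine ⟨fun i => convexHull ℝ (x '' {I | i ∈ I ∧ (⋂ i ∈ I, F i).Nonempty}),
    fun i => convex_convexHull ℝ _, fun i => ((Set.toFinite _).image x).isCompact_convexHull ℝ,
    fun i => convexHull_min ?_ (hconv i), fun I hI => ⟨x I, Set.mem_iInter₂.2 fun i hi => ?_⟩⟩
  · rintro _ ⟨I, ⟨hi, hI⟩, rfl⟩
    exact Set.mem_iInter₂.1 (hx I hI) i hi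
  · exact subset_convexHull ℝ _ ⟨I, ⟨hi, hI⟩, rfl⟩

open Finset in
/-- Upper bound theorem for families of convex sets. -/
theorem choose_le_card_not_nonempty {ι : Type*} [Fintype ι] [DecidableEq ι] {d m : ℕ}
    (hd : 1 ≤ d) (hdm : d ≤ m) (hm : m ≤ Fintype.card ι) {F : ι → Set (Fin d → ℝ)}
    (hconv : ∀ i, Convex ℝ (F i))
    (hmax : ∀ I : Finset ι, (⋂ i ∈ I, F i).Nonempty → #I ≤ m)
    (B : Finset (Finset ι)) (hB : ∀ I : Finset ι, #I = d + 1 → ¬ (⋂ i ∈ I, F i).Nonempty → I ∈ B) :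
    (Fintype.card ι - m + d).choose (d + 1) ≤ #B := by
  obtain ⟨K, hKconv, hKcomp, hKF, hK⟩ := exists_isCompact_convex_subset hconv
  exact choose_le_card_not_nonempty_of_isCompact hd hdm hm hKconv hKcomp
    (fun I hI => hmax I (hI.mono (Set.iInter₂_mono fun i _ => hKF i))) B
    fun I hIc hI => hB I hIc fun h => hI (hK I h)

lemma one_sub_rpow_mul_le_of_choose_le {d n m : ℕ} (hm : m ≤ n) {α : ℝ}
    (hα1 : α ≤ 1)
    (h : ((n - m + d).choose (d + 1) : ℝ) ≤ (1 - α) * n.choose (d + 1)) :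
    (1 - (1 - α) ^ ((1 : ℝ) / (d + 1))) * n ≤ m := by
  have hfac : (0 : ℝ) < (d + 1).factorial := by exact_mod_cast Nat.factorial_pos _
  have h1 := Nat.pow_le_choose (α := ℝ) (d + 1) (n - m + d)
  have h2 := Nat.choose_le_pow_div (α := ℝ) (d + 1) n
  rw [show n - m + d + 1 - (d + 1) = n - m by omega, Nat.cast_sub hm] at h1
  have h3 : ((n : ℝ) - m) ^ (d + 1) ≤ (1 - α) * (n : ℝ) ^ (d + 1) := by
    have h4 := h1.trans (h.trans (mul_le_mul_of_nonneg_left h2 (sub_nonneg.2 hα1)))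
    rwa [← mul_div_assoc, div_le_div_iff_of_pos_right hfac] at h4
  set t : ℝ := (1 - α) ^ ((1 : ℝ) / (d + 1)) with ht
  have ht0 : 0 ≤ t := Real.rpow_nonneg (sub_nonneg.2 hα1) _
  have htp : t ^ (d + 1) = 1 - α := by
    have := Real.rpow_inv_natCast_pow (sub_nonneg.2 hα1) (Nat.succ_ne_zero d)
    rw [ht, one_div]
    exact_mod_cast this
  rw [← htp, ← mul_pow] at h3
  have h5 := le_of_pow_le_pow_left₀ (Nat.succ_ne_zero d) (by positivity) h3
  linarith


/-- **Fractional Helly theorem** (Katchalski–Liu, with Kalai's optimal bound).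
Let `d ≥ 1`, `n ≥ d + 1`, `α ∈ (0,1]` and let `F₁, …, F_n` be convex subsets of `ℝ^d`.
If at least `α·C(n, d+1)` of the `(d+1)`-element index sets have intersecting members,
then some index set of size at least `(1 − (1−α)^{1/(d+1)})·n` has nonempty intersection. -/
theorem fractional_helly
    (d n : ℕ) (hd : 1 ≤ d) (hn : d + 1 ≤ n)
    (α : ℝ) (hα0 : 0 < α) (hα1 : α ≤ 1)
    (F : Fin n → Set (Fin d → ℝ)) (hconv : ∀ i, Convex ℝ (F i))
    (hmany : α * (n.choose (d + 1) : ℝ) ≤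
      ({I : Finset (Fin n) | I.card = d + 1 ∧ (⋂ i ∈ I, F i).Nonempty}.ncard : ℝ)) :
    ∃ I : Finset (Fin n),
      (1 - (1 - α) ^ ((1 : ℝ) / (d + 1))) * n ≤ (I.card : ℝ) ∧
      (⋂ i ∈ I, F i).Nonempty := by
  classical
  let A : Finset (Finset (Fin n)) := Finset.univ.filter fun I => (⋂ i ∈ I, F i).Nonempty
  obtain ⟨M, hMA, hMmax⟩ := A.exists_max_image Finset.card ⟨∅, by simp [A]⟩
  have hM : (⋂ i ∈ M, F i).Nonempty := (Finset.mem_filter.1 hMA).2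
  refine ⟨M, ?_, hM⟩
  have hmax : ∀ I : Finset (Fin n), (⋂ i ∈ I, F i).Nonempty → I.card ≤ M.card := fun I hI =>
    hMmax I (Finset.mem_filter.2 ⟨Finset.mem_univ _, hI⟩)
  let P := Finset.powersetCard (d + 1) (Finset.univ : Finset (Fin n))
  have hA : {I : Finset (Fin n) | I.card = d + 1 ∧ (⋂ i ∈ I, F i).Nonempty} =
      (P.filter fun I => (⋂ i ∈ I, F i).Nonempty : Finset (Finset (Fin n))) := by
    ext I
    simp [P]
  rw [hA, Set.ncard_coe_finset] at hmany
  have hadd := Finset.card_filter_add_card_filter_not (s := P)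
    (fun I => (⋂ i ∈ I, F i).Nonempty)
  rw [show P.card = n.choose (d + 1) by simp [P]] at hadd
  have hdM : d ≤ M.card := by
    have hpos : (0 : ℝ) < (P.filter fun I => (⋂ i ∈ I, F i).Nonempty).card :=
      (mul_pos hα0 (by exact_mod_cast Nat.choose_pos hn)).trans_le hmany
    obtain ⟨I, hI⟩ := Finset.card_pos.1 (by exact_mod_cast hpos)
    obtain ⟨hIP, hI⟩ := Finset.mem_filter.1 hI
    have := hmax I hI
    have := (Finset.mem_powersetCard.1 hIP).2
    omega
  have hMn : M.card ≤ n := by simpa using Finset.card_le_univ M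
  have hB := choose_le_card_not_nonempty hd hdM (by simpa using hMn) hconv hmax
    (P.filter fun I => ¬ (⋂ i ∈ I, F i).Nonempty)
    fun I hIc hI => Finset.mem_filter.2 ⟨by simpa [P] using hIc, hI⟩
  rw [Fintype.card_fin] at hB
  refine one_sub_rpow_mul_le_of_choose_le hMn hα1 ?_
  have hB' : ((n - M.card + d).choose (d + 1) : ℝ) ≤
      (P.filter fun I => ¬ (⋂ i ∈ I, F i).Nonempty).card := by exact_mod_cast hB
  have hadd' : ((P.filter fun I => (⋂ i ∈ I, F i).Nonempty).card : ℝ) +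
      (P.filter fun I => ¬ (⋂ i ∈ I, F i).Nonempty).card = n.choose (d + 1) := by
    exact_mod_cast hadd
  linarith
end

section
/- Let d ≥ 0 be an integer and let Δ_{d+1} = {x ∈ ℝ^{d+2} : x_i ≥ 0 for all i, ∑_{i=1}^{d+2} x_i = 1} be the standard (d+1)-dimensional simplex. For every continuous map f : Δ_{d+1} → ℝ^d there exist disjoint subsets S, T ⊆ {1,…,d+2} and points x, y ∈ Δ_{d+1} with supp(x) ⊆ S, supp(y) ⊆ T and f(x) = f(y). -/
/-- A finite field extension of `ℝ` of odd degree is trivial. -/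
theorem finrank_real_eq_one_of_odd (F : Type*) [Field F] [Algebra ℝ F] [FiniteDimensional ℝ F]
    (h : Odd (Module.finrank ℝ F)) : Module.finrank ℝ F = 1 := by
  let φ : F →ₐ[ℝ] ℂ := IsAlgClosed.lift
  let : Algebra F ℂ := φ.toRingHom.toAlgebra
  have : IsScalarTower ℝ F ℂ := IsScalarTower.of_algebraMap_eq fun x => (φ.commutes x).symm
  have h2 : Module.finrank ℝ F ∣ 2 :=
    ⟨_, by rw [Module.finrank_mul_finrank ℝ F ℂ, Complex.finrank_real_complex]⟩
  rcases (Nat.dvd_prime Nat.prime_two).1 h2 with h1 | h1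
  · exact h1
  · rw [h1] at h
    exact absurd h (by decide)

/-- If a commutative real algebra acts on a real vector space of odd dimension, then it has a real
character vanishing on the annihilator. -/
theorem exists_algHom_of_odd_finrank {R : Type*} [CommRing R] [Algebra ℝ R] (M : Type*)
    [AddCommGroup M] [Module ℝ M] [Module R M] [IsScalarTower ℝ R M] [FiniteDimensional ℝ M]
    (hM : Odd (Module.finrank ℝ M)) :
    ∃ φ : R →ₐ[ℝ] ℝ, ∀ r ∈ Module.annihilator R M, φ r = 0 := by
  induction hk : Module.finrank ℝ M using Nat.strong_induction_on generalizing M with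
  | _ k ih =>
    have : Nontrivial M := Module.nontrivial_of_finrank_pos (R := ℝ) hM.pos
    by_cases hs : IsSimpleModule R M
    · obtain ⟨I, hI, ⟨e⟩⟩ := isSimpleModule_iff_quot_maximal.1 hs
      let : Field (R ⧸ I) := Ideal.Quotient.field I
      let e' : M ≃ₗ[ℝ] R ⧸ I := e.restrictScalars ℝ
      have : FiniteDimensional ℝ (R ⧸ I) := e'.finiteDimensional
      have h1 := finrank_real_eq_one_of_odd (R ⧸ I) (e'.finrank_eq ▸ hM)
      have hb : Function.Bijective (algebraMap ℝ (R ⧸ I)) :=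
        (Algebra.finrank_eq_one_iff_bijective_algebraMap).1 h1
      let E : ℝ ≃ₐ[ℝ] R ⧸ I := AlgEquiv.ofBijective (Algebra.ofId ℝ (R ⧸ I)) hb
      refine ⟨E.symm.toAlgHom.comp (Ideal.Quotient.mkₐ ℝ I), fun r hr => ?_⟩
      rw [e.annihilator_eq, Ideal.annihilator_quotient] at hr
      have : Ideal.Quotient.mkₐ ℝ I r = 0 := Ideal.Quotient.eq_zero_iff_mem.2 hr
      rw [AlgHom.comp_apply, this, map_zero]
    · obtain ⟨N, hN⟩ : ∃ N : Submodule R M, ¬ (N = ⊥ ∨ N = ⊤) := by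
        by_contra! h
        exact hs ((isSimpleModule_iff R M).2 ⟨h⟩)
      push Not at hN
      let N' := N.restrictScalars ℝ
      have e : (M ⧸ N') ≃ₗ[ℝ] M ⧸ N := Submodule.Quotient.restrictScalarsEquiv ℝ N
      have hsum : Module.finrank ℝ (M ⧸ N) + Module.finrank ℝ N = Module.finrank ℝ M := by
        rw [← e.finrank_eq]
        exact N'.finrank_quotient_add_finrank
      have : FiniteDimensional ℝ N := inferInstanceAs (FiniteDimensional ℝ N')
      have : FiniteDimensional ℝ (M ⧸ N) := e.finiteDimensional
      have : Nontrivial N := (Submodule.nontrivial_iff_ne_bot).2 hN.1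
      have : Nontrivial (M ⧸ N) := Submodule.Quotient.nontrivial_iff.2 hN.2
      have p1 : 0 < Module.finrank ℝ N := Module.finrank_pos
      have p2 : 0 < Module.finrank ℝ (M ⧸ N) := Module.finrank_pos
      rcases Nat.even_or_odd (Module.finrank ℝ N) with h | h
      · have h' : Odd (Module.finrank ℝ (M ⧸ N)) := by
          rw [← hsum] at hM
          exact (Nat.odd_add.1 hM).2 h
        obtain ⟨φ, hφ⟩ := ih _ (by lia) (M ⧸ N) h' rfl
        exact ⟨φ, fun r hr => hφ r
          (LinearMap.annihilator_le_of_surjective N.mkQ N.mkQ_surjective hr)⟩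
      · obtain ⟨φ, hφ⟩ := ih _ (by lia) N h rfl
        exact ⟨φ, fun r hr => hφ r
          (LinearMap.annihilator_le_of_injective N.subtype N.injective_subtype hr)⟩

namespace MvPolynomial

variable {σ : Type*}

/-- A linear endomorphism sending each monomial to a polynomial of at most the same degree does not
raise the total degree. -/
theorem totalDegree_constr_le {F : (σ →₀ ℕ) → MvPolynomial σ ℝ}
    (hF : ∀ a, (F a).totalDegree ≤ a.degree) (v : MvPolynomial σ ℝ) :
    ((basisMonomials σ ℝ).constr ℝ F v).totalDegree ≤ v.totalDegree := by
  rw [Module.Basis.constr_apply]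
  refine totalDegree_finsetSum_le fun a ha => ?_
  exact (totalDegree_smul_le _ _).trans ((hF a).trans (le_totalDegree ha))

/-- Rewriting monomials divisible by some `X i ^ m` by means of `q i`. -/
noncomputable def rewriteMap (m : ℕ) (q : σ → MvPolynomial σ ℝ) :
    MvPolynomial σ ℝ →ₗ[ℝ] MvPolynomial σ ℝ :=
  open Classical in
  (basisMonomials σ ℝ).constr ℝ fun a =>
    if h : ∃ i, m ≤ a i then monomial (a - Finsupp.single h.choose m) 1 * q h.choose else 0

theorem rewriteMap_monomial_of_exists {m : ℕ} {q : σ → MvPolynomial σ ℝ} {a : σ →₀ ℕ}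
    (h : ∃ i, m ≤ a i) : rewriteMap m q (monomial a 1) =
      monomial (a - Finsupp.single h.choose m) 1 * q h.choose :=
  ((basisMonomials σ ℝ).constr_basis ℝ _ a).trans (dif_pos h)

theorem rewriteMap_monomial_of_not_exists {m : ℕ} {q : σ → MvPolynomial σ ℝ} {a : σ →₀ ℕ}
    (h : ¬ ∃ i, m ≤ a i) : rewriteMap m q (monomial a 1) = 0 :=
  ((basisMonomials σ ℝ).constr_basis ℝ _ a).trans (dif_neg h)

theorem degree_tsub_single {a : σ →₀ ℕ} {i : σ} {m : ℕ} (h : m ≤ a i) :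
    (a - Finsupp.single i m).degree + m = a.degree := by
  conv_rhs => rw [← tsub_add_cancel_of_le (Finsupp.single_le_iff.2 h)]
  rw [map_add, Finsupp.degree_single]

theorem totalDegree_monomial_mul_le {a : σ →₀ ℕ} {i : σ} {m : ℕ} {q : MvPolynomial σ ℝ}
    (hq : q.totalDegree ≤ m) (h : m ≤ a i) :
    (monomial (a - Finsupp.single i m) 1 * q).totalDegree ≤ a.degree := by
  rw [← degree_tsub_single h]
  exact (totalDegree_mul _ _).trans (add_le_add (totalDegree_monomial_le _ _) hq)

theorem totalDegree_rewriteMap_le {m : ℕ} {q : σ → MvPolynomial σ ℝ}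
    (hq : ∀ i, (q i).totalDegree ≤ m) (v : MvPolynomial σ ℝ) :
    (rewriteMap m q v).totalDegree ≤ v.totalDegree := by
  refine totalDegree_constr_le (fun a => ?_) v
  split_ifs with h
  · exact totalDegree_monomial_mul_le (hq _) h.choose_spec
  · simp

variable [Fintype σ]

/-- A linear endomorphism that does not raise the total degree has at most countably many
eigenvalues, so it becomes injective after adding an arbitrarily small multiple of the identity. -/
theorem exists_injective_smul_add {B : MvPolynomial σ ℝ →ₗ[ℝ] MvPolynomial σ ℝ}
    (hB : ∀ v, (B v).totalDegree ≤ v.totalDegree) {δ : ℝ} (hδ : 0 < δ) :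
    ∃ ε : ℝ, 0 < ε ∧ ε < δ ∧ Function.Injective (ε • (LinearMap.id : MvPolynomial σ ℝ →ₗ[ℝ] MvPolynomial σ ℝ) + B) := by
  have hres (D : ℕ) : ∀ v ∈ restrictTotalDegree σ ℝ D, B v ∈ restrictTotalDegree σ ℝ D := by
    intro v hv
    rw [mem_restrictTotalDegree] at *
    exact (hB v).trans hv
  let S : Set ℝ := ⋃ D, {μ | Module.End.HasEigenvalue (B.restrict (hres D)) μ}
  have hS : S.Countable := Set.countable_iUnion fun D =>
    (Module.End.finite_hasEigenvalue _).countable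
  obtain ⟨μ, hμS, hμ⟩ := (hS.dense_compl ℝ).exists_mem_open (isOpen_Ioo (a := -δ) (b := 0))
    ⟨-δ / 2, by constructor <;> linarith⟩
  refine ⟨-μ, by linarith [hμ.2], by linarith [hμ.1], ?_⟩
  rw [injective_iff_map_eq_zero]
  intro v hv
  by_contra hv0
  refine hμS (Set.mem_iUnion.2 ⟨v.totalDegree, ?_⟩)
  refine Module.End.hasEigenvalue_of_hasEigenvector
    (x := ⟨v, (mem_restrictTotalDegree _ _ _).2 le_rfl⟩) ⟨?_, fun h => hv0 (congrArg Subtype.val h)⟩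
  rw [Module.End.mem_eigenspace_iff]
  apply Subtype.ext
  have : -μ • v + B v = 0 := hv
  rw [neg_smul, neg_add_eq_zero] at this
  exact this.symm

theorem exists_totalDegree_le_of_injective {L : MvPolynomial σ ℝ →ₗ[ℝ] MvPolynomial σ ℝ}
    (hL : ∀ v, (L v).totalDegree ≤ v.totalDegree) (hinj : Function.Injective L)
    (v : MvPolynomial σ ℝ) : ∃ w, w.totalDegree ≤ v.totalDegree ∧ L w = v := by
  have hres : ∀ w ∈ restrictTotalDegree σ ℝ v.totalDegree,
      L w ∈ restrictTotalDegree σ ℝ v.totalDegree := by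
    intro w hw
    rw [mem_restrictTotalDegree] at *
    exact (hL w).trans hw
  have hi : Function.Injective (L.restrict hres) := fun a b hab =>
    Subtype.ext (hinj (congrArg Subtype.val hab))
  obtain ⟨w, hw⟩ := LinearMap.injective_iff_surjective.1 hi
    ⟨v, (mem_restrictTotalDegree _ _ _).2 le_rfl⟩
  exact ⟨w, (mem_restrictTotalDegree _ _ _).1 w.2, congrArg Subtype.val hw⟩

theorem injective_of_exists_totalDegree_le {L : MvPolynomial σ ℝ →ₗ[ℝ] MvPolynomial σ ℝ}
    (hL : ∀ v, (L v).totalDegree ≤ v.totalDegree)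
    (hsurj : ∀ v, ∃ w, w.totalDegree ≤ v.totalDegree ∧ L w = v) : Function.Injective L := by
  rw [injective_iff_map_eq_zero]
  intro v hv
  have hres : ∀ w ∈ restrictTotalDegree σ ℝ v.totalDegree,
      L w ∈ restrictTotalDegree σ ℝ v.totalDegree := by
    intro w hw
    rw [mem_restrictTotalDegree] at *
    exact (hL w).trans hw
  have hs : Function.Surjective (L.restrict hres) := by
    rintro ⟨u, hu⟩
    obtain ⟨w, hw, hwu⟩ := hsurj u
    rw [mem_restrictTotalDegree] at hu
    exact ⟨⟨w, (mem_restrictTotalDegree _ _ _).2 (hw.trans hu)⟩, Subtype.ext hwu⟩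
  have := LinearMap.injective_iff_surjective.2 hs
    (a₁ := ⟨v, (mem_restrictTotalDegree _ _ _).2 le_rfl⟩) (a₂ := 0) (Subtype.ext (by simpa using hv))
  exact congrArg Subtype.val this

/-- The linear map sending `X ^ (a + m b)`, with all exponents `a i < m`, to `X ^ a * p ^ b`. -/
noncomputable def digitMap (m : ℕ) (p : σ → MvPolynomial σ ℝ) :
    MvPolynomial σ ℝ →ₗ[ℝ] MvPolynomial σ ℝ :=
  (basisMonomials σ ℝ).constr ℝ fun c => ∏ i, (X i ^ (c i % m) * p i ^ (c i / m))

theorem digitMap_monomial (m : ℕ) (p : σ → MvPolynomial σ ℝ) (c : σ →₀ ℕ) :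
    digitMap m p (monomial c 1) = ∏ i, (X i ^ (c i % m) * p i ^ (c i / m)) := by
  exact (basisMonomials σ ℝ).constr_basis ℝ _ c

theorem digitMap_monomial_of_lt {m : ℕ} (p : σ → MvPolynomial σ ℝ) {c : σ →₀ ℕ}
    (hc : ∀ i, c i < m) : digitMap m p (monomial c 1) = monomial c 1 := by
  rw [digitMap_monomial, monomial_eq, Finsupp.prod_fintype _ _ (by simp)]
  simp [Nat.mod_eq_of_lt (hc _), Nat.div_eq_of_lt (hc _)]

theorem totalDegree_digitMap_le {m : ℕ} {p : σ → MvPolynomial σ ℝ}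
    (hp : ∀ i, (p i).totalDegree ≤ m) (v : MvPolynomial σ ℝ) :
    (digitMap m p v).totalDegree ≤ v.totalDegree := by
  refine totalDegree_constr_le (fun c => ?_) v
  refine (totalDegree_finsetProd _ _).trans ?_
  rw [Finsupp.degree_eq_sum]
  refine Finset.sum_le_sum fun i _ => ?_
  calc _ ≤ c i % m + c i / m * m := by
        refine (totalDegree_mul _ _).trans (add_le_add (by simp [totalDegree_X_pow]) ?_)
        exact (totalDegree_pow _ _).trans (Nat.mul_le_mul_left _ (hp i))
    _ = c i := Nat.mod_add_div' _ _

theorem digitMap_X_pow_mul {m : ℕ} (hm : 0 < m) (p : σ → MvPolynomial σ ℝ) (i : σ)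
    (v : MvPolynomial σ ℝ) : digitMap m p (X i ^ m * v) = p i * digitMap m p v := by
  classical
  suffices h : digitMap m p ∘ₗ LinearMap.mulLeft ℝ (X i ^ m) =
      LinearMap.mulLeft ℝ (p i) ∘ₗ digitMap m p from LinearMap.congr_fun h v
  refine (basisMonomials σ ℝ).ext fun c => ?_
  have hX : (X i ^ m * monomial c 1 : MvPolynomial σ ℝ) = monomial (Finsupp.single i m + c) 1 := by
    rw [X_pow_eq_monomial, monomial_mul, one_mul]
  simp only [coe_basisMonomials, LinearMap.comp_apply, LinearMap.mulLeft_apply, hX,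
    digitMap_monomial]
  rw [← Finset.mul_prod_erase _ _ (Finset.mem_univ i),
    ← Finset.mul_prod_erase _ (fun j => X j ^ (c j % m) * p j ^ (c j / m)) (Finset.mem_univ i)]
  have h1 : ∏ x ∈ Finset.univ.erase i, (X x ^ ((Finsupp.single i m + c) x % m) *
        p x ^ ((Finsupp.single i m + c) x / m)) =
      ∏ x ∈ Finset.univ.erase i, X x ^ (c x % m) * p x ^ (c x / m) := by
    refine Finset.prod_congr rfl fun x hx => ?_
    simp [Finsupp.single_eq_of_ne (Finset.ne_of_mem_erase hx)]
  rw [h1]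
  simp [Nat.add_div_left _ hm, pow_succ]
  ring

theorem exists_digitMap_eq {m : ℕ} (hm : 0 < m) {q : σ → MvPolynomial σ ℝ} {ε : ℝ}
    (hq : ∀ i, (q i).totalDegree ≤ m)
    (hinj : Function.Injective (ε • (LinearMap.id : MvPolynomial σ ℝ →ₗ[ℝ] MvPolynomial σ ℝ) + rewriteMap m q)) (v : MvPolynomial σ ℝ) :
    ∃ w, w.totalDegree ≤ v.totalDegree ∧
      digitMap m (fun i => C ε * X i ^ m + q i) w = v := by
  set p : σ → MvPolynomial σ ℝ := fun i => C ε * X i ^ m + q i with hp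
  induction hD : v.totalDegree using Nat.strong_induction_on generalizing v with
  | _ D ih =>
  subst hD
  obtain ⟨u, hu, rfl⟩ := exists_totalDegree_le_of_injective (fun w => by
    refine (totalDegree_add _ _).trans (max_le ?_ (totalDegree_rewriteMap_le hq w))
    exact totalDegree_smul_le _ _) hinj v
  set L := ε • (LinearMap.id : MvPolynomial σ ℝ →ₗ[ℝ] MvPolynomial σ ℝ) + rewriteMap m q with hL
  suffices h : L u ∈ (restrictTotalDegree σ ℝ (L u).totalDegree).map (digitMap m p) by
    obtain ⟨w, hw, hwu⟩ := h
    exact ⟨w, (mem_restrictTotalDegree _ _ _).1 hw, hwu⟩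
  generalize (L u).totalDegree = D at *
  rw [← (basisMonomials σ ℝ).linearCombination_repr u, Finsupp.linearCombination_apply,
    Finsupp.sum, map_sum]
  refine Submodule.sum_mem _ fun a ha => ?_
  rw [map_smul]
  refine Submodule.smul_mem _ _ ?_
  have had : a.degree ≤ D := (le_totalDegree ha).trans hu
  rw [coe_basisMonomials]
  by_cases h : ∃ i, m ≤ a i
  · have hLa : L (monomial a 1) =
        p h.choose * monomial (a - Finsupp.single h.choose m) 1 := by
      have h1 : (X h.choose ^ m * monomial (a - Finsupp.single h.choose m) 1 :
          MvPolynomial σ ℝ) = monomial a 1 := by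
        rw [X_pow_eq_monomial, monomial_mul, one_mul,
          add_tsub_cancel_of_le (Finsupp.single_le_iff.2 h.choose_spec)]
      rw [hL, LinearMap.add_apply, rewriteMap_monomial_of_exists h, hp]
      simp only [LinearMap.smul_apply, LinearMap.id_apply, add_mul, mul_assoc, h1]
      rw [smul_eq_C_mul, mul_comm (q _)]
    have hdeg := degree_tsub_single h.choose_spec
    obtain ⟨w, hw, hw'⟩ := ih (monomial (a - Finsupp.single h.choose m) 1).totalDegree
      ((totalDegree_monomial_le _ _).trans_lt (by change Finsupp.degree _ < _; lia)) _ rfl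
    refine ⟨X h.choose ^ m * w, ?_, ?_⟩
    · refine (mem_restrictTotalDegree _ _ _).2 ((totalDegree_mul _ _).trans ?_)
      have := hw.trans (totalDegree_monomial_le _ _)
      change _ ≤ Finsupp.degree _ at this
      rw [totalDegree_X_pow]
      lia
    · rw [digitMap_X_pow_mul hm, hw', hLa]
  · have hLa : L (monomial a 1) = ε • monomial a 1 := by
      rw [hL, LinearMap.add_apply, rewriteMap_monomial_of_not_exists h, add_zero]
      rfl
    rw [hLa]
    refine Submodule.smul_mem _ _ ⟨monomial a 1, ?_, digitMap_monomial_of_lt p ?_⟩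
    · exact (mem_restrictTotalDegree _ _ _).2 ((totalDegree_monomial_le _ _).trans had)
    · simpa using h

/-- If `digitMap m p` is bijective, then the quotient by the polynomials `p i` has dimension
`m ^ card σ`, as for `p i = X i ^ m`. -/
theorem finrank_quotient_span_range {m : ℕ} (hm : 0 < m) {p : σ → MvPolynomial σ ℝ}
    (hT : Function.Bijective (digitMap m p)) :
    Module.finrank ℝ (MvPolynomial σ ℝ ⧸ Ideal.span (Set.range p)) = m ^ Fintype.card σ := by
  classical
  set I := Ideal.span (Set.range p)
  let T : MvPolynomial σ ℝ ≃ₗ[ℝ] MvPolynomial σ ℝ := LinearEquiv.ofBijective _ hT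
  let e : (σ → Fin m) → (σ →₀ ℕ) := fun b => Finsupp.equivFunOnFinite.symm fun i => b i
  have he : Function.Injective e := fun b b' h => by
    ext i
    exact DFunLike.congr_fun h i
  let ψ : MvPolynomial σ ℝ →ₗ[ℝ] ((σ → Fin m) → ℝ) := LinearMap.pi fun b => lcoeff ℝ (e b)
  have hψ : Function.Surjective ψ := by
    intro h
    refine ⟨∑ b, monomial (e b) (h b), ?_⟩
    ext b
    simp [ψ, coeff_monomial, he.eq_iff]
  let φ : MvPolynomial σ ℝ →ₗ[ℝ] ((σ → Fin m) → ℝ) := ψ ∘ₗ T.symm.toLinearMap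
  have hφ : Function.Surjective φ := hψ.comp T.symm.surjective
  have hker : I.restrictScalars ℝ = LinearMap.ker φ := by
    ext v
    obtain ⟨s, rfl⟩ := T.surjective v
    have hφs : φ (T s) = ψ s := by simp [φ]
    rw [LinearMap.mem_ker, hφs, Submodule.restrictScalars_mem]
    constructor
    · intro hv
      obtain ⟨r, hr⟩ := Ideal.mem_span_range_iff_exists_fun.1 hv
      rw [← hφs, ← hr, map_sum]
      refine Finset.sum_eq_zero fun i _ => ?_
      obtain ⟨t, ht⟩ := T.surjective (r i)
      have h1 : r i * p i = T (X i ^ m * t) := by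
        rw [← ht, mul_comm]
        exact (digitMap_X_pow_mul hm p i t).symm
      rw [h1, LinearMap.comp_apply, LinearEquiv.coe_coe, T.symm_apply_apply]
      ext b
      have h2 : ¬ Finsupp.single i m ≤ e b := by
        rw [Finsupp.single_le_iff]
        exact not_le_of_gt (b i).2
      simp [ψ, X_pow_eq_monomial, coeff_monomial_mul', h2]
    · intro hs
      rw [← (basisMonomials σ ℝ).linearCombination_repr s, Finsupp.linearCombination_apply,
        Finsupp.sum, map_sum]
      refine Submodule.sum_mem _ fun a ha => ?_
      rw [map_smul]
      refine Submodule.smul_of_tower_mem _ _ ?_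
      obtain ⟨i, hi⟩ : ∃ i, m ≤ a i := by
        by_contra! h
        refine Finsupp.mem_support_iff.1 ha ?_
        have ha' : e (fun i => ⟨a i, h i⟩) = a := by
          ext i
          rfl
        have := congrFun hs fun i => ⟨a i, h i⟩
        change coeff (e _) s = 0 at this
        rwa [ha'] at this
      have h1 : T (monomial a 1) = p i * T (monomial (a - Finsupp.single i m) 1) := by
        refine Eq.trans ?_ (digitMap_X_pow_mul hm p i _)
        rw [X_pow_eq_monomial, monomial_mul, one_mul,
          add_tsub_cancel_of_le (Finsupp.single_le_iff.2 hi)]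
        rfl
      rw [coe_basisMonomials, h1]
      exact I.mul_mem_right _ (Ideal.subset_span ⟨i, rfl⟩)
  rw [← (Submodule.Quotient.restrictScalarsEquiv ℝ I).finrank_eq, hker,
    (φ.quotKerEquivOfSurjective hφ).finrank_eq]
  simp

/-- A real polynomial system of top degree `m` odd, in as many equations as variables, acquires a
real solution after adding arbitrarily small multiples of `X i ^ m`. -/
theorem exists_eval_add_eq_zero {m : ℕ} (hm : Odd m) {q : σ → MvPolynomial σ ℝ}
    (hq : ∀ i, (q i).totalDegree ≤ m) {δ : ℝ} (hδ : 0 < δ) :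
    ∃ ε : ℝ, 0 < ε ∧ ε < δ ∧ ∃ x : σ → ℝ, ∀ i, ε * x i ^ m + eval x (q i) = 0 := by
  obtain ⟨ε, h0, h1, hinj⟩ := exists_injective_smul_add (totalDegree_rewriteMap_le hq) hδ
  refine ⟨ε, h0, h1, ?_⟩
  set p : σ → MvPolynomial σ ℝ := fun i => C ε * X i ^ m + q i
  have hp (i) : (p i).totalDegree ≤ m := by
    refine (totalDegree_add _ _).trans (max_le ?_ (hq i))
    refine (totalDegree_mul _ _).trans ?_
    rw [totalDegree_C, totalDegree_X_pow, zero_add]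
  have hsurj := exists_digitMap_eq hm.pos hq hinj
  have hT : Function.Bijective (digitMap m p) :=
    ⟨injective_of_exists_totalDegree_le (totalDegree_digitMap_le hp) hsurj,
      fun v => (hsurj v).imp fun _ => And.right⟩
  have hfr := finrank_quotient_span_range hm.pos hT
  have hodd : Odd (Module.finrank ℝ (MvPolynomial σ ℝ ⧸ Ideal.span (Set.range p))) :=
    hfr ▸ hm.pow
  have := Module.finite_of_finrank_pos hodd.pos
  obtain ⟨φ, hφ⟩ := exists_algHom_of_odd_finrank (R := MvPolynomial σ ℝ) _ hodd
  refine ⟨fun i => φ (X i), fun i => ?_⟩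
  have h := hφ (p i) (by
    rw [Ideal.annihilator_quotient]
    exact Ideal.subset_span ⟨i, rfl⟩)
  rw [aeval_unique φ] at h
  simpa [p, aeval_eq_eval, Function.comp_def] using h

theorem IsHomogeneous.eval_smul_vec {τ : Type*} [Fintype τ] {P : MvPolynomial τ ℝ} {k : ℕ}
    (hP : P.IsHomogeneous k) (r : ℝ) (u : τ → ℝ) : eval (r • u) P = r ^ k * eval u P := by
  rw [eval_eq', eval_eq', Finset.mul_sum]
  refine Finset.sum_congr rfl fun d hd => ?_
  have hk : ∑ i, d i = k := by
    rw [← Finsupp.degree_eq_sum]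
    by_contra h
    exact mem_support_iff.1 hd (hP.coeff_eq_zero h)
  simp only [Pi.smul_apply, smul_eq_mul, mul_pow, Finset.prod_mul_distrib,
    Finset.prod_pow_eq_pow_sum, hk]
  ring

theorem totalDegree_aeval_le {τ υ : Type*} [Fintype τ] {F : τ → MvPolynomial υ ℝ}
    (hF : ∀ i, (F i).totalDegree ≤ 1) (P : MvPolynomial τ ℝ) :
    (aeval F P).totalDegree ≤ P.totalDegree := by
  rw [aeval_eq_eval₂Hom, coe_eval₂Hom, eval₂_eq']
  refine totalDegree_finsetSum_le fun d hd => ?_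
  refine (totalDegree_mul _ _).trans ?_
  rw [algebraMap_eq, totalDegree_C, zero_add]
  refine (totalDegree_finsetProd _ _).trans (le_trans ?_ (le_totalDegree hd))
  rw [Finsupp.sum_fintype _ _ (by simp)]
  refine Finset.sum_le_sum fun i _ => (totalDegree_pow _ _).trans ?_
  simpa using Nat.mul_le_mul_left (d i) (hF i)

theorem sum_odd_homogeneousComponent {τ : Type*} [Fintype τ] {G : MvPolynomial τ ℝ} {m : ℕ}
    (hG : G.totalDegree ≤ m) (u : τ → ℝ) :
    ∑ k ∈ (Finset.range (m + 1)).filter Odd, eval u (homogeneousComponent k G) =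
      (eval u G - eval (-u) G) / 2 := by
  have hsum : G = ∑ k ∈ Finset.range (m + 1), homogeneousComponent k G := by
    conv_lhs => rw [← sum_homogeneousComponent G]
    refine Finset.sum_subset (Finset.range_mono (by lia)) fun k _ hk => ?_
    exact homogeneousComponent_eq_zero _ _ (by simpa using hk)
  have heval (w : τ → ℝ) :
      eval w G = ∑ k ∈ Finset.range (m + 1), eval w (homogeneousComponent k G) := by
    conv_lhs => rw [hsum, map_sum]
  rw [heval u, heval (-u), ← Finset.sum_sub_distrib, Finset.sum_div, Finset.sum_filter]
  refine Finset.sum_congr rfl fun k _ => ?_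
  rw [← neg_one_smul ℝ u, (homogeneousComponent_isHomogeneous k G).eval_smul_vec]
  rcases Nat.even_or_odd k with h | h
  · simp [h.neg_one_pow, h]
  · simp [h.neg_one_pow, h]

/-- The odd part of a polynomial on the sphere, pulled back to an affine chart by central
projection, becomes a polynomial after multiplication by a power of the norm. -/
theorem exists_dehomogenize_odd_part {n m : ℕ} (hm : Odd m) {G : MvPolynomial (Fin (n + 1)) ℝ}
    (hG : G.totalDegree ≤ m) :
    ∃ q : MvPolynomial (Fin n) ℝ, q.totalDegree ≤ m ∧
      ∀ (x : Fin n → ℝ) (ρ : ℝ) (u : Fin (n + 1) → ℝ), ρ ^ 2 = 1 + ∑ i, x i ^ 2 →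
        Fin.cons 1 x = ρ • u →
        eval x q = ρ ^ m * ((eval u G - eval (-u) G) / 2) := by
  let F : Fin (n + 1) → MvPolynomial (Fin n) ℝ := Fin.cons 1 X
  have hF (i) : (F i).totalDegree ≤ 1 := by
    cases i using Fin.cases <;> simp [F]
  let s : MvPolynomial (Fin n) ℝ := 1 + ∑ i, X i ^ 2
  have hs : s.totalDegree ≤ 2 := by
    refine (totalDegree_add _ _).trans (max_le (by simp) ?_)
    exact totalDegree_finsetSum_le fun i _ => by simp
  refine ⟨∑ k ∈ (Finset.range (m + 1)).filter Odd,
    aeval F (homogeneousComponent k G) * s ^ ((m - k) / 2), ?_, ?_⟩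
  · refine totalDegree_finsetSum_le fun k hk => ?_
    have hk' : k ≤ m := by
      have := (Finset.mem_filter.1 hk).1
      simp at this
      lia
    have h1 := (totalDegree_aeval_le hF (homogeneousComponent k G)).trans
      (homogeneousComponent_isHomogeneous k G).totalDegree_le
    have h2 := (totalDegree_pow s ((m - k) / 2)).trans (Nat.mul_le_mul_left _ hs)
    exact (totalDegree_mul _ _).trans (by lia)
  · intro x ρ u hρ hu
    rw [← sum_odd_homogeneousComponent hG, Finset.mul_sum, map_sum]
    refine Finset.sum_congr rfl fun k hk => ?_
    obtain ⟨hkm, hk⟩ := Finset.mem_filter.1 hk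
    have hs' : eval x s = ρ ^ 2 := by simp [s, hρ]
    have hF' : (fun i => eval x (F i)) = Fin.cons 1 x := by
      ext i
      cases i using Fin.cases <;> simp [F]
    have he : eval x (aeval F (homogeneousComponent k G)) =
        ρ ^ k * eval u (homogeneousComponent k G) := by
      rw [← (homogeneousComponent_isHomogeneous k G).eval_smul_vec, ← hu, ← hF', ← coe_aeval_eq_eval,
        ← coe_aeval_eq_eval, RingHom.coe_coe, RingHom.coe_coe, comp_aeval_apply]
    obtain ⟨j, hj⟩ : Even (m - k) := Nat.Odd.sub_odd hm hk
    have hkm' : k ≤ m := by simpa [Nat.lt_succ_iff] using hkm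
    have hpow : ρ ^ m = ρ ^ k * (ρ ^ 2) ^ ((m - k) / 2) := by
      rw [← pow_mul, ← pow_add]
      congr 1
      lia
    rw [map_mul, map_pow, hs', he, hpow]
    ring

/-- Polynomials are uniformly dense in the continuous functions on a compact set. -/
theorem exists_abs_eval_sub_lt {τ : Type*} {K : Set (τ → ℝ)} (hK : IsCompact K)
    {g : (τ → ℝ) → ℝ} (hg : ContinuousOn g K) {δ : ℝ} (hδ : 0 < δ) :
    ∃ G : MvPolynomial τ ℝ, ∀ u ∈ K, |eval u G - g u| < δ := by
  have := isCompact_iff_compactSpace.1 hK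
  let coord : τ → C(K, ℝ) := fun i => ⟨fun u => u.1 i, (continuous_apply i).comp continuous_subtype_val⟩
  let A : Subalgebra ℝ C(K, ℝ) := (aeval coord).range
  have hev (G : MvPolynomial τ ℝ) (u : K) : aeval coord G u = eval u.1 G := by
    have := comp_aeval_apply (ContinuousMap.evalAlgHom ℝ ℝ u) (f := coord) G
    exact this
  have hA : A.SeparatesPoints := by
    intro u v huv
    obtain ⟨i, hi⟩ := Function.ne_iff.1 (Subtype.coe_injective.ne huv)
    exact ⟨_, ⟨coord i, ⟨X i, by simp⟩, rfl⟩, hi⟩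
  obtain ⟨⟨_, G, rfl⟩, hG⟩ := ContinuousMap.exists_mem_subalgebra_near_continuous_of_separatesPoints
    A hA (fun u : K => g u) hg.domRestrict δ hδ
  refine ⟨G, fun u hu => ?_⟩
  have := hG ⟨u, hu⟩
  rw [← hev G ⟨u, hu⟩]
  exact this

end MvPolynomial

/-- **Borsuk–Ulam theorem**: an odd continuous map from the `n`-sphere to `ℝ ^ n` has a zero. -/
theorem exists_eq_zero_of_odd_on_sphere {n : ℕ} {g : (Fin (n + 1) → ℝ) → Fin n → ℝ}
    (hg : ContinuousOn g {u | ∑ i, u i ^ 2 = 1}) (hodd : ∀ u, g (-u) = -g u) :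
    ∃ u : Fin (n + 1) → ℝ, ∑ i, u i ^ 2 = 1 ∧ g u = 0 := by
  set K : Set (Fin (n + 1) → ℝ) := {u | ∑ i, u i ^ 2 = 1} with hKdef
  have habs {u} (hu : u ∈ K) (i) : |u i| ≤ 1 := by
    rw [← sq_le_one_iff_abs_le_one, ← show ∑ i, u i ^ 2 = 1 from hu]
    exact Finset.single_le_sum (f := fun i => u i ^ 2) (fun i _ => sq_nonneg _) (Finset.mem_univ i)
  have hK : IsCompact K := by
    refine Metric.isCompact_of_isClosed_isBounded
      (isClosed_eq (by fun_prop) continuous_const)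
      ((Metric.isBounded_closedBall (x := 0) (r := 1)).subset fun u hu => ?_)
    rw [mem_closedBall_zero_iff, pi_norm_le_iff_of_nonneg zero_le_one]
    exact habs hu
  have hKne : K.Nonempty := ⟨Pi.single 0 1, by simp [K, Pi.single_apply]⟩
  obtain ⟨w, hwK, hw⟩ := hK.exists_isMinOn hKne hg.norm
  by_contra! hne
  have hc : 0 < ‖g w‖ := norm_pos_iff.2 (hne w hwK)
  set δ := ‖g w‖ / 4 with hδ
  have hδ0 : 0 < δ := by positivity
  choose G hG using fun i => MvPolynomial.exists_abs_eval_sub_lt hK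
    ((continuous_apply i).comp_continuousOn hg) hδ0
  set m := 2 * ∑ i, (G i).totalDegree + 1 with hm
  have hmodd : Odd m := ⟨_, rfl⟩
  have hGm (i) : (G i).totalDegree ≤ m := by
    have := Finset.single_le_sum (f := fun i => (G i).totalDegree) (fun _ _ => Nat.zero_le _)
      (Finset.mem_univ i)
    lia
  choose q hqm hq using fun i => MvPolynomial.exists_dehomogenize_odd_part hmodd (hGm i)
  obtain ⟨ε, hε, hεδ, x, hx⟩ := MvPolynomial.exists_eval_add_eq_zero hmodd hqm hδ0
  set ρ := √(1 + ∑ i, x i ^ 2) with hρdef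
  have hpos : 0 < 1 + ∑ i, x i ^ 2 := by positivity
  have hρ : 0 < ρ := Real.sqrt_pos.2 hpos
  have hρ2 : ρ ^ 2 = 1 + ∑ i, x i ^ 2 := Real.sq_sqrt hpos.le
  let u : Fin (n + 1) → ℝ := ρ⁻¹ • Fin.cons 1 x
  have hu : (Fin.cons 1 x : Fin (n + 1) → ℝ) = ρ • u := (smul_inv_smul₀ hρ.ne' _).symm
  have huK : u ∈ K := by
    have : ∑ i, u i ^ 2 = (ρ⁻¹) ^ 2 * (1 + ∑ i, x i ^ 2) := by
      simp [u, Fin.sum_univ_succ, mul_pow, Finset.mul_sum, mul_add]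
    change ∑ i, u i ^ 2 = 1
    rw [this, ← hρ2]
    field_simp
  have hnegK : -u ∈ K := by simpa [K] using huK
  have hlt : ‖g u‖ < ‖g w‖ := by
    refine (pi_norm_lt_iff hc).2 fun i => ?_
    have h1 := abs_lt.1 (hG i u huK)
    have h2 := abs_lt.1 (hG i (-u) hnegK)
    simp only [Function.comp_apply, hodd, Pi.neg_apply] at h1 h2
    have h3 := hx i
    rw [hq i x ρ u hρ2 hu, show x i = ρ * u i.succ from congrFun hu i.succ, mul_pow] at h3
    have h4 : ε * u i.succ ^ m + ((MvPolynomial.eval u (G i)) - MvPolynomial.eval (-u) (G i)) / 2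
        = 0 := by
      refine (mul_eq_zero_iff_left (pow_pos hρ m).ne').1 ?_
      linear_combination h3
    have h5 : |ε * u i.succ ^ m| ≤ ε := by
      rw [abs_mul, abs_pow, abs_of_pos hε]
      exact mul_le_of_le_one_right hε.le (pow_le_one₀ (abs_nonneg _) (habs huK _))
    have h6 := abs_le.1 h5
    rw [Real.norm_eq_abs, abs_lt]
    constructor <;> linarith [h1.1, h1.2, h2.1, h2.2, h6.1, h6.2]
  exact absurd (hw huK) (not_le_of_gt hlt)

/-- Append a coordinate that makes the coordinates sum to zero, and take positive parts. -/
def balancedPosPart {n : ℕ} (u : Fin (n + 1) → ℝ) (i : Fin (n + 2)) : ℝ :=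
  max ((Fin.cons (-∑ j, u j) u : Fin (n + 2) → ℝ) i) 0

theorem continuous_balancedPosPart {n : ℕ} :
    Continuous (balancedPosPart : (Fin (n + 1) → ℝ) → Fin (n + 2) → ℝ) := by
  refine continuous_pi fun i => Continuous.max ?_ continuous_const
  cases i using Fin.cases <;> simp only [Fin.cons_zero, Fin.cons_succ] <;> fun_prop

theorem balancedPosPart_eq_zero_or {n : ℕ} (u : Fin (n + 1) → ℝ) (i : Fin (n + 2)) :
    balancedPosPart u i = 0 ∨ balancedPosPart (-u) i = 0 := by
  have h : (Fin.cons (-∑ j, (-u) j) (-u) : Fin (n + 2) → ℝ) i =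
      -(Fin.cons (-∑ j, u j) u : Fin (n + 2) → ℝ) i := by
    cases i using Fin.cases <;> simp
  rw [balancedPosPart, balancedPosPart, h]
  rcases le_total ((Fin.cons (-∑ j, u j) u : Fin (n + 2) → ℝ) i) 0 with h0 | h0
  · exact Or.inl (max_eq_right h0)
  · exact Or.inr (max_eq_right (neg_nonpos.2 h0))

theorem sum_balancedPosPart_pos {n : ℕ} {u : Fin (n + 1) → ℝ} (hu : u ≠ 0) :
    0 < ∑ i, balancedPosPart u i := by
  by_contra! h
  set w : Fin (n + 2) → ℝ := Fin.cons (-∑ j, u j) u with hw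
  have hle (i) : w i ≤ 0 := by
    refine (le_max_left _ 0).trans (le_trans ?_ h)
    exact Finset.single_le_sum (f := balancedPosPart u) (fun _ _ => le_max_right _ _)
      (Finset.mem_univ i)
  have hsum : ∑ i, w i = 0 := by simp [hw, Fin.sum_univ_succ (n := n + 1)]
  have hzero := (Finset.sum_eq_zero_iff_of_nonpos fun i _ => hle i).1 hsum
  exact hu (funext fun i => hzero i.succ (Finset.mem_univ _))

/-- **Topological Radon theorem** (Bajmóczy–Bárány).
For every continuous map `f` from the standard `(d+1)`-dimensional simplex
`Δ_{d+1} ⊆ ℝ^{d+2}` to `ℝ^d` there are two disjoint faces of `Δ_{d+1}` whose images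
intersect: there are disjoint sets `S, T` of vertices and points `x, y` of the simplex
supported on `S` resp. `T` with `f x = f y`. -/
theorem topological_radon
    (d : ℕ)
    (f : {x : Fin (d + 2) → ℝ // (∀ i, 0 ≤ x i) ∧ ∑ i, x i = 1} → (Fin d → ℝ))
    (hf : Continuous f) :
    ∃ S T : Set (Fin (d + 2)), Disjoint S T ∧
      ∃ x y : {x : Fin (d + 2) → ℝ // (∀ i, 0 ≤ x i) ∧ ∑ i, x i = 1},
        {i | x.1 i ≠ 0} ⊆ S ∧ {i | y.1 i ≠ 0} ⊆ T ∧ f x = f y := by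
  classical
  let Δ : Set (Fin (d + 2) → ℝ) := {x | (∀ i, 0 ≤ x i) ∧ ∑ i, x i = 1}
  let F : (Fin (d + 2) → ℝ) → Fin d → ℝ := fun x => if hx : x ∈ Δ then f ⟨x, hx⟩ else 0
  have hFf (x : Δ) : F x = f x := dif_pos x.2
  have hF : ContinuousOn F Δ := by
    rw [continuousOn_iff_continuous_domRestrict]
    exact hf.congr fun x => (hFf x).symm
  let N : (Fin (d + 1) → ℝ) → ℝ := fun u => ∑ i, balancedPosPart u i
  let P : (Fin (d + 1) → ℝ) → Fin (d + 2) → ℝ := fun u => (N u)⁻¹ • balancedPosPart u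
  let K : Set (Fin (d + 1) → ℝ) := {u | ∑ i, u i ^ 2 = 1}
  have hN {u} (hu : u ∈ K) : 0 < N u := by
    refine sum_balancedPosPart_pos ?_
    rintro rfl
    simp [K] at hu
  have hPΔ : Set.MapsTo P K Δ := by
    refine fun u hu => ⟨fun i => mul_nonneg (inv_nonneg.2 (hN hu).le) (le_max_right _ _), ?_⟩
    simp only [P, Pi.smul_apply, smul_eq_mul, ← Finset.mul_sum]
    exact inv_mul_cancel₀ (hN hu).ne'
  have hNc : Continuous N :=
    continuous_finsetSum _ fun i _ => (continuous_apply i).comp continuous_balancedPosPart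
  have hPc : ContinuousOn P K :=
    (hNc.continuousOn.inv₀ fun u hu => (hN hu).ne').smul continuous_balancedPosPart.continuousOn
  have hneg : Set.MapsTo (fun u : Fin (d + 1) → ℝ => -u) K K := fun u hu => by simpa [K] using hu
  have hFP : ContinuousOn (F ∘ P) K := hF.comp hPc hPΔ
  obtain ⟨u, hu, hgu⟩ := exists_eq_zero_of_odd_on_sphere (g := fun u => F (P u) - F (P (-u)))
    (hFP.sub (hFP.comp continuous_neg.continuousOn hneg)) (fun u => by simp)
  refine ⟨{i | P u i ≠ 0}, {i | P (-u) i ≠ 0}, ?_, ⟨P u, hPΔ hu⟩, ⟨P (-u), hPΔ (hneg hu)⟩,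
    subset_rfl, subset_rfl, ?_⟩
  · rw [Set.disjoint_left]
    intro i hi hi'
    rcases balancedPosPart_eq_zero_or u i with h | h
    · exact hi (by simp [P, h])
    · exact hi' (by simp [P, h])
  · rw [← hFf ⟨P u, hPΔ hu⟩, ← hFf ⟨P (-u), hPΔ (hneg hu)⟩]
    exact sub_eq_zero.1 hgu
end
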